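/- arXiv:1601.04858 — 2 statements merged into one kernel-verified Lean document; each statement's English description precedes it below -/
import Mathlib

section
/- Let $(\xi_1,\ldots,\xi_k)$ be a vector of exchangeable random variables whose distribution is absolutely continuous with respect to Lebesgue measure on $\mathbb{R}^k$. Then $\mathbb{P}\{|\sum_{j=1}^k (-1)^j j\xi_j| \le |\sum_{j=1}^k (-1)^j \xi_j|\} \le C/k$ for an absolute constant $C$. -/
open Finset MeasureTheory

/-- real value of a sign -/
noncomputable def sg (u : ℤˣ) : ℝ := ((u : ℤ) : ℝ)

lemma sg_sq (u : ℤˣ) : sg u * sg u = 1 := by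
  rcases Int.units_eq_one_or u with h | h <;> simp [sg, h]

lemma sg_mul (u v : ℤˣ) : sg (u * v) = sg u * sg v := by simp [sg]

lemma sg_abs (u : ℤˣ) : |sg u| = 1 := by
  rcases Int.units_eq_one_or u with h | h <;> simp [sg, h]

lemma sg_neg_one : sg (-1) = -1 := by simp [sg]
lemma sg_one : sg 1 = 1 := by simp [sg]

section signs
variable {ι : Type} [Fintype ι] [DecidableEq ι]

lemma sum_signs_mul (F : (ι → ℤˣ) → ℝ) (u : ι → ℤˣ) : ∑ s, F (s * u) = ∑ s, F s :=
  Fintype.sum_equiv (Equiv.mulRight u) _ _ (fun _ => rfl)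

lemma sum_sg_sg (j l : ι) (h : j ≠ l) : ∑ s : ι → ℤˣ, sg (s j) * sg (s l) = 0 := by
  have := sum_signs_mul (fun s : ι → ℤˣ => sg (s j) * sg (s l)) (Pi.mulSingle j (-1))
  have h2 : ∀ s : ι → ℤˣ, sg ((s * (Pi.mulSingle j (-1) : ι → ℤˣ)) j)
      * sg ((s * (Pi.mulSingle j (-1) : ι → ℤˣ)) l)
      = - (sg (s j) * sg (s l)) := by
    intro s
    simp [Pi.mulSingle_eq_of_ne h.symm, sg]
  simp only [h2, Finset.sum_neg_distrib] at this
  linarith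

lemma sum_sq_signs (z : ι → ℝ) : ∑ s : ι → ℤˣ, (∑ j, sg (s j) * z j) ^ 2
    = Fintype.card (ι → ℤˣ) * ∑ j, z j ^ 2 := by
  have h1 : ∀ s : ι → ℤˣ, (∑ j, sg (s j) * z j) ^ 2
      = ∑ j, ∑ l, (sg (s j) * sg (s l)) * (z j * z l) := by
    intro s
    rw [sq, Finset.sum_mul_sum]
    refine Finset.sum_congr rfl fun j _ => Finset.sum_congr rfl fun l _ => by ring
  simp only [h1]
  rw [Finset.sum_comm]
  rw [Finset.mul_sum]
  refine Finset.sum_congr rfl fun j _ => ?_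
  rw [Finset.sum_comm, Finset.sum_eq_single j]
  · simp [sg_sq, sq]
  · intro l _ hl
    rw [← Finset.sum_mul, sum_sg_sg j l hl.symm, zero_mul]
  · simp

lemma sum_abs_signs (z : ι → ℝ) (τ : ℝ) (hτ : 0 < τ) (hz : ∑ j, z j ^ 2 ≤ τ ^ 2) :
    ∑ s : ι → ℤˣ, |∑ j, sg (s j) * z j| ≤ Fintype.card (ι → ℤˣ) * τ := by
  have h1 : ∀ s : ι → ℤˣ, |∑ j, sg (s j) * z j|
      ≤ ((∑ j, sg (s j) * z j) ^ 2 / τ + τ) / 2 := by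
    intro s
    set x := ∑ j, sg (s j) * z j
    have : (x ^ 2 / τ + τ) / 2 - |x| = (|x| - τ) ^ 2 / (2 * τ) := by
      field_simp
      rw [← sq_abs x]; ring
    have h2 : 0 ≤ (|x| - τ) ^ 2 / (2 * τ) := by positivity
    linarith
  refine (Finset.sum_le_sum fun s _ => h1 s).trans ?_
  rw [← Finset.sum_div, Finset.sum_add_distrib, ← Finset.sum_div, sum_sq_signs]
  simp only [Finset.sum_const, Finset.card_univ, nsmul_eq_mul]
  have hN : (0:ℝ) ≤ Fintype.card (ι → ℤˣ) := by positivity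
  have : (Fintype.card (ι → ℤˣ) : ℝ) * ∑ j, z j ^ 2 ≤ Fintype.card (ι → ℤˣ) * τ ^ 2 := by gcongr
  have h3 : (Fintype.card (ι → ℤˣ) : ℝ) * ∑ j, z j ^ 2 / 1 / τ ≤ Fintype.card (ι → ℤˣ) * τ := by
    simp only [div_one]
    rw [← Finset.sum_div, ← mul_div_assoc, div_le_iff₀ hτ]; nlinarith
  rw [show (∑ j, z j ^ 2 / 1 / τ) = (∑ j, z j ^ 2) / τ by simp [Finset.sum_div]] at h3
  rw [mul_div_assoc]
  linarith

lemma sum_cos_signs (M : ℝ) (b : ι → ℝ) :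
    ∑ s : ι → ℤˣ, Real.cos (M + ∑ j, sg (s j) * b j)
      ≤ Fintype.card (ι → ℤˣ) * ∏ j, |Real.cos (b j)| := by
  have h1 : ∑ s : ι → ℤˣ, Complex.exp (((M + ∑ j, sg (s j) * b j : ℝ) : ℂ) * Complex.I)
      = Complex.exp (M * Complex.I) * ∏ j, (2 * Complex.cos (b j)) := by
    have h2 : ∀ j, (2 * Complex.cos (b j)) = ∑ u : ℤˣ, Complex.exp ((sg u * b j : ℝ) * Complex.I) := by
      intro j
      rw [Complex.cos, mul_div_cancel₀ _ two_ne_zero]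
      rw [show (Finset.univ : Finset ℤˣ) = {1, -1} from rfl, Finset.sum_pair (by decide)]
      simp [sg_one, sg_neg_one]
    simp only [h2]
    rw [Finset.prod_univ_sum, Finset.mul_sum, Fintype.piFinset_univ]
    refine Finset.sum_congr rfl fun s _ => ?_
    rw [← Complex.exp_sum, ← Complex.exp_add]
    congr 1
    push_cast
    rw [← Finset.sum_mul]; ring
  have h3 : ∑ s : ι → ℤˣ, Real.cos (M + ∑ j, sg (s j) * b j)
      = (∑ s : ι → ℤˣ, Complex.exp (((M + ∑ j, sg (s j) * b j : ℝ) : ℂ) * Complex.I)).re := by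
    rw [Complex.re_sum]
    refine Finset.sum_congr rfl fun s _ => ?_
    rw [Complex.exp_ofReal_mul_I_re]
  rw [h3, h1]
  refine (Complex.re_le_norm _).trans ?_
  rw [norm_mul, Complex.norm_exp_ofReal_mul_I, one_mul, norm_prod]
  have : ∀ j, ‖2 * Complex.cos (b j)‖ = 2 * |Real.cos (b j)| := by
    intro j
    rw [norm_mul, ← Complex.ofReal_cos, Complex.norm_real]; simp
  simp only [this, Finset.prod_mul_distrib]
  simp

lemma kernel_nonneg (x : ℝ) : 0 ≤ ∫ θ in (0:ℝ)..1, (1 - θ) * Real.cos (θ * x) := by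
  by_cases hx : x = 0
  · apply intervalIntegral.integral_nonneg (by norm_num)
    intro u hu; simp [hx]; linarith [hu.2]
  · have hd : ∀ θ ∈ Set.uIcc (0:ℝ) 1, HasDerivAt
        (fun θ => (1 - θ) * Real.sin (θ * x) / x - Real.cos (θ * x) / x ^ 2)
        ((1 - θ) * Real.cos (θ * x)) θ := by
      intro θ _
      have h0 : HasDerivAt (fun θ : ℝ => θ * x) x θ := by simpa using (hasDerivAt_id θ).mul_const x
      have h1 := ((((hasDerivAt_id θ).const_sub 1).mul h0.sin).div_const x).sub
        (h0.cos.div_const (x^2))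
      have h2 : (-1 * Real.sin (θ * x) + (1 - id θ) * (Real.cos (θ * x) * x)) / x
          - -Real.sin (θ * x) * x / x ^ 2 = (1 - θ) * Real.cos (θ * x) := by
        simp only [id]
        field_simp
        ring
      rw [h2] at h1
      exact h1
    rw [intervalIntegral.integral_eq_sub_of_hasDerivAt hd (by
      apply Continuous.intervalIntegrable; fun_prop)]
    simp
    rw [← sub_nonneg, show (x^2)⁻¹ - Real.cos x / x^2 = (1 - Real.cos x) / x^2 by field_simp]
    have := Real.cos_le_one x
    exact div_nonneg (by linarith) (by positivity)

lemma kernel_lower (x : ℝ) (hx : |x| ≤ 1) :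
    1 / 4 ≤ ∫ θ in (0:ℝ)..1, (1 - θ) * Real.cos (θ * x) := by
  have h1 : ∫ θ in (0:ℝ)..1, (1 - θ) * (1 / 2) = 1 / 4 := by
    rw [intervalIntegral.integral_mul_const, intervalIntegral.integral_sub (by simp) (by simp)]
    simp; norm_num
  rw [← h1]
  apply intervalIntegral.integral_mono_on (by norm_num)
  · apply Continuous.intervalIntegrable; fun_prop
  · apply Continuous.intervalIntegrable; fun_prop
  · intro θ hθ
    apply mul_le_mul_of_nonneg_left _ (by linarith [hθ.2])
    have h2 := Real.one_sub_sq_div_two_le_cos (x := θ * x)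
    have h3 : (θ * x) ^ 2 ≤ 1 := by
      rw [sq_le_one_iff_abs_le_one, abs_mul, abs_of_nonneg hθ.1]
      calc θ * |x| ≤ 1 * 1 := mul_le_mul hθ.2 hx (abs_nonneg _) zero_le_one
        _ = 1 := by ring
    linarith

lemma abs_cos_le (x : ℝ) (hx : |x| ≤ 1) : |Real.cos x| ≤ Real.exp (- (x ^ 2 / 9)) := by
  have hpi := Real.pi_gt_three
  have hpi2 := Real.pi_lt_four
  have h0 : 0 ≤ Real.cos x := by
    apply Real.cos_nonneg_of_mem_Icc
    constructor <;> linarith [abs_le.mp hx]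
  rw [abs_of_nonneg h0]
  have h1 := Real.cos_le_one_sub_mul_cos_sq (x := x) (by linarith)
  have h2 := Real.add_one_le_exp (- (x ^ 2 / 9))
  have h3 : 1 / 9 ≤ 2 / Real.pi ^ 2 := by
    rw [div_le_div_iff₀ (by norm_num) (by positivity)]; nlinarith
  nlinarith [sq_nonneg x]

lemma lo (M L w : ℝ) (b : ι → ℝ) (hL : 0 < L) (hw : 0 < w) (hb : ∀ j, |b j| ≤ L)
    (hV : w ^ 2 ≤ ∑ j, b j ^ 2) :
    ∑ s : ι → ℤˣ, (if |M + ∑ j, sg (s j) * b j| ≤ L then (1:ℝ) else 0)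
      ≤ Fintype.card (ι → ℤˣ) * (20 * L / w) := by
  set N : ℝ := (Fintype.card (ι → ℤˣ) : ℝ) with hN
  have hN0 : 0 ≤ N := by positivity
  have h1 : ∀ s : ι → ℤˣ, (if |M + ∑ j, sg (s j) * b j| ≤ L then (1:ℝ) else 0) ≤
      4 * ∫ θ in (0:ℝ)..1, (1 - θ) * Real.cos (θ * ((M + ∑ j, sg (s j) * b j) / L)) := by
    intro s
    split_ifs with h
    · have := kernel_lower ((M + ∑ j, sg (s j) * b j) / L) (by
        rw [abs_div, abs_of_pos hL, div_le_one hL]; exact h)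
      linarith
    · have := kernel_nonneg ((M + ∑ j, sg (s j) * b j) / L)
      linarith
  refine (Finset.sum_le_sum fun s _ => h1 s).trans ?_
  rw [← Finset.mul_sum, ← intervalIntegral.integral_finsetSum
    (fun s _ => by apply Continuous.intervalIntegrable; fun_prop)]
  set a : ℝ := w / (3 * L) with ha
  have ha0 : 0 < a := by positivity
  have h2 : ∫ θ in (0:ℝ)..1, ∑ s : ι → ℤˣ, (1 - θ) * Real.cos (θ * ((M + ∑ j, sg (s j) * b j) / L))
      ≤ ∫ θ in (0:ℝ)..1, N * (1 + (a * θ) ^ 2)⁻¹ := by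
    apply intervalIntegral.integral_mono_on (by norm_num)
    · apply Continuous.intervalIntegrable; fun_prop
    · apply Continuous.intervalIntegrable
      apply Continuous.mul continuous_const
      apply Continuous.inv₀ (by fun_prop)
      intro θ; positivity
    · intro θ hθ
      rw [← Finset.mul_sum]
      have h3 := sum_cos_signs (θ * M / L) (fun j => θ * b j / L)
      have h4 : ∀ s : ι → ℤˣ, θ * ((M + ∑ j, sg (s j) * b j) / L)
          = θ * M / L + ∑ j, sg (s j) * (θ * b j / L) := by
        intro s
        rw [mul_div_assoc', mul_add, add_div, Finset.mul_sum, Finset.sum_div]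
        congr 1
        refine Finset.sum_congr rfl fun j _ => by ring
      simp only [h4]
      have h5 : ∏ j, |Real.cos (θ * b j / L)| ≤ (1 + (a * θ) ^ 2)⁻¹ := by
        calc ∏ j, |Real.cos (θ * b j / L)| ≤ ∏ j, Real.exp (- ((θ * b j / L) ^ 2 / 9)) := by
              apply Finset.prod_le_prod (fun _ _ => abs_nonneg _)
              intro j _
              apply abs_cos_le
              rw [abs_div, abs_mul, abs_of_nonneg hθ.1, abs_of_pos hL, div_le_one hL]
              calc θ * |b j| ≤ 1 * L := mul_le_mul hθ.2 (hb j) (abs_nonneg _) zero_le_one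
                _ = L := one_mul L
          _ = Real.exp (- ((∑ j, b j ^ 2) * (θ ^ 2 / (9 * L ^ 2)))) := by
              rw [← Real.exp_sum, Finset.sum_neg_distrib, Finset.sum_mul]
              congr 2
              refine Finset.sum_congr rfl fun j _ => ?_
              field_simp
          _ ≤ Real.exp (- (a * θ) ^ 2) := by
              apply Real.exp_le_exp.mpr
              apply neg_le_neg
              calc (a * θ) ^ 2 = w ^ 2 * (θ ^ 2 / (9 * L ^ 2)) := by rw [ha]; field_simp; ring
                _ ≤ _ := by gcongr
          _ ≤ (1 + (a * θ) ^ 2)⁻¹ := by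
              rw [Real.exp_neg]
              apply inv_anti₀ (by positivity)
              linarith [Real.add_one_le_exp ((a * θ) ^ 2)]
      have h6 : ∑ s : ι → ℤˣ, Real.cos (θ * M / L + ∑ j, sg (s j) * (θ * b j / L))
          ≤ N * (1 + (a * θ) ^ 2)⁻¹ := h3.trans (by gcongr)
      have h7 : 0 ≤ N * (1 + (a * θ) ^ 2)⁻¹ := by positivity
      nlinarith [hθ.1, hθ.2]
  have h8 : ∫ θ in (0:ℝ)..1, N * (1 + (a * θ) ^ 2)⁻¹ ≤ N * (5 * L / w) := by
    rw [intervalIntegral.integral_const_mul]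
    apply mul_le_mul_of_nonneg_left _ hN0
    have := intervalIntegral.integral_comp_mul_left (a := 0) (b := 1)
      (fun x : ℝ => (1 + x ^ 2)⁻¹) ha0.ne'
    rw [this, integral_inv_one_add_sq]
    simp only [mul_zero, mul_one, Real.arctan_zero, sub_zero, smul_eq_mul]
    have h9 := (Real.arctan_lt_pi_div_two a).le
    have h10 : Real.pi < 3.15 := Real.pi_lt_d2
    calc a⁻¹ * Real.arctan a ≤ a⁻¹ * (5 / 3) := by
          gcongr; linarith
      _ = 5 * L / w := by rw [ha]; field_simp
  calc 4 * _ ≤ 4 * (N * (5 * L / w)) := by gcongr; exact h2.trans h8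
    _ = _ := by ring

end signs

section decoupling
variable {ι : Type} [Fintype ι] [DecidableEq ι]

lemma greedy (f : ι → ℝ) (β : ℝ) (hβ : 0 ≤ β) (hf0 : ∀ j, 0 ≤ f j) (hf : ∀ j, f j ≤ β)
    (T : Finset ι) :
    ∃ A : Finset ι, |∑ j ∈ T, (if j ∈ A then f j else 0) - ∑ j ∈ T, (if j ∈ A then 0 else f j)| ≤ β := by
  induction T using Finset.induction_on with
  | empty => exact ⟨∅, by simpa using hβ⟩
  | insert x T hx ih =>
    obtain ⟨A, hA⟩ := ih
    have key : ∀ A' : Finset ι, (∀ j ∈ T, (j ∈ A' ↔ j ∈ A)) →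
        ∑ j ∈ T, (if j ∈ A' then f j else 0) = ∑ j ∈ T, (if j ∈ A then f j else 0) ∧
        ∑ j ∈ T, (if j ∈ A' then 0 else f j) = ∑ j ∈ T, (if j ∈ A then 0 else f j) := by
      intro A' h
      constructor <;> exact Finset.sum_congr rfl fun j hj => by simp [h j hj]
    have hxT : ∀ j ∈ T, j ≠ x := fun j hj h => hx (h ▸ hj)
    by_cases hs : 0 ≤ ∑ j ∈ T, (if j ∈ A then f j else 0) - ∑ j ∈ T, (if j ∈ A then 0 else f j)
    · refine ⟨A.erase x, ?_⟩
      obtain ⟨h1, h2⟩ := key (A.erase x) (fun j hj => by simp [hxT j hj])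
      rw [Finset.sum_insert hx, Finset.sum_insert hx, h1, h2]
      simp only [Finset.mem_erase, ne_eq, not_true_eq_false, false_and, if_false]
      rw [abs_le] at hA ⊢
      constructor <;> linarith [hf x, hf0 x]
    · refine ⟨insert x A, ?_⟩
      obtain ⟨h1, h2⟩ := key (insert x A) (fun j hj => by simp [hxT j hj])
      rw [Finset.sum_insert hx, Finset.sum_insert hx, h1, h2]
      simp only [Finset.mem_insert, true_or, if_true]
      rw [abs_le] at hA ⊢
      constructor <;> linarith [hf x, hf0 x]

lemma decoup_half (A : Finset ι) (M L w τ : ℝ) (b z : ι → ℝ) (hL : 0 < L) (hw : 0 < w) (hτ : 0 < τ)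
    (hb : ∀ j, |b j| ≤ L) (hz : ∑ j, z j ^ 2 ≤ τ ^ 2)
    (hV : w ^ 2 ≤ ∑ j, (if j ∈ A then 0 else b j ^ 2)) :
    ∑ s : ι → ℤˣ, |∑ j, sg (s j) * (if j ∈ A then z j else 0)| *
      (if |M + ∑ j, sg (s j) * b j| ≤ L then (1:ℝ) else 0)
      ≤ Fintype.card (ι → ℤˣ) * (τ * (20 * L / w)) := by
  set N : ℝ := (Fintype.card (ι → ℤˣ) : ℝ) with hN
  have hN0 : 0 < N := by rw [hN]; exact_mod_cast Fintype.card_pos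
  set F : (ι → ℤˣ) → ℝ := fun s => |∑ j, sg (s j) * (if j ∈ A then z j else 0)| *
      (if |M + ∑ j, sg (s j) * b j| ≤ L then (1:ℝ) else 0) with hF
  have h1 : N * ∑ s, F s = ∑ s : ι → ℤˣ, ∑ t : ι → ℤˣ, F (s * (fun j => if j ∈ A then 1 else t j)) := by
    rw [Finset.sum_comm]
    simp_rw [sum_signs_mul F]
    simp [hN]
  have h2 : ∀ s t : ι → ℤˣ, F (s * (fun j => if j ∈ A then 1 else t j))
      = |∑ j, sg (s j) * (if j ∈ A then z j else 0)| *
      (if |(M + ∑ j, sg (s j) * (if j ∈ A then b j else 0)) +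
        ∑ j, sg (t j) * (if j ∈ A then 0 else sg (s j) * b j)| ≤ L then (1:ℝ) else 0) := by
    intro s t
    simp only [hF]
    have e1 : ∑ j, sg ((s * (fun j => if j ∈ A then 1 else t j)) j) * (if j ∈ A then z j else 0)
        = ∑ j, sg (s j) * (if j ∈ A then z j else 0) := by
      refine Finset.sum_congr rfl fun j _ => ?_
      by_cases h : j ∈ A <;> simp [h]
    have e2 : M + ∑ j, sg ((s * (fun j => if j ∈ A then 1 else t j)) j) * b j
        = (M + ∑ j, sg (s j) * (if j ∈ A then b j else 0)) +
        ∑ j, sg (t j) * (if j ∈ A then 0 else sg (s j) * b j) := by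
      rw [add_assoc, ← Finset.sum_add_distrib]
      congr 1
      refine Finset.sum_congr rfl fun j _ => ?_
      by_cases h : j ∈ A <;> simp [h, sg_mul]
      ring
    rw [e1, e2]
  have h3 : ∀ s : ι → ℤˣ, ∑ t : ι → ℤˣ, F (s * (fun j => if j ∈ A then 1 else t j))
      ≤ |∑ j, sg (s j) * (if j ∈ A then z j else 0)| * (N * (20 * L / w)) := by
    intro s
    simp only [h2]
    rw [← Finset.mul_sum]
    apply mul_le_mul_of_nonneg_left _ (abs_nonneg _)
    apply lo _ _ _ _ hL hw
    · intro j
      by_cases h : j ∈ A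
      · simp [h, hL.le]
      · simp [h, abs_mul, sg_abs, hb j]
    · refine hV.trans (le_of_eq ?_)
      refine Finset.sum_congr rfl fun j _ => ?_
      by_cases h : j ∈ A
      · simp [h]
      · have := sg_sq (s j)
        simp only [h, if_false]
        rw [mul_pow, sq (sg (s j)), this, one_mul]
  have h4 := sum_abs_signs (fun j => if j ∈ A then z j else 0) τ hτ (by
    refine le_trans (Finset.sum_le_sum fun j _ => ?_) hz
    by_cases h : j ∈ A <;> simp [h, sq_nonneg])
  have h5 : N * ∑ s, F s ≤ N * (N * (τ * (20 * L / w))) := by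
    rw [h1]
    refine (Finset.sum_le_sum fun s _ => h3 s).trans ?_
    rw [← Finset.sum_mul]
    calc _ ≤ (N * τ) * (N * (20 * L / w)) := by gcongr
      _ = _ := by ring
  exact le_of_mul_le_mul_left h5 hN0

lemma decoup (M L w τ : ℝ) (b z : ι → ℝ) (hL : 0 < L) (hw : 0 < w) (hτ : 0 < τ)
    (hb : ∀ j, |b j| ≤ L) (hz : ∑ j, z j ^ 2 ≤ τ ^ 2)
    (hV : 2 * w ^ 2 + L ^ 2 ≤ ∑ j, b j ^ 2) :
    ∑ s : ι → ℤˣ, |∑ j, sg (s j) * z j| *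
      (if |M + ∑ j, sg (s j) * b j| ≤ L then (1:ℝ) else 0)
      ≤ Fintype.card (ι → ℤˣ) * (τ * (40 * L / w)) := by
  obtain ⟨A, hA⟩ := greedy (fun j => b j ^ 2) (L ^ 2) (by positivity) (fun j => sq_nonneg _)
    (fun j => sq_le_sq' (by linarith [abs_le.mp (hb j)]) (abs_le.mp (hb j)).2) Finset.univ
  have hsum : ∑ j, b j ^ 2 = ∑ j, (if j ∈ A then b j ^ 2 else 0) + ∑ j, (if j ∈ A then 0 else b j ^ 2) := by
    rw [← Finset.sum_add_distrib]
    refine Finset.sum_congr rfl fun j _ => ?_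
    by_cases h : j ∈ A <;> simp [h]
  rw [abs_le] at hA
  have h1 := decoup_half A M L w τ b z hL hw hτ hb hz (by linarith)
  have h2 := decoup_half Aᶜ M L w τ b z hL hw hτ hb hz (by
    simp only [Finset.mem_compl, ite_not]; linarith)
  calc _ ≤ ∑ s : ι → ℤˣ, (|∑ j, sg (s j) * (if j ∈ A then z j else 0)| *
      (if |M + ∑ j, sg (s j) * b j| ≤ L then (1:ℝ) else 0) +
      |∑ j, sg (s j) * (if j ∈ Aᶜ then z j else 0)| *
      (if |M + ∑ j, sg (s j) * b j| ≤ L then (1:ℝ) else 0)) := by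
        refine Finset.sum_le_sum fun s _ => ?_
        rw [← add_mul]
        apply mul_le_mul_of_nonneg_right _ (by split_ifs <;> norm_num)
        refine le_trans (le_of_eq ?_) (abs_add_le _ _)
        rw [← Finset.sum_add_distrib]
        congr 1
        refine Finset.sum_congr rfl fun j _ => ?_
        by_cases h : j ∈ A <;> simp [h]
    _ ≤ _ := by
        rw [Finset.sum_add_distrib]
        refine (add_le_add h1 h2).trans (le_of_eq ?_)
        ring

lemma exists_perm_two {i l i' l' : ι} (h : i ≠ l) (h' : i' ≠ l') :
    ∃ σ : Equiv.Perm ι, σ i = i' ∧ σ l = l' := by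
  refine ⟨Equiv.swap (Equiv.swap i i' l) l' * Equiv.swap i i', ?_, ?_⟩
  · rw [Equiv.Perm.mul_apply, Equiv.swap_apply_left]
    apply Equiv.swap_apply_of_ne_of_ne _ h'
    intro e
    have : Equiv.swap i i' i = Equiv.swap i i' l := by rw [Equiv.swap_apply_left]; exact e
    exact h ((Equiv.swap i i').injective this)
  · simp [Equiv.Perm.mul_apply]

lemma sum_perm_mul (F : Equiv.Perm ι → ℝ) (σ : Equiv.Perm ι) : ∑ π, F (π * σ) = ∑ π, F π :=
  Fintype.sum_equiv (Equiv.mulRight σ) _ _ (fun _ => rfl)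

lemma perm_var (a u : ι → ℝ) (A : ℝ) (ha0 : ∀ i, |a i - A| ≤ 1) (hA : ∑ i, (a i - A) = 0) :
    ∑ π : Equiv.Perm ι, (∑ i, a i * u (π i) - A * ∑ j, u j) ^ 2
      ≤ Fintype.card (Equiv.Perm ι) * (2 * ∑ j, u j ^ 2) := by
  classical
  set h : ι → ℝ := fun i => a i - A with hh
  set G : ι → ι → ℝ := fun i l => ∑ π : Equiv.Perm ι, u (π i) * u (π l) with hG
  have hG1 : ∀ i l, G i i = G l l := by
    intro i l
    have := sum_perm_mul (fun π => u (π l) * u (π l)) (Equiv.swap i l)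
    simp only [Equiv.Perm.mul_apply, Equiv.swap_apply_right] at this
    exact this
  have hG2 : ∀ i l i' l', i ≠ l → i' ≠ l' → G i l = G i' l' := by
    intro i l i' l' h1 h2
    obtain ⟨σ, e1, e2⟩ := exists_perm_two h2 h1
    have := sum_perm_mul (fun π => u (π i') * u (π l')) σ
    simp only [Equiv.Perm.mul_apply, e1, e2] at this
    exact this
  have hG3 : ∀ i l, |G i l| ≤ (G i i + G l l) / 2 := by
    intro i l
    simp only [hG]
    refine (Finset.abs_sum_le_sum_abs _ _).trans ?_
    rw [← Finset.sum_add_distrib, Finset.sum_div]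
    refine Finset.sum_le_sum fun π _ => ?_
    rw [abs_le]
    constructor <;> nlinarith [sq_nonneg (u (π i) + u (π l)), sq_nonneg (u (π i) - u (π l))]
  have hX : ∀ π : Equiv.Perm ι, ∑ i, a i * u (π i) - A * ∑ j, u j = ∑ i, h i * u (π i) := by
    intro π
    rw [← Equiv.sum_comp π u, Finset.mul_sum, ← Finset.sum_sub_distrib]
    refine Finset.sum_congr rfl fun i _ => by simp only [hh]; ring
  have hmain : ∑ π : Equiv.Perm ι, (∑ i, h i * u (π i)) ^ 2 = ∑ i, ∑ l, h i * h l * G i l := by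
    have : ∀ π : Equiv.Perm ι, (∑ i, h i * u (π i)) ^ 2
        = ∑ i, ∑ l, h i * h l * (u (π i) * u (π l)) := by
      intro π
      rw [sq, Finset.sum_mul_sum]
      refine Finset.sum_congr rfl fun j _ => Finset.sum_congr rfl fun l _ => by ring
    simp only [this]
    rw [Finset.sum_comm]
    refine Finset.sum_congr rfl fun i _ => ?_
    rw [Finset.sum_comm]
    refine Finset.sum_congr rfl fun l _ => ?_
    simp only [hG]
    rw [Finset.mul_sum]
  obtain ⟨α, hα⟩ : ∃ α, ∀ i, G i i = α := by
    by_cases hne : Nonempty ι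
    · exact ⟨G hne.some hne.some, fun i => hG1 _ _⟩
    · exact ⟨0, fun i => (hne ⟨i⟩).elim⟩
  obtain ⟨β, hβ, hβ2⟩ : ∃ β, (∀ i l, i ≠ l → G i l = β) ∧ ((∃ i : ι, True) → |β| ≤ α) := by
    by_cases hne : ∃ i l : ι, i ≠ l
    · obtain ⟨i, l, hil⟩ := hne
      refine ⟨G i l, fun i' l' h' => hG2 _ _ _ _ h' hil, fun _ => ?_⟩
      have := hG3 i l
      rw [hα, hα] at this
      linarith
    · refine ⟨0, fun i l h => (hne ⟨i, l, h⟩).elim, ?_⟩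
      rintro ⟨i, -⟩
      rw [abs_zero, ← hα i]
      exact Finset.sum_nonneg fun π _ => mul_self_nonneg _
  have h5 : ∑ i, ∑ l, h i * h l * G i l = (α - β) * ∑ i, h i ^ 2 := by
    have : ∀ i l, h i * h l * G i l = β * (h i * h l) + (if i = l then (α - β) * h i ^ 2 else 0) := by
      intro i l
      by_cases e : i = l
      · subst e; rw [hα]; simp; ring
      · rw [hβ i l e]; simp [e]; ring
    simp only [this, Finset.sum_add_distrib, ← Finset.mul_sum, ← Finset.sum_mul]
    have hA' : ∑ i, h i = 0 := hA
    simp [hA', Finset.mul_sum]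
  simp only [hX, hmain, h5]
  by_cases hne : ∃ i : ι, True
  · have hab := abs_le.mp (hβ2 hne)
    have h6 : ∑ i, h i ^ 2 ≤ Fintype.card ι := by
      calc ∑ i, h i ^ 2 ≤ ∑ i : ι, (1:ℝ) := Finset.sum_le_sum fun i _ => by
            rw [← sq_abs]; exact pow_le_one₀ (abs_nonneg _) (ha0 i)
        _ = _ := by simp
    have h7 : (Fintype.card ι : ℝ) * α = Fintype.card (Equiv.Perm ι) * ∑ j, u j ^ 2 := by
      calc (Fintype.card ι : ℝ) * α = ∑ i : ι, G i i := by simp [hα]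
        _ = ∑ π : Equiv.Perm ι, ∑ i, u (π i) ^ 2 := by
            simp only [hG]; rw [Finset.sum_comm]; simp only [sq]
        _ = _ := by
            have : ∀ π : Equiv.Perm ι, ∑ i, u (π i) ^ 2 = ∑ j, u j ^ 2 :=
              fun π => Equiv.sum_comp π (fun j => u j ^ 2)
            simp [this]
    have h8 : 0 ≤ ∑ i, h i ^ 2 := Finset.sum_nonneg fun i _ => sq_nonneg _
    nlinarith
  · have : IsEmpty ι := ⟨fun i => hne ⟨i, trivial⟩⟩
    simp

end decoupling

lemma coarse_est (n : ℕ) (hn : 0 < n) (v c z : Fin n → ℝ) (D M σ : ℝ) (hD : 0 < D)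
    (hv0 : ∀ j, 0 ≤ v j) (hvD : ∀ j, v j ≤ D) (hσ : D ≤ σ) (hσ2 : σ ^ 2 = ∑ j, v j ^ 2)
    (hc1 : ∀ i : Fin n, 2 * (i : ℝ) + 1 ≤ c i) (hc2 : ∀ i, c i ≤ 3 * n) (hz : ∀ i, |z i| ≤ 3) :
    ∑ π : Equiv.Perm (Fin n), ∑ s : Fin n → ℤˣ, |∑ j, sg (s j) * (v j * z (π j))| *
      (if |M + ∑ j, sg (s j) * (v j * c (π j))| ≤ 300 * n * D then (1:ℝ) else 0)
    ≤ Fintype.card (Equiv.Perm (Fin n)) * (Fintype.card (Fin n → ℤˣ) * (150000 * D)) := by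
  set N : ℝ := (Fintype.card (Fin n → ℤˣ) : ℝ) with hN
  have hN0 : 0 < N := by rw [hN]; exact_mod_cast Fintype.card_pos
  set P : ℝ := (Fintype.card (Equiv.Perm (Fin n)) : ℝ) with hP
  have hP0 : 0 < P := by rw [hP]; exact_mod_cast Fintype.card_pos
  have hn0 : (0:ℝ) < n := by exact_mod_cast hn
  have hσ0 : 0 < σ := lt_of_lt_of_le hD hσ
  set F : Equiv.Perm (Fin n) → ℝ := fun π => ∑ s : Fin n → ℤˣ, |∑ j, sg (s j) * (v j * z (π j))| *
      (if |M + ∑ j, sg (s j) * (v j * c (π j))| ≤ 300 * n * D then (1:ℝ) else 0) with hF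
  have hzz : ∀ π : Equiv.Perm (Fin n), ∑ j, (v j * z (π j)) ^ 2 ≤ (3 * σ) ^ 2 := by
    intro π
    rw [mul_pow, hσ2, Finset.mul_sum]
    refine Finset.sum_le_sum fun j _ => ?_
    have h1 : z (π j) ^ 2 ≤ 3 ^ 2 := by rw [← sq_abs]; gcongr; exact hz _
    rw [mul_pow]; nlinarith [sq_nonneg (v j)]
  have htriv : ∀ π, F π ≤ N * (3 * σ) := by
    intro π
    refine le_trans (Finset.sum_le_sum fun s _ => ?_)
      (sum_abs_signs (fun j => v j * z (π j)) (3 * σ) (by positivity) (hzz π))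
    apply mul_le_of_le_one_right (abs_nonneg _)
    split_ifs <;> norm_num
  by_cases hcase : σ ≤ 900 * D
  · calc ∑ π, F π ≤ ∑ π : Equiv.Perm (Fin n), N * (3 * σ) := Finset.sum_le_sum fun π _ => htriv π
      _ = P * (N * (3 * σ)) := by simp [hP]
      _ ≤ _ := by
          have h : 3 * σ ≤ 150000 * D := by linarith
          gcongr
  · push Not at hcase
    set a : Fin n → ℝ := fun i => (2 * (i:ℝ) + 1) / (2 * n) with ha
    set X : Equiv.Perm (Fin n) → ℝ := fun π => ∑ j, v j ^ 2 * a (π j) with hX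
    have ha0 : ∀ i, 0 ≤ a i := fun i => by simp only [ha]; positivity
    have ha1 : ∀ i, a i ≤ 1 := fun i => by
      simp only [ha]
      rw [div_le_one (by positivity)]
      have : ((i:ℕ):ℝ) + 1 ≤ n := by exact_mod_cast i.2
      linarith
    have hasum : ∑ i, (a i - 1 / 2) = 0 := by
      rw [Finset.sum_sub_distrib]
      simp only [ha]
      rw [← Finset.sum_div, Fin.sum_univ_eq_sum_range (fun i : ℕ => 2 * (i:ℝ) + 1) n]
      have : ∀ m : ℕ, ∑ i ∈ Finset.range m, (2 * (i:ℝ) + 1) = (m:ℝ) ^ 2 := by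
        intro m
        induction m with
        | zero => simp
        | succ k ih => rw [Finset.sum_range_succ, ih]; push_cast; ring
      rw [this]
      simp
      field_simp
      ring
    have hvar : ∑ π : Equiv.Perm (Fin n), (X π - σ ^ 2 / 2) ^ 2 ≤ P * (2 * (D ^ 2 * σ ^ 2)) := by
      have h1 := perm_var a (fun j => v j ^ 2) (1/2) (fun i => by
        rw [abs_le]; constructor <;> linarith [ha0 i, ha1 i]) hasum
      have h2 : ∑ π : Equiv.Perm (Fin n), (X π - σ ^ 2 / 2) ^ 2 =
          ∑ π : Equiv.Perm (Fin n), (∑ i, a i * v (π i) ^ 2 - 1 / 2 * ∑ j, v j ^ 2) ^ 2 := by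
        refine Fintype.sum_equiv (Equiv.inv _) _ _ fun π => ?_
        have : X π = ∑ i, a i * v (π⁻¹ i) ^ 2 := by
          simp only [hX]
          rw [← Equiv.sum_comp π (fun i => a i * v (π⁻¹ i) ^ 2)]
          simp [mul_comm]
        rw [this, hσ2]
        simp only [Equiv.inv_apply]
        ring
      rw [h2]
      refine h1.trans ?_
      have h3 : ∑ j, (v j ^ 2) ^ 2 ≤ D ^ 2 * σ ^ 2 := by
        rw [hσ2, Finset.mul_sum]
        refine Finset.sum_le_sum fun j _ => ?_
        have : v j ^ 2 ≤ D ^ 2 := by gcongr; exacts [hv0 j, hvD j]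
        nlinarith [sq_nonneg (v j)]
      gcongr
    have hgood : ∀ π, σ ^ 2 / 4 ≤ X π → F π ≤ N * (144000 * D) := by
      intro π hπ
      have := decoup M (300 * n * D) (n * σ / 4) (3 * σ) (fun j => v j * c (π j))
        (fun j => v j * z (π j)) (by positivity) (by positivity) (by positivity)
        (fun j => by
          have h1 := hc1 (π j)
          have h0 : 0 ≤ c (π j) := by linarith [(Nat.cast_nonneg (π j : ℕ) : (0:ℝ) ≤ _)]
          rw [abs_of_nonneg (mul_nonneg (hv0 j) h0)]
          calc v j * c (π j) ≤ D * (3 * n) := mul_le_mul (hvD j) (hc2 _) h0 hD.le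
            _ ≤ _ := by nlinarith [mul_pos hn0 hD]) (hzz π) (by
          have h1 : ∑ j, (v j * c (π j)) ^ 2 ≥ ∑ j, 4 * n ^ 2 * (v j ^ 2 * a (π j) / 2 - v j ^ 2 / 16) := by
            refine Finset.sum_le_sum fun j _ => ?_
            have h2 : (2 * n * a (π j)) ^ 2 ≤ c (π j) ^ 2 := by
              apply pow_le_pow_left₀ (mul_nonneg (by positivity) (ha0 _))
              have : 2 * n * a (π j) = 2 * ((π j : ℕ) : ℝ) + 1 := by simp only [ha]; field_simp
              rw [this]; exact hc1 _
            have h3 : a (π j) / 2 - 1 / 16 ≤ a (π j) ^ 2 := by nlinarith [sq_nonneg (a (π j) - 1/4)]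
            calc 4 * (n:ℝ) ^ 2 * (v j ^ 2 * a (π j) / 2 - v j ^ 2 / 16)
                = v j ^ 2 * (4 * n ^ 2 * (a (π j) / 2 - 1 / 16)) := by ring
              _ ≤ v j ^ 2 * (4 * n ^ 2 * (a (π j) ^ 2)) := by gcongr
              _ = v j ^ 2 * (2 * n * a (π j)) ^ 2 := by ring
              _ ≤ v j ^ 2 * c (π j) ^ 2 := by gcongr
              _ = _ := by ring
          rw [← Finset.mul_sum, Finset.sum_sub_distrib, ← Finset.sum_div, ← Finset.sum_div, ← hσ2] at h1
          have h4 : 4 * (n:ℝ) ^ 2 * (σ ^ 2 / 4 / 2 - σ ^ 2 / 16) ≤ 4 * n ^ 2 * (X π / 2 - σ ^ 2 / 16) := by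
            gcongr
          have h5 : (900 * D) ^ 2 ≤ σ ^ 2 := by gcongr
          have h6 : (n:ℝ) ^ 2 * (900 * D) ^ 2 ≤ n ^ 2 * σ ^ 2 := by gcongr
          have h7 : ∑ j, v j ^ 2 * a (π j) = X π := rfl
          rw [h7] at h1
          have h8 : 0 ≤ (n:ℝ) ^ 2 * D ^ 2 := by positivity
          nlinarith)
      refine this.trans (le_of_eq ?_)
      field_simp
      ring
    have hall : ∀ π, F π ≤ N * (144000 * D) + N * (3 * σ) * ((X π - σ ^ 2 / 2) ^ 2 * (16 / σ ^ 4)) := by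
      intro π
      by_cases h : σ ^ 2 / 4 ≤ X π
      · have h0 : 0 ≤ N * (3 * σ) * ((X π - σ ^ 2 / 2) ^ 2 * (16 / σ ^ 4)) := by positivity
        linarith [hgood π h]
      · push Not at h
        have h1 : 1 ≤ (X π - σ ^ 2 / 2) ^ 2 * (16 / σ ^ 4) := by
          rw [mul_div_assoc', le_div_iff₀ (by positivity)]
          nlinarith [sq_nonneg σ]
        have h2 : N * (3 * σ) * 1 ≤ N * (3 * σ) * ((X π - σ ^ 2 / 2) ^ 2 * (16 / σ ^ 4)) := by gcongr
        have h3 : 0 ≤ N * (144000 * D) := by positivity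
        linarith [htriv π]
    calc ∑ π, F π ≤ _ := Finset.sum_le_sum fun π _ => hall π
      _ = P * (N * (144000 * D)) + N * (3 * σ) * ((∑ π, (X π - σ ^ 2 / 2) ^ 2) * (16 / σ ^ 4)) := by
          rw [Finset.sum_add_distrib, Finset.sum_mul, Finset.mul_sum, Finset.sum_const, Finset.card_univ, nsmul_eq_mul]
      _ ≤ P * (N * (144000 * D)) + N * (3 * σ) * ((P * (2 * (D ^ 2 * σ ^ 2))) * (16 / σ ^ 4)) := by gcongr
      _ = P * (N * (144000 * D + 96 * D * (D / σ))) := by field_simp; ring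
      _ ≤ P * (N * (150000 * D)) := by
          have : D / σ ≤ 1 := (div_le_one hσ0).mpr hσ
          gcongr
          nlinarith


lemma count_spaced (S : Finset ℕ) (m : ℕ) (a : ℕ → ℝ) (D R : ℝ) (hD : 0 < D) (hR : 0 ≤ R)
    (hS : ∀ t ∈ S, t < m ∧ |a t| ≤ R) (ha : ∀ t, t + 1 < m → a t + 2 * D ≤ a (t + 1)) :
    (S.card : ℝ) ≤ R / D + 1 := by
  rcases S.eq_empty_or_nonempty with h | h
  · subst h; simp; positivity
  · set i := S.min' h
    set j := S.max' h
    have hij : i ≤ j := S.min'_le_max' h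
    have hi := hS i (S.min'_mem h)
    have hj := hS j (S.max'_mem h)
    have hmono : ∀ k, i + k < m → a i + 2 * D * k ≤ a (i + k) := by
      intro k
      induction k with
      | zero => intro _; simp
      | succ k ih =>
        intro hk
        have h1 := ih (by omega)
        have h2 := ha (i + k) (by omega)
        rw [← add_assoc]; push_cast; linarith
    have h1 := hmono (j - i) (by omega)
    rw [Nat.add_sub_cancel' hij, Nat.cast_sub hij] at h1
    have h2 : S ⊆ Finset.Icc i j := fun t ht =>
      Finset.mem_Icc.mpr ⟨S.min'_le t ht, S.le_max' t ht⟩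
    have h3 := Finset.card_le_card h2
    rw [Nat.card_Icc] at h3
    have h4 : S.card + i ≤ j + 1 := by omega
    have h5 : (S.card : ℝ) + i ≤ j + 1 := by exact_mod_cast h4
    have h6 : (j:ℝ) - i ≤ R / D := by
      rw [le_div_iff₀ hD]
      linarith [abs_le.mp hi.2, abs_le.mp hj.2]
    linarith

lemma chain_abs {Ω : Type} [Fintype Ω] [DecidableEq Ω] (m : ℕ) (r : Ω → ℕ)
    (suc pre : Ω → Ω) (hr : ∀ ω, r ω < m)
    (h1 : ∀ ω, r ω + 1 < m → r (suc ω) = r ω + 1 ∧ pre (suc ω) = ω)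
    (h2 : ∀ ω, 0 < r ω → r (pre ω) + 1 = r ω ∧ suc (pre ω) = ω)
    (f g : Ω → ℝ) (D R G : ℝ) (hD : 0 < D) (hR : 0 ≤ R) (hg0 : ∀ ω, 0 ≤ g ω) (hgG : ∀ ω, g ω ≤ G)
    (h3 : ∀ ω, r ω + 1 < m → f ω + 2 * D ≤ f (suc ω))
    (h4 : ∀ ω, r ω + 1 < m → f (suc ω) - f ω ≤ 2 * D * (g (suc ω) - g ω)) :
    (m : ℝ) * ∑ ω, (if |f ω| ≤ R then (1:ℝ) else 0)
      ≤ (R / D + 1) * ∑ ω, (if |f ω| ≤ R + 2 * D * G then (1:ℝ) else 0) := by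
  have hT : ∀ ω, r ω = 0 → ∀ t, t < m → r (suc^[t] ω) = t := by
    intro ω hω t
    induction t with
    | zero => intro _; simpa using hω
    | succ t ih =>
      intro ht
      rw [Function.iterate_succ_apply']
      rw [(h1 _ (by rw [ih (by omega)]; exact ht)).1, ih (by omega)]
  have hTp : ∀ ω, r ω = 0 → ∀ t, t < m → pre^[t] (suc^[t] ω) = ω := by
    intro ω hω t
    induction t with
    | zero => intro _; rfl
    | succ t ih =>
      intro ht
      rw [Function.iterate_succ_apply' suc, Function.iterate_succ_apply pre,
        (h1 _ (by rw [hT ω hω t (by omega)]; exact ht)).2, ih (by omega)]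
  have hp : ∀ t ω, t ≤ r ω → r (pre^[t] ω) + t = r ω ∧ suc^[t] (pre^[t] ω) = ω := by
    intro t
    induction t with
    | zero => intro ω _; simp
    | succ t ih =>
      intro ω ht
      obtain ⟨e1, e2⟩ := ih ω (by omega)
      obtain ⟨e3, e4⟩ := h2 (pre^[t] ω) (by omega)
      rw [Function.iterate_succ_apply' pre]
      refine ⟨by omega, ?_⟩
      rw [Function.iterate_succ_apply suc, e4, e2]
  have hsum : ∀ F : Ω → ℝ, ∑ ω, F ω
      = ∑ ω ∈ Finset.univ.filter (fun ω => r ω = 0), ∑ t ∈ Finset.range m, F (suc^[t] ω) := by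
    intro F
    rw [← Finset.sum_product']
    symm
    refine Finset.sum_nbij' (fun x => suc^[x.2] x.1) (fun ω => (pre^[r ω] ω, r ω)) ?_ ?_ ?_ ?_ ?_
    · intro x _; simp
    · intro ω _
      simp only [Finset.mem_product, Finset.mem_filter, Finset.mem_univ, true_and, Finset.mem_range]
      have := (hp (r ω) ω le_rfl).1
      exact ⟨by omega, hr ω⟩
    · rintro ⟨ω, t⟩ hx
      simp only [Finset.mem_product, Finset.mem_filter, Finset.mem_univ, true_and, Finset.mem_range] at hx
      simp only [hT ω hx.1 t hx.2, hTp ω hx.1 t hx.2]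
    · intro ω _
      exact (hp (r ω) ω le_rfl).2
    · intro x _; rfl
  rw [hsum, hsum, Finset.mul_sum, Finset.mul_sum]
  refine Finset.sum_le_sum fun ω hω => ?_
  simp only [Finset.mem_filter, Finset.mem_univ, true_and] at hω
  have hRD : 0 ≤ R / D + 1 := by positivity
  by_cases hex : ∃ t, t < m ∧ |f (suc^[t] ω)| ≤ R
  · obtain ⟨t0, ht0, hft0⟩ := hex
    have hstep : ∀ t, t + 1 < m → f (suc^[t] ω) + 2 * D ≤ f (suc^[t+1] ω) := by
      intro t ht
      rw [Function.iterate_succ_apply']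
      exact h3 _ (by rw [hT ω hω t (by omega)]; exact ht)
    have hstep2 : ∀ t, t + 1 < m → f (suc^[t+1] ω) - 2 * D * g (suc^[t+1] ω)
        ≤ f (suc^[t] ω) - 2 * D * g (suc^[t] ω) := by
      intro t ht
      rw [Function.iterate_succ_apply']
      have := h4 _ (by rw [hT ω hω t (by omega)]; exact ht)
      linarith
    have hmono : ∀ k i, i + k < m → f (suc^[i] ω) ≤ f (suc^[i+k] ω) ∧
        f (suc^[i+k] ω) - 2 * D * g (suc^[i+k] ω) ≤ f (suc^[i] ω) - 2 * D * g (suc^[i] ω) := by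
      intro k i
      induction k with
      | zero => intro _; simp
      | succ k ih =>
        intro hk
        obtain ⟨a1, a2⟩ := ih (by omega)
        have b1 := hstep (i + k) (by omega)
        have b2 := hstep2 (i + k) (by omega)
        rw [← add_assoc]
        exact ⟨by linarith, by linarith⟩
    have hfar : ∀ i j, i ≤ j → j < m → |f (suc^[j] ω) - f (suc^[i] ω)| ≤ 2 * D * G := by
      intro i j hij hj
      obtain ⟨a1, a2⟩ := hmono (j - i) i (by omega)
      rw [Nat.add_sub_cancel' hij] at a1 a2
      rw [abs_of_nonneg (by linarith)]
      have b1 := hg0 (suc^[i] ω)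
      have b2 := hgG (suc^[j] ω)
      nlinarith
    have hallc : ∀ t ∈ Finset.range m, (if |f (suc^[t] ω)| ≤ R + 2 * D * G then (1:ℝ) else 0) = 1 := by
      intro t ht
      rw [Finset.mem_range] at ht
      rw [if_pos]
      have h5 : |f (suc^[t] ω) - f (suc^[t0] ω)| ≤ 2 * D * G := by
        rcases le_total t t0 with h | h
        · rw [abs_sub_comm]; exact hfar _ _ h ht0
        · exact hfar _ _ h ht
      have h6 := abs_add_le (f (suc^[t] ω) - f (suc^[t0] ω)) (f (suc^[t0] ω))
      rw [sub_add_cancel] at h6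
      linarith
    rw [Finset.sum_congr rfl hallc, Finset.sum_boole]
    have hc := count_spaced ((Finset.range m).filter (fun t => |f (suc^[t] ω)| ≤ R)) m
      (fun t => f (suc^[t] ω)) D R hD hR (by
        intro t ht
        rw [Finset.mem_filter, Finset.mem_range] at ht
        exact ht) hstep
    simp only [Finset.sum_const, Finset.card_range, nsmul_eq_mul, mul_one]
    rw [mul_comm]
    gcongr
  · have : ∑ t ∈ Finset.range m, (if |f (suc^[t] ω)| ≤ R then (1:ℝ) else 0) = 0 := by
      apply Finset.sum_eq_zero
      intro t ht
      rw [if_neg]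
      intro h
      exact hex ⟨t, Finset.mem_range.mp ht, h⟩
    rw [this, mul_zero]
    apply mul_nonneg hRD
    exact Finset.sum_nonneg fun t _ => by split_ifs <;> norm_num

section chain
variable {n : ℕ}

lemma exists_next (j0 : Fin n) (J : Finset (Fin n)) (π : Equiv.Perm (Fin n)) :
    ∃ k : Fin n, (∃ l ∈ J, π j0 < π l) → (k ∈ J ∧ π j0 < π k ∧ ∀ l ∈ J, π j0 < π l → π k ≤ π l) := by
  by_cases h : ∃ l ∈ J, π j0 < π l
  · obtain ⟨l, hl, hl2⟩ := h
    obtain ⟨k, hk, hk2⟩ := Finset.exists_min_image (J.filter (fun l => π j0 < π l)) π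
      ⟨l, Finset.mem_filter.mpr ⟨hl, hl2⟩⟩
    rw [Finset.mem_filter] at hk
    exact ⟨k, fun _ => ⟨hk.1, hk.2, fun l a b => hk2 l (Finset.mem_filter.mpr ⟨a, b⟩)⟩⟩
  · exact ⟨j0, fun h' => (h h').elim⟩

lemma exists_prev (j0 : Fin n) (J : Finset (Fin n)) (π : Equiv.Perm (Fin n)) :
    ∃ k : Fin n, (∃ l ∈ J, π l < π j0) → (k ∈ J ∧ π k < π j0 ∧ ∀ l ∈ J, π l < π j0 → π l ≤ π k) := by
  by_cases h : ∃ l ∈ J, π l < π j0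
  · obtain ⟨l, hl, hl2⟩ := h
    obtain ⟨k, hk, hk2⟩ := Finset.exists_max_image (J.filter (fun l => π l < π j0)) π
      ⟨l, Finset.mem_filter.mpr ⟨hl, hl2⟩⟩
    rw [Finset.mem_filter] at hk
    exact ⟨k, fun _ => ⟨hk.1, hk.2, fun l a b => hk2 l (Finset.mem_filter.mpr ⟨a, b⟩)⟩⟩
  · exact ⟨j0, fun h' => (h h').elim⟩

lemma chain_perm (c w : Fin n → ℝ) (j0 : Fin n) (J : Finset (Fin n)) (hj0 : j0 ∉ J)
    (M D R G : ℝ) (hD : 0 < D) (hR : 0 ≤ R) (hw0 : w j0 = D) (hwJ : ∀ j ∈ J, w j ≤ 0 ∧ -D ≤ w j)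
    (hc : ∀ i l : Fin n, i < l → c i + 2 ≤ c l) (hc0 : ∀ i, 0 ≤ c i) (hcG : ∀ i, c i ≤ G) :
    ((J.card + 1 : ℕ) : ℝ) * ∑ π : Equiv.Perm (Fin n), (if |M + ∑ j, w j * c (π j)| ≤ R then (1:ℝ) else 0)
      ≤ (R / D + 1) * ∑ π : Equiv.Perm (Fin n),
        (if |M + ∑ j, w j * c (π j)| ≤ R + 2 * D * G then (1:ℝ) else 0) := by
  choose nx hnx using exists_next j0 J
  choose pv hpv using exists_prev j0 J
  set r : Equiv.Perm (Fin n) → ℕ := fun π => (J.filter (fun l => π l < π j0)).card with hrdef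
  have hneJ : ∀ l ∈ J, l ≠ j0 := fun l hl e => hj0 (e ▸ hl)
  have hval : ∀ (π : Equiv.Perm (Fin n)) (k : Fin n), (π * Equiv.swap j0 k) j0 = π k := by
    intro π k; simp
  have hval2 : ∀ (π : Equiv.Perm (Fin n)) (k : Fin n), (π * Equiv.swap j0 k) k = π j0 := by
    intro π k; simp
  have hval3 : ∀ (π : Equiv.Perm (Fin n)) (k l : Fin n), l ≠ j0 → l ≠ k →
      (π * Equiv.swap j0 k) l = π l := by
    intro π k l h1 h2; simp [Equiv.swap_apply_of_ne_of_ne h1 h2]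
  have hnext : ∀ π, r π + 1 < J.card + 1 → ∃ l ∈ J, π j0 < π l := by
    intro π h
    by_contra hcon
    push Not at hcon
    have : J.filter (fun l => π l < π j0) = J := by
      apply Finset.filter_true_of_mem
      intro l hl
      exact lt_of_le_of_ne (hcon l hl) (fun e => hneJ l hl (π.injective e))
    simp only [hrdef, this] at h
    omega
  have hprev : ∀ π, 0 < r π → ∃ l ∈ J, π l < π j0 := by
    intro π h
    obtain ⟨l, hl⟩ := Finset.card_pos.mp h
    rw [Finset.mem_filter] at hl
    exact ⟨l, hl⟩
  have hU : ∀ (π : Equiv.Perm (Fin n)) (k : Fin n), k ≠ j0 →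
      ∑ j, w j * c ((π * Equiv.swap j0 k) j) = ∑ j, w j * c (π j) +
        (c (π k) - c (π j0)) * (w j0 - w k) := by
    intro π k hk
    have e : ∀ F : Fin n → ℝ, ∑ j, F j = F j0 + F k + ∑ j ∈ (Finset.univ.erase j0).erase k, F j := by
      intro F
      rw [← Finset.add_sum_erase _ F (Finset.mem_univ j0),
        ← Finset.add_sum_erase _ F (Finset.mem_erase.mpr ⟨hk, Finset.mem_univ k⟩)]
      ring
    rw [e, e (fun j => w j * c (π j)), hval, hval2]
    have : ∑ j ∈ (Finset.univ.erase j0).erase k, w j * c ((π * Equiv.swap j0 k) j)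
        = ∑ j ∈ (Finset.univ.erase j0).erase k, w j * c (π j) := by
      refine Finset.sum_congr rfl fun j hj => ?_
      simp only [Finset.mem_erase, Finset.mem_univ, and_true] at hj
      rw [hval3 π k j hj.2 hj.1]
    rw [this]; ring
  refine chain_abs (J.card + 1) r (fun π => π * Equiv.swap j0 (nx π)) (fun π => π * Equiv.swap j0 (pv π))
    ?_ ?_ ?_ _ (fun π => c (π j0)) D R G hD hR (fun π => hc0 _) (fun π => hcG _) ?_ ?_
  · intro π
    exact Nat.lt_succ_of_le (Finset.card_filter_le _ _)
  · intro π hπ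
    obtain ⟨hk1, hk2, hk3⟩ := hnx π (hnext π hπ)
    set k := nx π
    have hkj := hneJ k hk1
    have hlow : ∀ l ∈ J, l ≠ k → (π l < π k ↔ π l < π j0) := by
      intro l hl hlk
      constructor
      · intro h
        by_contra hcon
        have h5 : π j0 < π l := lt_of_le_of_ne (not_lt.mp hcon) (fun e => hneJ l hl (π.injective e.symm))
        exact absurd (hk3 l hl h5) (not_le.mpr h)
      · intro h; exact h.trans hk2
    refine ⟨?_, ?_⟩
    · have : J.filter (fun l => (π * Equiv.swap j0 k) l < (π * Equiv.swap j0 k) j0)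
          = insert k (J.filter (fun l => π l < π j0)) := by
        ext l
        rw [Finset.mem_filter, Finset.mem_insert, Finset.mem_filter, hval]
        by_cases hlk : l = k
        · subst hlk; rw [hval2]; simp [hk1, hk2]
        · constructor
          · rintro ⟨a, b⟩
            rw [hval3 π k l (hneJ l a) hlk] at b
            exact Or.inr ⟨a, (hlow l a hlk).mp b⟩
          · rintro (a | ⟨a, b⟩)
            · exact (hlk a).elim
            · refine ⟨a, ?_⟩
              rw [hval3 π k l (hneJ l a) hlk]
              exact (hlow l a hlk).mpr b
      simp only [hrdef]
      rw [this, Finset.card_insert_of_notMem]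
      rw [Finset.mem_filter]
      rintro ⟨_, h⟩
      exact absurd h (not_lt.mpr hk2.le)
    · have hex : ∃ l ∈ J, (π * Equiv.swap j0 k) l < (π * Equiv.swap j0 k) j0 :=
        ⟨k, hk1, by rw [hval, hval2]; exact hk2⟩
      obtain ⟨p1, p2, p3⟩ := hpv (π * Equiv.swap j0 k) hex
      have heq : pv (π * Equiv.swap j0 k) = k := by
        by_contra hne
        set q := pv (π * Equiv.swap j0 k)
        have h6 := p3 k hk1 (by rw [hval, hval2]; exact hk2)
        rw [hval, hval3 π k q (hneJ q p1) hne] at p2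
        rw [hval2, hval3 π k q (hneJ q p1) hne] at h6
        exact absurd ((hlow q p1 hne).mp p2) (not_lt.mpr h6)
      simp only [heq]
      rw [mul_assoc, Equiv.swap_mul_self, mul_one]
  · intro π hπ
    obtain ⟨hk1, hk2, hk3⟩ := hpv π (hprev π hπ)
    set k := pv π
    have hkj := hneJ k hk1
    have hlow : ∀ l ∈ J, l ≠ k → (π l < π k ↔ π l < π j0) := by
      intro l hl hlk
      constructor
      · intro h; exact h.trans hk2
      · intro h
        exact lt_of_le_of_ne (hk3 l hl h) (fun e => hlk (π.injective e))
    refine ⟨?_, ?_⟩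
    · have : J.filter (fun l => π l < π j0)
          = insert k (J.filter (fun l => (π * Equiv.swap j0 k) l < (π * Equiv.swap j0 k) j0)) := by
        ext l
        rw [Finset.mem_filter, Finset.mem_insert, Finset.mem_filter, hval]
        by_cases hlk : l = k
        · subst hlk; simp [hk1, hk2]
        · constructor
          · rintro ⟨a, b⟩
            refine Or.inr ⟨a, ?_⟩
            rw [hval3 π k l (hneJ l a) hlk]
            exact (hlow l a hlk).mpr b
          · rintro (a | ⟨a, b⟩)
            · exact (hlk a).elim
            · rw [hval3 π k l (hneJ l a) hlk] at b
              exact ⟨a, (hlow l a hlk).mp b⟩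
      simp only [hrdef]
      rw [this, Finset.card_insert_of_notMem]
      rw [Finset.mem_filter, hval, hval2]
      rintro ⟨_, h⟩
      exact absurd h (not_lt.mpr hk2.le)
    · have hex : ∃ l ∈ J, (π * Equiv.swap j0 k) j0 < (π * Equiv.swap j0 k) l :=
        ⟨k, hk1, by rw [hval, hval2]; exact hk2⟩
      obtain ⟨p1, p2, p3⟩ := hnx (π * Equiv.swap j0 k) hex
      have heq : nx (π * Equiv.swap j0 k) = k := by
        by_contra hne
        set q := nx (π * Equiv.swap j0 k)
        have h6 := p3 k hk1 (by rw [hval, hval2]; exact hk2)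
        rw [hval, hval3 π k q (hneJ q p1) hne] at p2
        rw [hval2, hval3 π k q (hneJ q p1) hne] at h6
        have h7 : π q < π j0 := lt_of_le_of_ne h6 (fun e => hneJ q p1 (π.injective e))
        exact absurd ((hlow q p1 hne).mpr h7) (not_lt.mpr p2.le)
      simp only [heq]
      rw [mul_assoc, Equiv.swap_mul_self, mul_one]
  · intro π hπ
    obtain ⟨hk1, hk2, hk3⟩ := hnx π (hnext π hπ)
    have hcc := hc _ _ hk2
    have hww := hwJ _ hk1
    rw [hU π (nx π) (hneJ _ hk1), hw0]
    nlinarith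
  · intro π hπ
    obtain ⟨hk1, hk2, hk3⟩ := hnx π (hnext π hπ)
    have hcc := hc _ _ hk2
    have hww := hwJ _ hk1
    rw [hU π (nx π) (hneJ _ hk1), hw0, hval]
    nlinarith

end chain

lemma perm_sum_le_of_sign (n : ℕ) (hn : 40 ≤ n) (v c : Fin n → ℝ) (D M : ℝ) (j0 : Fin n) (hD : 0 < D)
    (hv0 : ∀ j, 0 ≤ v j) (hvD : ∀ j, v j ≤ D) (hj0 : v j0 = D)
    (hc : ∀ i l : Fin n, i < l → c i + 2 ≤ c l) (hc0 : ∀ i, 0 ≤ c i)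
    (hc2 : ∀ i, c i ≤ 3 * n) (s : Fin n → ℤˣ) :
    ∑ π : Equiv.Perm (Fin n), (if |M + ∑ j, sg (s j) * (v j * c (π j))| ≤
      10 * (|∑ j, sg (s j) * v j| + D + |∑ j, sg (s j) * (v j * c (π j))| / n) then (1:ℝ) else 0)
    ≤ (4 / n) * ∑ π : Equiv.Perm (Fin n), (20 * |∑ j, sg (s j) * v j| / D + 6021 +
          20 * |∑ j, sg (s j) * (v j * c (π j))| / (n * D)) *
        (if |M + ∑ j, sg (s j) * (v j * c (π j))| ≤ 300 * n * D then (1:ℝ) else 0)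
      + Fintype.card (Equiv.Perm (Fin n)) * ((∑ j, sg (s j) * 1) ^ 2 * (4 / n ^ 2)) := by
  have hn40 : (40:ℝ) ≤ n := by exact_mod_cast hn
  have hn0 : (0:ℝ) < n := by linarith
  set S : ℝ := |∑ j, sg (s j) * v j| with hS
  set U : Equiv.Perm (Fin n) → ℝ := fun π => ∑ j, sg (s j) * (v j * c (π j)) with hU
  have hS0 : 0 ≤ S := abs_nonneg _
  have hSn : S ≤ n * D := by
    calc S ≤ ∑ j, |sg (s j) * v j| := Finset.abs_sum_le_sum_abs _ _
      _ ≤ ∑ j : Fin n, D := Finset.sum_le_sum fun j _ => by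
          rw [abs_mul, sg_abs, one_mul, abs_of_nonneg (hv0 j)]; exact hvD j
      _ = n * D := by simp
  have hUn : ∀ π, |U π| ≤ 3 * n ^ 2 * D := by
    intro π
    calc |U π| ≤ ∑ j, |sg (s j) * (v j * c (π j))| := Finset.abs_sum_le_sum_abs _ _
      _ ≤ ∑ j : Fin n, D * (3 * n) := Finset.sum_le_sum fun j _ => by
          rw [abs_mul, sg_abs, one_mul, abs_of_nonneg (mul_nonneg (hv0 j) (hc0 _))]
          exact mul_le_mul (hvD j) (hc2 _) (hc0 _) hD.le
      _ = 3 * n ^ 2 * D := by simp; ring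
  set R : ℝ := 20 * (S + D + |M| / n) with hR
  have hR0 : 0 ≤ R := by positivity
  have hev : ∀ π, |M + U π| ≤ 10 * (S + D + |U π| / n) → |M + U π| ≤ R := by
    intro π h
    have h1 : |U π| ≤ |M| + |M + U π| := by
      have : U π = (M + U π) - M := by ring
      calc |U π| = |(M + U π) - M| := by rw [← this]
        _ ≤ |M + U π| + |M| := abs_sub _ _
        _ = _ := add_comm _ _
    have h2 : |U π| / n ≤ |M| / n + |M + U π| / n := by
      rw [← add_div]; gcongr
    have h3 : |M + U π| / n ≤ |M + U π| / 20 := by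
      gcongr; linarith
    simp only [hR]
    linarith
  have hnn1 : (0:ℝ) ≤ Fintype.card (Equiv.Perm (Fin n)) * ((∑ j, sg (s j) * 1) ^ 2 * (4 / n ^ 2)) := by
    positivity
  have hnn2 : (0:ℝ) ≤ (4 / n) * ∑ π : Equiv.Perm (Fin n), (20 * S / D + 6021 +
          20 * |U π| / (n * D)) * (if |M + U π| ≤ 300 * n * D then (1:ℝ) else 0) := by
    refine mul_nonneg (by positivity) (Finset.sum_nonneg fun π _ => mul_nonneg (by positivity) ?_)
    split_ifs <;> norm_num
  change ∑ π : Equiv.Perm (Fin n), (if |M + U π| ≤ 10 * (S + D + |U π| / n) then (1:ℝ) else 0) ≤ 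
    (4 / n) * ∑ π : Equiv.Perm (Fin n), (20 * S / D + 6021 +
          20 * |U π| / (n * D)) * (if |M + U π| ≤ 300 * n * D then (1:ℝ) else 0) + _
  by_cases hM : 8 * n ^ 2 * D < |M|
  · have : ∀ π, ¬ |M + U π| ≤ 10 * (S + D + |U π| / n) := by
      intro π h
      have h1 := hev π h
      have h2 : |M| ≤ |M + U π| + |U π| := by
        have : M = (M + U π) - U π := by ring
        calc |M| = |(M + U π) - U π| := by rw [← this]
          _ ≤ _ := abs_sub _ _
      have h3 : |M| / n ≤ |M| / 40 := by gcongr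
      have h4 := hUn π
      simp only [hR] at h1
      have h5 : 40 * (n * D) ≤ n ^ 2 * D := by nlinarith [mul_pos hn0 hD]
      have h6 : 40 * D ≤ n * D := by gcongr
      linarith
    simp only [this, if_false, Finset.sum_const_zero]
    linarith
  push Not at hM
  have hRle : R + 2 * D * (3 * n) ≤ 300 * n * D := by
    have h1 : |M| / n ≤ 8 * n * D := by
      rw [div_le_iff₀ hn0]; linarith
    have h6 : 40 * D ≤ n * D := by gcongr
    simp only [hR]
    linarith
  set J : Finset (Fin n) := Finset.univ.filter (fun j => s j ≠ s j0) with hJ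
  have hneg : ∀ j ∈ J, sg (s j0) * sg (s j) = -1 := by
    intro j hj
    have hj' : s j ≠ s j0 := (Finset.mem_filter.mp hj).2
    rcases Int.units_eq_one_or (s j) with h | h <;> rcases Int.units_eq_one_or (s j0) with h' | h' <;>
      rw [h, h'] at hj' <;> simp [h, h', sg] at hj' ⊢
  have hpos : ∀ j, j ∉ J → sg (s j0) * sg (s j) = 1 := by
    intro j hj
    have hj' : s j = s j0 := by
      by_contra h; exact hj (Finset.mem_filter.mpr ⟨Finset.mem_univ _, h⟩)
    rw [hj', sg_sq]
  have hchain := chain_perm c (fun j => sg (s j0) * sg (s j) * v j) j0 J (by simp [hJ])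
    (sg (s j0) * M) D R (3 * n) hD hR0 (by simp only [sg_sq, hj0, one_mul])
    (fun j hj => by
      simp only [hneg j hj]; constructor <;> linarith [hv0 j, hvD j]) hc hc0 hc2
  have habs : ∀ π : Equiv.Perm (Fin n), |sg (s j0) * M + ∑ j, sg (s j0) * sg (s j) * v j * c (π j)| = |M + U π| := by
    intro π
    have : sg (s j0) * M + ∑ j, sg (s j0) * sg (s j) * v j * c (π j) = sg (s j0) * (M + U π) := by
      rw [mul_add, hU, Finset.mul_sum]
      congr 1
      exact Finset.sum_congr rfl fun j _ => by ring
    rw [this, abs_mul, sg_abs, one_mul]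
  simp only [habs] at hchain
  have hle1 : ∑ π : Equiv.Perm (Fin n), (if |M + U π| ≤ 10 * (S + D + |U π| / n) then (1:ℝ) else 0)
      ≤ ∑ π : Equiv.Perm (Fin n), (if |M + U π| ≤ R then (1:ℝ) else 0) := by
    refine Finset.sum_le_sum fun π _ => ?_
    by_cases h : |M + U π| ≤ 10 * (S + D + |U π| / n)
    · rw [if_pos h, if_pos (hev π h)]
    · rw [if_neg h]; split_ifs <;> norm_num
  by_cases hm : (n:ℝ) / 4 ≤ ((J.card + 1 : ℕ) : ℝ)
  · have hle2 : (R / D + 1) * ∑ π : Equiv.Perm (Fin n), (if |M + U π| ≤ R + 2 * D * (3 * n) then (1:ℝ) else 0)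
        ≤ ∑ π : Equiv.Perm (Fin n), (20 * S / D + 6021 +
          20 * |U π| / (n * D)) * (if |M + U π| ≤ 300 * n * D then (1:ℝ) else 0) := by
      rw [Finset.mul_sum]
      refine Finset.sum_le_sum fun π _ => ?_
      by_cases h : |M + U π| ≤ R + 2 * D * (3 * n)
      · rw [if_pos h, if_pos (h.trans hRle), mul_one, mul_one]
        have h2 : |M| ≤ |M + U π| + |U π| := by
          have : M = (M + U π) - U π := by ring
          calc |M| = |(M + U π) - U π| := by rw [← this]
            _ ≤ _ := abs_sub _ _
        have h3 : |M| ≤ 300 * n * D + |U π| := by linarith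
        have h4 : |M| / (n * D) ≤ 300 + |U π| / (n * D) := by
          rw [div_le_iff₀ (by positivity), add_mul, div_mul_cancel₀ _ (by positivity)]; linarith
        have h5 : R / D = 20 * S / D + 20 + 20 * (|M| / (n * D)) := by
          simp only [hR]; field_simp
        rw [h5, mul_div_assoc 20 (|U π|)]
        linarith
      · rw [if_neg h, mul_zero]
        refine mul_nonneg (by positivity) ?_
        split_ifs <;> norm_num
    have hle3 : (n:ℝ) / 4 * ∑ π : Equiv.Perm (Fin n), (if |M + U π| ≤ R then (1:ℝ) else 0) ≤
        ∑ π : Equiv.Perm (Fin n), (20 * S / D + 6021 +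
          20 * |U π| / (n * D)) * (if |M + U π| ≤ 300 * n * D then (1:ℝ) else 0) := by
      refine le_trans (mul_le_mul_of_nonneg_right hm ?_) (hchain.trans hle2)
      exact Finset.sum_nonneg fun π _ => by split_ifs <;> norm_num
    have : ∑ π : Equiv.Perm (Fin n), (if |M + U π| ≤ R then (1:ℝ) else 0) =
        4 / n * ((n:ℝ) / 4 * ∑ π : Equiv.Perm (Fin n), (if |M + U π| ≤ R then (1:ℝ) else 0)) := by
      field_simp
    have h7 := mul_le_mul_of_nonneg_left hle3 (show (0:ℝ) ≤ 4 / n by positivity)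
    linarith
  · push Not at hm
    have hsum : sg (s j0) * ∑ j, sg (s j) * 1 = n - 2 * J.card := by
      rw [Finset.mul_sum]
      have : ∀ j, sg (s j0) * (sg (s j) * 1) = 1 - 2 * (if j ∈ J then (1:ℝ) else 0) := by
        intro j
        by_cases h : j ∈ J
        · rw [if_pos h, mul_one, hneg j h]; norm_num
        · rw [if_neg h, mul_one, hpos j h]; norm_num
      simp only [this]
      rw [Finset.sum_sub_distrib, ← Finset.mul_sum]
      simp
    have hsq : (n:ℝ) ^ 2 / 4 ≤ (∑ j, sg (s j) * 1) ^ 2 := by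
      have : (∑ j, sg (s j) * 1) ^ 2 = (n - 2 * (J.card:ℝ)) ^ 2 := by
        rw [← hsum, mul_pow, sq (sg _), sg_sq, one_mul]
      rw [this]
      push_cast at hm
      have h1 : (n:ℝ) / 2 ≤ n - 2 * J.card := by linarith
      nlinarith
    have h1 : 1 ≤ (∑ j, sg (s j) * 1) ^ 2 * (4 / (n:ℝ) ^ 2) := by
      rw [mul_div_assoc', le_div_iff₀ (by positivity)]
      linarith
    have h2 : ∑ π : Equiv.Perm (Fin n), (if |M + U π| ≤ 10 * (S + D + |U π| / n) then (1:ℝ) else 0)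
        ≤ Fintype.card (Equiv.Perm (Fin n)) * 1 := by
      calc _ ≤ ∑ π : Equiv.Perm (Fin n), (1:ℝ) := Finset.sum_le_sum fun π _ => by split_ifs <;> norm_num
        _ = _ := by simp
    have h3 : (Fintype.card (Equiv.Perm (Fin n)) : ℝ) * 1 ≤
        Fintype.card (Equiv.Perm (Fin n)) * ((∑ j, sg (s j) * 1) ^ 2 * (4 / (n:ℝ) ^ 2)) := by gcongr
    linarith

lemma finite_claim_nonneg (n : ℕ) (hn : 40 ≤ n) (v c : Fin n → ℝ) (D M : ℝ) (j0 : Fin n) (hD : 0 < D)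
    (hv0 : ∀ j, 0 ≤ v j) (hvD : ∀ j, v j ≤ D) (hj0 : v j0 = D)
    (hc : ∀ i l : Fin n, i < l → c i + 2 ≤ c l) (hc1 : ∀ i : Fin n, 2 * (i : ℝ) + 1 ≤ c i)
    (hc2 : ∀ i, c i ≤ 3 * n) :
    ∑ s : Fin n → ℤˣ, ∑ π : Equiv.Perm (Fin n), (if |M + ∑ j, sg (s j) * (v j * c (π j))| ≤
      10 * (|∑ j, sg (s j) * v j| + D + |∑ j, sg (s j) * (v j * c (π j))| / n) then (1:ℝ) else 0)
    ≤ (25000000 / n) * (Fintype.card (Equiv.Perm (Fin n)) * Fintype.card (Fin n → ℤˣ)) := by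
  have hc0 : ∀ i, 0 ≤ c i := fun i => by
    linarith [hc1 i, (Nat.cast_nonneg (i : ℕ) : (0:ℝ) ≤ _)]
  have hn0 : (0:ℝ) < n := by exact_mod_cast (by omega : 0 < n)
  have hσ : D ≤ Real.sqrt (∑ j, v j ^ 2) := by
    apply Real.le_sqrt_of_sq_le
    rw [← hj0]
    exact Finset.single_le_sum (f := fun j => v j ^ 2) (fun j _ => sq_nonneg _) (Finset.mem_univ j0)
  have hσ2 : Real.sqrt (∑ j, v j ^ 2) ^ 2 = ∑ j, v j ^ 2 :=
    Real.sq_sqrt (Finset.sum_nonneg fun j _ => sq_nonneg _)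
  have e1 := coarse_est n (by omega) v c (fun _ => 1) D M _ hD hv0 hvD hσ hσ2 hc1 hc2 (by norm_num)
  have e2 := coarse_est n (by omega) v c (fun i => c i / n) D M _ hD hv0 hvD hσ hσ2 hc1 hc2 (by
    intro i
    rw [abs_of_nonneg (div_nonneg (hc0 i) hn0.le), div_le_iff₀ hn0]
    exact hc2 i)
  refine (Finset.sum_le_sum fun s _ => perm_sum_le_of_sign n hn v c D M j0 hD hv0 hvD hj0 hc hc0 hc2 s).trans ?_
  rw [Finset.sum_add_distrib, ← Finset.mul_sum, ← Finset.mul_sum, ← Finset.sum_mul, sum_sq_signs,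
    Finset.sum_comm]
  set P : ℝ := (Fintype.card (Equiv.Perm (Fin n)) : ℝ)
  set N : ℝ := (Fintype.card (Fin n → ℤˣ) : ℝ)
  have hP0 : 0 ≤ P := Nat.cast_nonneg _
  have hN0 : 0 ≤ N := Nat.cast_nonneg _
  simp only [mul_one] at e1
  have h3 : ∑ π : Equiv.Perm (Fin n), ∑ s : Fin n → ℤˣ, 
      (if |M + ∑ j, sg (s j) * (v j * c (π j))| ≤ 300 * n * D then (1:ℝ) else 0) ≤ P * N := by
    calc _ ≤ ∑ π : Equiv.Perm (Fin n), ∑ s : Fin n → ℤˣ, (1:ℝ) :=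
        Finset.sum_le_sum fun π _ => Finset.sum_le_sum fun s _ => by split_ifs <;> norm_num
      _ = P * N := by simp [P, N]
  have h4 : ∑ π : Equiv.Perm (Fin n), ∑ s : Fin n → ℤˣ, (20 * |∑ j, sg (s j) * v j| / D + 6021 +
          20 * |∑ j, sg (s j) * (v j * c (π j))| / (n * D)) *
        (if |M + ∑ j, sg (s j) * (v j * c (π j))| ≤ 300 * n * D then (1:ℝ) else 0) =
      20 / D * (∑ π : Equiv.Perm (Fin n), ∑ s : Fin n → ℤˣ, |∑ j, sg (s j) * v j| *
        (if |M + ∑ j, sg (s j) * (v j * c (π j))| ≤ 300 * n * D then (1:ℝ) else 0)) +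
      6021 * (∑ π : Equiv.Perm (Fin n), ∑ s : Fin n → ℤˣ,
        (if |M + ∑ j, sg (s j) * (v j * c (π j))| ≤ 300 * n * D then (1:ℝ) else 0)) +
      20 / D * (∑ π : Equiv.Perm (Fin n), ∑ s : Fin n → ℤˣ, |∑ j, sg (s j) * (v j * (c (π j) / n))| *
        (if |M + ∑ j, sg (s j) * (v j * c (π j))| ≤ 300 * n * D then (1:ℝ) else 0)) := by
    simp only [Finset.mul_sum, ← Finset.sum_add_distrib]
    refine Finset.sum_congr rfl fun π _ => Finset.sum_congr rfl fun s _ => ?_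
    have : |∑ j, sg (s j) * (v j * (c (π j) / n))| = |∑ j, sg (s j) * (v j * c (π j))| / n := by
      rw [← abs_of_pos hn0, ← abs_div, abs_of_pos hn0, Finset.sum_div]
      congr 1
      exact Finset.sum_congr rfl fun j _ => by ring
    rw [this]
    field_simp
  rw [h4]
  have h5 : 20 / D * (∑ π : Equiv.Perm (Fin n), ∑ s : Fin n → ℤˣ, |∑ j, sg (s j) * v j| *
        (if |M + ∑ j, sg (s j) * (v j * c (π j))| ≤ 300 * n * D then (1:ℝ) else 0)) ≤ 3000000 * (P * N) := by
    calc _ ≤ 20 / D * (P * (N * (150000 * D))) := by gcongr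
      _ = _ := by field_simp; ring
  have h6 : 20 / D * (∑ π : Equiv.Perm (Fin n), ∑ s : Fin n → ℤˣ, |∑ j, sg (s j) * (v j * (c (π j) / n))| *
        (if |M + ∑ j, sg (s j) * (v j * c (π j))| ≤ 300 * n * D then (1:ℝ) else 0)) ≤ 3000000 * (P * N) := by
    calc _ ≤ 20 / D * (P * (N * (150000 * D))) := by gcongr
      _ = _ := by field_simp; ring
  have h7 : P * (N * ∑ j : Fin n, (1:ℝ) ^ 2 * (4 / (n:ℝ) ^ 2)) = 4 / n * (P * N) := by
    simp; field_simp
  have h8 : P * (N * (∑ j : Fin n, (1:ℝ) ^ 2) * (4 / (n:ℝ) ^ 2)) = 4 / n * (P * N) := by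
    simp; field_simp
  rw [h8]
  have h9 : 0 ≤ P * N := by positivity
  calc _ ≤ 4 / n * (3000000 * (P * N) + 6021 * (P * N) + 3000000 * (P * N)) + 4 / n * (P * N) := by
        gcongr
    _ = 1 / n * (24024088 * (P * N)) := by ring
    _ ≤ 1 / n * (25000000 * (P * N)) := by gcongr; norm_num
    _ = _ := by ring

lemma finite_claim (n : ℕ) (hn : 40 ≤ n) (d c : Fin n → ℝ) (D M : ℝ) (j0 : Fin n) (hD : 0 < D)
    (hvD : ∀ j, |d j| ≤ D) (hj0 : |d j0| = D)
    (hc : ∀ i l : Fin n, i < l → c i + 2 ≤ c l) (hc1 : ∀ i : Fin n, 2 * (i : ℝ) + 1 ≤ c i)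
    (hc2 : ∀ i, c i ≤ 3 * n) :
    ∑ s : Fin n → ℤˣ, ∑ π : Equiv.Perm (Fin n), (if |M + ∑ j, sg (s j) * (d j * c (π j))| ≤
      10 * (|∑ j, sg (s j) * d j| + D + |∑ j, sg (s j) * (d j * c (π j))| / n) then (1:ℝ) else 0)
    ≤ (25000000 / n) * (Fintype.card (Equiv.Perm (Fin n)) * Fintype.card (Fin n → ℤˣ)) := by
  have h := finite_claim_nonneg n hn (fun j => |d j|) c D M j0 hD (fun j => abs_nonneg _) hvD hj0 hc hc1 hc2
  set u : Fin n → ℤˣ := fun j => if 0 ≤ d j then 1 else -1 with hu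
  have hud : ∀ j, sg (u j) * d j = |d j| := by
    intro j
    simp only [hu]
    split_ifs with h
    · rw [sg_one, one_mul, abs_of_nonneg h]
    · rw [sg_neg_one, abs_of_neg (not_le.mp h)]; ring
  rw [← sum_signs_mul _ u]
  refine le_trans (le_of_eq ?_) h
  refine Finset.sum_congr rfl fun s _ => Finset.sum_congr rfl fun π _ => ?_
  have h1 : ∀ j, sg ((s * u) j) * d j = sg (s j) * |d j| := by
    intro j
    rw [Pi.mul_apply, sg_mul, mul_assoc, hud]
  have h2 : ∀ j, sg ((s * u) j) * (d j * c (π j)) = sg (s j) * (|d j| * c (π j)) := by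
    intro j
    rw [← mul_assoc, h1, mul_assoc]
  simp only [h1, h2]

section reduction
variable {n o : ℕ}

/-- positions: `n` pairs and `o` leftover points -/
abbrev Idx (n o : ℕ) : Type := (Fin n × Bool) ⊕ Fin o

/-- half differences of the pairs -/
def dd (y : Idx n o → ℝ) (i : Fin n) : ℝ := y (Sum.inl (i, true)) - y (Sum.inl (i, false))
/-- midpoints of the pairs -/
noncomputable def mm (y : Idx n o → ℝ) (i : Fin n) : ℝ :=
  (y (Sum.inl (i, true)) + y (Sum.inl (i, false))) / 2
/-- leftover sum -/
def xx (y : Idx n o → ℝ) : ℝ := ∑ j : Fin o, y (Sum.inr j)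

/-- sign acting on a two-point set -/
def actB (u : ℤˣ) : Equiv.Perm Bool := if u = 1 then Equiv.refl _ else Equiv.boolNot

/-- signed permutation of pairs -/
def gperm (π : Equiv.Perm (Fin n)) (s : Fin n → ℤˣ) : Equiv.Perm (Idx n o) :=
  Equiv.sumCongr ((Equiv.prodCongr π.symm (Equiv.refl Bool)).trans
    (Equiv.prodShear (Equiv.refl (Fin n)) (fun j => actB (s j)))) (Equiv.refl _)

lemma gperm_inl (π : Equiv.Perm (Fin n)) (s : Fin n → ℤˣ) (i : Fin n) (b : Bool) :
    (gperm π s : Equiv.Perm (Idx n o)) (Sum.inl (i, b)) = Sum.inl (π.symm i, actB (s (π.symm i)) b) := rfl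

lemma xx_gperm (y : Idx n o → ℝ) (π : Equiv.Perm (Fin n)) (s : Fin n → ℤˣ) :
    xx (y ∘ gperm π s) = xx y := rfl

lemma dd_gperm (y : Idx n o → ℝ) (π : Equiv.Perm (Fin n)) (s : Fin n → ℤˣ) (i : Fin n) :
    dd (y ∘ gperm π s) i = sg (s (π.symm i)) * dd y (π.symm i) := by
  simp only [dd, Function.comp, gperm_inl]
  rcases Int.units_eq_one_or (s (π.symm i)) with h | h <;> rw [h] <;> simp [actB, sg]

lemma mm_gperm (y : Idx n o → ℝ) (π : Equiv.Perm (Fin n)) (s : Fin n → ℤˣ) (i : Fin n) :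
    mm (y ∘ gperm π s) i = mm y (π.symm i) := by
  simp only [mm, Function.comp, gperm_inl]
  rcases Int.units_eq_one_or (s (π.symm i)) with h | h <;> rw [h] <;> simp [actB]
  ring

lemma norm_dd_gperm (y : Idx n o → ℝ) (π : Equiv.Perm (Fin n)) (s : Fin n → ℤˣ) :
    ‖dd (y ∘ gperm π s)‖ = ‖dd y‖ := by
  apply le_antisymm
  · refine (pi_norm_le_iff_of_nonneg (norm_nonneg _)).mpr fun i => ?_
    rw [dd_gperm, norm_mul, Real.norm_eq_abs, sg_abs, one_mul]
    exact norm_le_pi_norm _ _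
  · refine (pi_norm_le_iff_of_nonneg (norm_nonneg _)).mpr fun i => ?_
    have : ‖dd y i‖ = ‖dd (y ∘ gperm π s) (π i)‖ := by
      rw [dd_gperm, norm_mul, Real.norm_eq_abs (sg _), sg_abs, one_mul, Equiv.symm_apply_apply]
    rw [this]
    exact norm_le_pi_norm _ _

/-- the weights -/
noncomputable def cc (n o : ℕ) (i : Fin n) : ℝ := 2 * (i : ℝ) + 3 / 2 + o

/-- the enlarged event -/
def evE' (y : Idx n o → ℝ) : Prop :=
  |(xx y + ∑ i, mm y i) + ∑ i, cc n o i * dd y i| ≤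
    10 * (|∑ i, dd y i| + ‖dd y‖ + |∑ i, cc n o i * dd y i| / n)

/-- the event -/
def evE (y : Idx n o → ℝ) : Prop :=
  |(xx y + ∑ i, mm y i) + ∑ i, cc n o i * dd y i| ≤ |xx y + ∑ i, dd y i|

/-- the exceptional event -/
def evBad (y : Idx n o → ℝ) : Prop := ∃ i, 10 * ‖dd y‖ < |mm y i - xx y|

open Classical in
lemma count_evE' (hn : 40 ≤ n) (ho : o ≤ 1) (x : Idx n o → ℝ) (hx : Function.Injective x) :
    ∑ σ : Equiv.Perm (Idx n o), (if evE' (x ∘ σ) then (1:ℝ) else 0)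
      ≤ 25000000 / n * Fintype.card (Equiv.Perm (Idx n o)) := by
  have hn0 : (40:ℝ) ≤ n := by exact_mod_cast hn
  have ho' : (o:ℝ) ≤ 1 := by exact_mod_cast ho
  set P : ℝ := (Fintype.card (Equiv.Perm (Fin n)) : ℝ) with hP
  set N : ℝ := (Fintype.card (Fin n → ℤˣ) : ℝ) with hN
  have hP0 : 0 < P := by rw [hP]; exact_mod_cast Fintype.card_pos
  have hN0 : 0 < N := by rw [hN]; exact_mod_cast Fintype.card_pos
  have key : ∀ y : Idx n o → ℝ, Function.Injective y →
      ∑ s : Fin n → ℤˣ, ∑ π : Equiv.Perm (Fin n), (if evE' (y ∘ gperm π s) then (1:ℝ) else 0)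
        ≤ 25000000 / n * (P * N) := by
    intro y hy
    haveI : Nonempty (Fin n) := ⟨⟨0, by omega⟩⟩
    obtain ⟨j0, hj0⟩ := Finite.exists_max (fun j => |dd y j|)
    have hnorm : ‖dd y‖ = |dd y j0| := by
      apply le_antisymm
      · exact (pi_norm_le_iff_of_nonneg (abs_nonneg _)).mpr hj0
      · exact norm_le_pi_norm (dd y) j0
    have hpos : 0 < |dd y j0| := by
      rw [abs_pos]
      simp only [dd]
      rw [sub_ne_zero]
      intro h
      have := hy h
      simp at this
    have h := finite_claim n hn (dd y) (cc n o) (|dd y j0|) (xx y + ∑ i, mm y i) j0 hpos hj0 rfl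
      (fun i l hil => by
        have : (i:ℝ) + 1 ≤ l := by exact_mod_cast hil
        simp only [cc]; linarith)
      (fun i => by
        have : (0:ℝ) ≤ o := Nat.cast_nonneg _
        simp only [cc]; linarith)
      (fun i => by
        have : (i:ℝ) + 1 ≤ n := by exact_mod_cast i.2
        simp only [cc]; linarith)
    refine le_trans (le_of_eq ?_) h
    refine Finset.sum_congr rfl fun s _ => Finset.sum_congr rfl fun π _ => ?_
    have e1 : ∑ i, mm (y ∘ gperm π s) i = ∑ i, mm y i := by
      simp only [mm_gperm]
      exact Equiv.sum_comp π.symm (mm y)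
    have e2 : ∑ i, dd (y ∘ gperm π s) i = ∑ j, sg (s j) * dd y j := by
      simp only [dd_gperm]
      exact Equiv.sum_comp π.symm (fun j => sg (s j) * dd y j)
    have e3 : ∑ i, cc n o i * dd (y ∘ gperm π s) i = ∑ j, sg (s j) * (dd y j * cc n o (π j)) := by
      simp only [dd_gperm]
      rw [← Equiv.sum_comp π.symm (fun j => sg (s j) * (dd y j * cc n o (π j)))]
      refine Finset.sum_congr rfl fun i _ => ?_
      rw [Equiv.apply_symm_apply]; ring
    simp only [evE', e1, e2, e3, xx_gperm, norm_dd_gperm, hnorm]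
  have h1 : P * N * ∑ σ : Equiv.Perm (Idx n o), (if evE' (x ∘ σ) then (1:ℝ) else 0) =
      ∑ σ : Equiv.Perm (Idx n o), ∑ s : Fin n → ℤˣ, ∑ π : Equiv.Perm (Fin n),
        (if evE' ((x ∘ σ) ∘ gperm π s) then (1:ℝ) else 0) := by
    rw [Finset.sum_comm]
    have : ∀ s : Fin n → ℤˣ, ∑ σ : Equiv.Perm (Idx n o), ∑ π : Equiv.Perm (Fin n),
        (if evE' ((x ∘ σ) ∘ gperm π s) then (1:ℝ) else 0) =
        P * ∑ σ : Equiv.Perm (Idx n o), (if evE' (x ∘ σ) then (1:ℝ) else 0) := by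
      intro s
      rw [Finset.sum_comm]
      have : ∀ π : Equiv.Perm (Fin n), ∑ σ : Equiv.Perm (Idx n o),
        (if evE' ((x ∘ σ) ∘ gperm π s) then (1:ℝ) else 0) =
          ∑ σ : Equiv.Perm (Idx n o), (if evE' (x ∘ σ) then (1:ℝ) else 0) := fun π =>
        sum_perm_mul (fun σ : Equiv.Perm (Idx n o) => if evE' (x ∘ σ) then (1:ℝ) else 0) (gperm π s)
      simp only [this, Finset.sum_const, Finset.card_univ, nsmul_eq_mul, hP]
    simp only [this, Finset.sum_const, Finset.card_univ, nsmul_eq_mul]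
    ring
  have h2 : P * N * ∑ σ : Equiv.Perm (Idx n o), (if evE' (x ∘ σ) then (1:ℝ) else 0) ≤
      P * N * (25000000 / n * Fintype.card (Equiv.Perm (Idx n o))) := by
    rw [h1]
    refine (Finset.sum_le_sum fun (σ : Equiv.Perm (Idx n o)) _ => key (x ∘ σ) (hx.comp (Equiv.injective σ))).trans (le_of_eq ?_)
    rw [Finset.sum_const, Finset.card_univ, nsmul_eq_mul]
    ring
  exact le_of_mul_le_mul_left h2 (by positivity)

lemma evE_sub_zero (y : Idx n 0 → ℝ) (h : evE y) : evE' y := by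
  simp only [evE, evE', xx, Finset.univ_eq_empty, Finset.sum_empty, zero_add] at h ⊢
  have h1 : 0 ≤ |∑ i, cc n 0 i * dd y i| / n := by positivity
  have h2 := norm_nonneg (dd y)
  have h3 := abs_nonneg (∑ i, dd y i)
  linarith

lemma evE_sub_one (hn : 0 < n) (y : Idx n 1 → ℝ) (h : evE y) (hb : ¬ evBad y) : evE' y := by
  have hn0 : (0:ℝ) < n := by exact_mod_cast hn
  simp only [evE, evE', evBad, not_exists, not_lt] at h hb ⊢
  set U := ∑ i, cc n 1 i * dd y i
  set S := ∑ i, dd y i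
  set D := ‖dd y‖
  set x0 := xx y
  have h1 : |∑ i, (mm y i - x0)| ≤ n * (10 * D) := by
    calc _ ≤ ∑ i, |mm y i - x0| := Finset.abs_sum_le_sum_abs _ _
      _ ≤ ∑ i : Fin n, 10 * D := Finset.sum_le_sum fun i _ => hb i
      _ = _ := by simp
  have h2 : ((n:ℝ) + 1) * x0 = ((x0 + ∑ i, mm y i) + U) - U - ∑ i, (mm y i - x0) := by
    rw [Finset.sum_sub_distrib]; simp; ring
  have h3 : ((n:ℝ) + 1) * |x0| ≤ |(x0 + ∑ i, mm y i) + U| + |U| + |∑ i, (mm y i - x0)| := by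
    have : ((n:ℝ) + 1) * |x0| = |((n:ℝ) + 1) * x0| := by
      rw [abs_mul, abs_of_pos (by positivity : (0:ℝ) < n + 1)]
    rw [this, h2]
    exact (abs_sub _ _).trans (by gcongr; exact abs_sub _ _)
  have h4 : |x0 + S| ≤ |x0| + |S| := abs_add_le _ _
  have h5 : n * |x0| ≤ |S| + |U| + n * (10 * D) := by linarith
  have h6 : |x0| ≤ |S| / n + |U| / n + 10 * D := by
    rw [← add_div, ← sub_le_iff_le_add, le_div_iff₀ hn0]; linarith
  have h7 : |S| / n ≤ |S| := div_le_self (abs_nonneg _) (by exact_mod_cast hn)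
  have h8 : 0 ≤ |U| / n := by positivity
  have := abs_nonneg S
  linarith

end reduction

section badcount
variable {n : ℕ}

open Classical in
lemma count_G (x : Idx n 1 → ℝ) :
    ∑ σ : Equiv.Perm (Idx n 1), ∑ i : Fin n,
      (if 4 * ‖dd (x ∘ σ)‖ < |x (σ (Sum.inl (i, false))) - x (σ (Sum.inr 0))| then (1:ℝ) else 0)
      ≤ Fintype.card (Equiv.Perm (Idx n 1)) := by
  rw [Finset.sum_comm]
  have h1 : ∀ i : Fin n, ∑ σ : Equiv.Perm (Idx n 1),
      (if 4 * ‖dd (x ∘ σ)‖ < |x (σ (Sum.inl (i, false))) - x (σ (Sum.inr 0))| then (1:ℝ) else 0)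
      ≤ ∑ σ : Equiv.Perm (Idx n 1), (if ∀ l, l ≠ i → |dd (x ∘ σ) l| < |dd (x ∘ σ) i| then (1:ℝ) else 0) := by
    intro i
    rw [← sum_perm_mul (fun σ : Equiv.Perm (Idx n 1) =>
      (if ∀ l, l ≠ i → |dd (x ∘ σ) l| < |dd (x ∘ σ) i| then (1:ℝ) else 0))
      (Equiv.swap (Sum.inr 0) (Sum.inl (i, true)))]
    refine Finset.sum_le_sum fun σ _ => ?_
    by_cases h : 4 * ‖dd (x ∘ σ)‖ < |x (σ (Sum.inl (i, false))) - x (σ (Sum.inr 0))|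
    · rw [if_pos h, if_pos]
      intro l hl
      have e1 : dd (x ∘ (σ * Equiv.swap (Sum.inr 0) (Sum.inl (i, true)) : Equiv.Perm (Idx n 1))) l
          = dd (x ∘ σ) l := by
        simp only [dd, Function.comp, Equiv.Perm.mul_apply]
        rw [Equiv.swap_apply_of_ne_of_ne (by simp) (by simp [hl]),
          Equiv.swap_apply_of_ne_of_ne (by simp) (by simp)]
      have e2 : dd (x ∘ (σ * Equiv.swap (Sum.inr 0) (Sum.inl (i, true)) : Equiv.Perm (Idx n 1))) i
          = x (σ (Sum.inr 0)) - x (σ (Sum.inl (i, false))) := by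
        simp only [dd, Function.comp, Equiv.Perm.mul_apply]
        rw [Equiv.swap_apply_right, Equiv.swap_apply_of_ne_of_ne (by simp) (by simp)]
      rw [e1, e2, abs_sub_comm]
      have h2 : |dd (x ∘ σ) l| ≤ ‖dd (x ∘ σ)‖ := norm_le_pi_norm (dd (x ∘ σ)) l
      have h3 := norm_nonneg (dd (x ∘ σ))
      linarith
    · rw [if_neg h]; split_ifs <;> norm_num
  refine (Finset.sum_le_sum fun i _ => h1 i).trans ?_
  rw [Finset.sum_comm]
  calc _ ≤ ∑ σ : Equiv.Perm (Idx n 1), (1:ℝ) := by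
        refine Finset.sum_le_sum fun σ _ => ?_
        rw [Finset.sum_boole]
        have : (Finset.univ.filter (fun i => ∀ l, l ≠ i → |dd (x ∘ σ) l| < |dd (x ∘ σ) i|)).card ≤ 1 := by
          rw [Finset.card_le_one]
          intro a ha b hb
          rw [Finset.mem_filter] at ha hb
          by_contra hab
          exact lt_asymm (ha.2 b (Ne.symm hab)) (hb.2 a hab)
        exact_mod_cast this
    _ = _ := by simp

lemma card_top_two (f : Fin n → ℝ) (A : Finset (Fin n × Fin n))
    (hA : ∀ p ∈ A, p.1 ≠ p.2 ∧ ∀ r, r ≠ p.1 → r ≠ p.2 → f r < f p.1 ∧ f r < f p.2) : A.card ≤ 2 := by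
  rcases A.eq_empty_or_nonempty with h | ⟨p, hp⟩
  · subst h; simp
  · have : A ⊆ {p, (p.2, p.1)} := by
      intro q hq
      obtain ⟨hp0, hp1⟩ := hA p hp
      obtain ⟨hq0, hq1⟩ := hA q hq
      obtain ⟨a, b⟩ := p
      obtain ⟨c, d⟩ := q
      simp only [Finset.mem_insert, Finset.mem_singleton, Prod.mk.injEq] at *
      by_contra hcon
      have hc := hp1 c
      have hd := hp1 d
      have ha := hq1 a
      have hb := hq1 b
      grind
    exact (Finset.card_le_card this).trans Finset.card_le_two

open Classical in
lemma count_H (x : Idx n 1 → ℝ) :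
    ∑ σ : Equiv.Perm (Idx n 1), ∑ p : Fin n × Fin n,
      (if p.1 ≠ p.2 ∧ 5 * ‖dd (x ∘ σ)‖ < |x (σ (Sum.inl (p.1, false))) - x (σ (Sum.inl (p.2, false)))|
        then (1:ℝ) else 0)
      ≤ 2 * Fintype.card (Equiv.Perm (Idx n 1)) := by
  rw [Finset.sum_comm]
  have h1 : ∀ p : Fin n × Fin n, ∑ σ : Equiv.Perm (Idx n 1),
      (if p.1 ≠ p.2 ∧ 5 * ‖dd (x ∘ σ)‖ < |x (σ (Sum.inl (p.1, false))) - x (σ (Sum.inl (p.2, false)))|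
        then (1:ℝ) else 0)
      ≤ ∑ σ : Equiv.Perm (Idx n 1), (if p.1 ≠ p.2 ∧ ∀ r, r ≠ p.1 → r ≠ p.2 →
        |dd (x ∘ σ) r| < |dd (x ∘ σ) p.1| ∧ |dd (x ∘ σ) r| < |dd (x ∘ σ) p.2| then (1:ℝ) else 0) := by
    rintro ⟨i, l⟩
    rw [← sum_perm_mul (fun σ : Equiv.Perm (Idx n 1) =>
      (if (i, l).1 ≠ (i, l).2 ∧ ∀ r, r ≠ (i, l).1 → r ≠ (i, l).2 →
        |dd (x ∘ σ) r| < |dd (x ∘ σ) (i, l).1| ∧ |dd (x ∘ σ) r| < |dd (x ∘ σ) (i, l).2| then (1:ℝ) else 0))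
      (Equiv.swap (Sum.inl (i, false)) (Sum.inl (l, true)))]
    refine Finset.sum_le_sum fun σ _ => ?_
    by_cases h : i ≠ l ∧ 5 * ‖dd (x ∘ σ)‖ < |x (σ (Sum.inl (i, false))) - x (σ (Sum.inl (l, false)))|
    · rw [if_pos h, if_pos]
      obtain ⟨hil, h⟩ := h
      refine ⟨hil, fun r hri hrl => ?_⟩
      simp only at hri hrl
      have e1 : dd (x ∘ (σ * Equiv.swap (Sum.inl (i, false)) (Sum.inl (l, true)) : Equiv.Perm (Idx n 1))) r
          = dd (x ∘ σ) r := by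
        simp only [dd, Function.comp, Equiv.Perm.mul_apply]
        rw [Equiv.swap_apply_of_ne_of_ne (by simp) (by simp [hrl]),
          Equiv.swap_apply_of_ne_of_ne (by simp [hri]) (by simp)]
      have e2 : dd (x ∘ (σ * Equiv.swap (Sum.inl (i, false)) (Sum.inl (l, true)) : Equiv.Perm (Idx n 1))) i
          = x (σ (Sum.inl (i, true))) - x (σ (Sum.inl (l, true))) := by
        simp only [dd, Function.comp, Equiv.Perm.mul_apply]
        rw [Equiv.swap_apply_left, Equiv.swap_apply_of_ne_of_ne (by simp) (by simp [hil])]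
      have e3 : dd (x ∘ (σ * Equiv.swap (Sum.inl (i, false)) (Sum.inl (l, true)) : Equiv.Perm (Idx n 1))) l
          = x (σ (Sum.inl (i, false))) - x (σ (Sum.inl (l, false))) := by
        simp only [dd, Function.comp, Equiv.Perm.mul_apply]
        rw [Equiv.swap_apply_right, Equiv.swap_apply_of_ne_of_ne (by simp [Ne.symm hil]) (by simp)]
      simp only
      rw [e1, e2, e3]
      have h2 : |dd (x ∘ σ) r| ≤ ‖dd (x ∘ σ)‖ := norm_le_pi_norm (dd (x ∘ σ)) r
      have h3 := norm_nonneg (dd (x ∘ σ))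
      have h4 : |dd (x ∘ σ) i| ≤ ‖dd (x ∘ σ)‖ := norm_le_pi_norm (dd (x ∘ σ)) i
      have h5 : |dd (x ∘ σ) l| ≤ ‖dd (x ∘ σ)‖ := norm_le_pi_norm (dd (x ∘ σ)) l
      simp only [dd, Function.comp] at h4 h5
      refine ⟨?_, by linarith⟩
      rw [abs_le] at h4 h5
      rcases lt_abs.mp h with h6 | h6
      · exact lt_of_lt_of_le (by linarith) (le_abs_self _)
      · exact lt_of_lt_of_le (by linarith) (neg_le_abs _)
    · rw [if_neg h]; split_ifs <;> norm_num
  refine (Finset.sum_le_sum fun i _ => h1 i).trans ?_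
  rw [Finset.sum_comm]
  calc _ ≤ ∑ σ : Equiv.Perm (Idx n 1), (2:ℝ) := by
        refine Finset.sum_le_sum fun σ _ => ?_
        rw [Finset.sum_boole]
        have := card_top_two (fun r => |dd (x ∘ σ) r|) (Finset.univ.filter (fun p : Fin n × Fin n =>
          p.1 ≠ p.2 ∧ ∀ r, r ≠ p.1 → r ≠ p.2 →
            |dd (x ∘ σ) r| < |dd (x ∘ σ) p.1| ∧ |dd (x ∘ σ) r| < |dd (x ∘ σ) p.2|))
          (fun p hp => (Finset.mem_filter.mp hp).2)
        exact_mod_cast this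
    _ = _ := by simp; ring

open Classical in
lemma count_bad (hn : 0 < n) (x : Idx n 1 → ℝ) :
    ∑ σ : Equiv.Perm (Idx n 1), (if evBad (x ∘ σ) then (1:ℝ) else 0)
      ≤ 3 / n * Fintype.card (Equiv.Perm (Idx n 1)) := by
  have hn0 : (0:ℝ) < n := by exact_mod_cast hn
  have h1 : ∀ σ : Equiv.Perm (Idx n 1), n * (if evBad (x ∘ σ) then (1:ℝ) else 0) ≤
      ∑ i : Fin n,
      (if 4 * ‖dd (x ∘ σ)‖ < |x (σ (Sum.inl (i, false))) - x (σ (Sum.inr 0))| then (1:ℝ) else 0) +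
      ∑ p : Fin n × Fin n,
      (if p.1 ≠ p.2 ∧ 5 * ‖dd (x ∘ σ)‖ < |x (σ (Sum.inl (p.1, false))) - x (σ (Sum.inl (p.2, false)))|
        then (1:ℝ) else 0) := by
    intro σ
    by_cases hb : evBad (x ∘ σ)
    · rw [if_pos hb, mul_one]
      obtain ⟨i, hi⟩ := hb
      have hxx : xx (x ∘ σ) = x (σ (Sum.inr 0)) := by simp [xx]
      have hD := norm_nonneg (dd (x ∘ σ))
      have h9 : 9 * ‖dd (x ∘ σ)‖ < |x (σ (Sum.inl (i, false))) - x (σ (Sum.inr 0))| := by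
        have h4 : |dd (x ∘ σ) i| ≤ ‖dd (x ∘ σ)‖ := norm_le_pi_norm (dd (x ∘ σ)) i
        rw [hxx] at hi
        simp only [dd, mm, Function.comp] at h4 hi
        rw [abs_le] at h4
        rcases lt_abs.mp hi with h6 | h6
        · refine lt_of_lt_of_le ?_ (le_abs_self _)
          linarith
        · refine lt_of_lt_of_le ?_ (neg_le_abs _)
          linarith
      have h10 : ∑ l : Fin n, (if i ≠ l ∧ 5 * ‖dd (x ∘ σ)‖ <
          |x (σ (Sum.inl (i, false))) - x (σ (Sum.inl (l, false)))| then (1:ℝ) else 0) ≤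
          ∑ p : Fin n × Fin n, (if p.1 ≠ p.2 ∧ 5 * ‖dd (x ∘ σ)‖ <
            |x (σ (Sum.inl (p.1, false))) - x (σ (Sum.inl (p.2, false)))| then (1:ℝ) else 0) := by
        rw [Fintype.sum_prod_type]
        exact Finset.single_le_sum (f := fun i => ∑ l : Fin n, (if i ≠ l ∧ 5 * ‖dd (x ∘ σ)‖ <
          |x (σ (Sum.inl (i, false))) - x (σ (Sum.inl (l, false)))| then (1:ℝ) else 0))
          (fun i _ => Finset.sum_nonneg fun l _ => by split_ifs <;> norm_num) (Finset.mem_univ i)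
      refine le_trans ?_ (add_le_add le_rfl h10)
      rw [← Finset.sum_add_distrib]
      calc (n:ℝ) = ∑ l : Fin n, (1:ℝ) := by simp
        _ ≤ _ := Finset.sum_le_sum fun l _ => ?_
      by_cases hG : 4 * ‖dd (x ∘ σ)‖ < |x (σ (Sum.inl (l, false))) - x (σ (Sum.inr 0))|
      · rw [if_pos hG]
        split_ifs <;> norm_num
      · rw [if_neg hG, if_pos, zero_add]
        constructor
        · rintro rfl
          exact hG (by linarith)
        · push Not at hG
          have := abs_sub_le (x (σ (Sum.inl (i, false)))) (x (σ (Sum.inl (l, false)))) (x (σ (Sum.inr 0)))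
          linarith
    · rw [if_neg hb, mul_zero]
      refine add_nonneg (Finset.sum_nonneg fun l _ => ?_) (Finset.sum_nonneg fun l _ => ?_) <;>
        split_ifs <;> norm_num
  have h2 := Finset.sum_le_sum fun (σ : Equiv.Perm (Idx n 1)) (_ : σ ∈ Finset.univ) => h1 σ
  rw [Finset.sum_add_distrib, ← Finset.mul_sum] at h2
  have h3 := count_G x
  have h4 := count_H x
  rw [div_mul_eq_mul_div, le_div_iff₀ hn0]
  linarith

open Classical in
lemma count_evE (n o : ℕ) (hn : 40 ≤ n) (ho : o ≤ 1) (x : Idx n o → ℝ) (hx : Function.Injective x) :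
    ∑ σ : Equiv.Perm (Idx n o), (if evE (x ∘ σ) then (1:ℝ) else 0)
      ≤ 25000003 / n * Fintype.card (Equiv.Perm (Idx n o)) := by
  have h1 := count_evE' hn ho x hx
  have hn0 : (0:ℝ) < n := by exact_mod_cast (by omega : 0 < n)
  have hsplit : (25000003:ℝ) / n * Fintype.card (Equiv.Perm (Idx n o)) =
    25000000 / n * Fintype.card (Equiv.Perm (Idx n o)) + 3 / n * Fintype.card (Equiv.Perm (Idx n o)) := by ring
  have hnn : (0:ℝ) ≤ 3 / n * Fintype.card (Equiv.Perm (Idx n o)) := by positivity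
  rcases (by omega : o = 0 ∨ o = 1) with rfl | rfl
  · have : ∑ σ : Equiv.Perm (Idx n 0), (if evE (x ∘ σ) then (1:ℝ) else 0) ≤
      ∑ σ : Equiv.Perm (Idx n 0), (if evE' (x ∘ σ) then (1:ℝ) else 0) := by
      refine Finset.sum_le_sum fun σ _ => ?_
      by_cases h : evE (x ∘ σ)
      · rw [if_pos h, if_pos (evE_sub_zero _ h)]
      · rw [if_neg h]; split_ifs <;> norm_num
    linarith
  · have h2 := count_bad (by omega) x
    have : ∑ σ : Equiv.Perm (Idx n 1), (if evE (x ∘ σ) then (1:ℝ) else 0) ≤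
      ∑ σ : Equiv.Perm (Idx n 1), (if evE' (x ∘ σ) then (1:ℝ) else 0) +
      ∑ σ : Equiv.Perm (Idx n 1), (if evBad (x ∘ σ) then (1:ℝ) else 0) := by
      rw [← Finset.sum_add_distrib]
      refine Finset.sum_le_sum fun σ _ => ?_
      by_cases h : evE (x ∘ σ)
      · by_cases hb : evBad (x ∘ σ)
        · rw [if_pos h, if_pos hb]; split_ifs <;> norm_num
        · rw [if_pos h, if_pos (evE_sub_one (by omega) _ h hb), if_neg hb]; norm_num
      · rw [if_neg h]; split_ifs <;> norm_num
    linarith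

end badcount

section final

/-- numbering of the positions -/
def posFun (n o : ℕ) : Idx n o → Fin (2 * n + o)
  | Sum.inl (i, b) => ⟨2 * i + o + b.toNat, by have := i.2; have := b.toNat_le; omega⟩
  | Sum.inr j => ⟨j, by have := j.2; omega⟩

lemma posFun_bij (n o : ℕ) : Function.Bijective (posFun n o) := by
  rw [Fintype.bijective_iff_injective_and_card]
  constructor
  · rintro (⟨i, b⟩ | j) (⟨i', b'⟩ | j') h
    · have h : 2 * (i:ℕ) + o + b.toNat = 2 * i' + o + b'.toNat := congrArg Fin.val h
      have e1 : b = b' := by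
        cases b <;> cases b' <;> simp at h ⊢ <;> omega
      subst e1
      have e2 : i = i' := by ext; omega
      rw [e2]
    · have h : 2 * (i:ℕ) + o + b.toNat = j' := congrArg Fin.val h
      have := j'.2
      omega
    · have h : (j:ℕ) = 2 * i' + o + b'.toNat := congrArg Fin.val h
      have := j.2
      omega
    · have h : (j:ℕ) = j' := congrArg (Fin.val (n := 2 * n + o)) h
      have e2 : j = j' := by ext; omega
      rw [e2]
  · simp [mul_comm]

/-- numbering of the positions as an equivalence -/
noncomputable def posE (n o : ℕ) : Idx n o ≃ Fin (2 * n + o) := Equiv.ofBijective _ (posFun_bij n o)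

lemma posE_inl (n o : ℕ) (i : Fin n) (b : Bool) :
    ((posE n o (Sum.inl (i, b)) : Fin (2 * n + o)) : ℕ) = 2 * i + o + b.toNat := rfl

lemma posE_inr (n o : ℕ) (j : Fin o) : ((posE n o (Sum.inr j) : Fin (2 * n + o)) : ℕ) = j := rfl

lemma event_iff (n o : ℕ) (ho : o ≤ 1) (x : Fin (2 * n + o) → ℝ) :
    (|∑ j : Fin (2 * n + o), (-1:ℝ)^((j:ℕ)+1) * ((j:ℕ) + 1 : ℝ) * x j|
            ≤ |∑ j : Fin (2 * n + o), (-1:ℝ)^((j:ℕ)+1) * x j|) ↔ evE (x ∘ posE n o) := by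
  have e1 : ∑ j : Fin (2 * n + o), (-1:ℝ)^((j:ℕ)+1) * ((j:ℕ) + 1 : ℝ) * x j =
      (-1) ^ o * ((xx (x ∘ posE n o) + ∑ i, mm (x ∘ posE n o) i) + ∑ i, cc n o i * dd (x ∘ posE n o) i) := by
    rw [← Equiv.sum_comp (posE n o), Fintype.sum_sum_type, Fintype.sum_prod_type, add_assoc,
      ← Finset.sum_add_distrib, mul_add, Finset.mul_sum, add_comm]
    congr 1
    · rcases (by omega : o = 0 ∨ o = 1) with rfl | rfl
      · simp [xx]
      · simp [xx, posE_inr]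
    · refine Finset.sum_congr rfl fun i _ => ?_
      rw [Fintype.sum_bool]
      simp only [posE_inl, mm, dd, cc, Function.comp]
      have h2 : (-1:ℝ) ^ (2 * (i:ℕ)) = 1 := by rw [pow_mul]; norm_num
      simp only [pow_add, h2, Bool.toNat_true, Bool.toNat_false]
      push_cast
      ring
  have e2 : ∑ j : Fin (2 * n + o), (-1:ℝ)^((j:ℕ)+1) * x j =
      (-1) ^ o * (xx (x ∘ posE n o) + ∑ i, dd (x ∘ posE n o) i) := by
    rw [← Equiv.sum_comp (posE n o), Fintype.sum_sum_type, Fintype.sum_prod_type,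
      mul_add, Finset.mul_sum, add_comm]
    congr 1
    · rcases (by omega : o = 0 ∨ o = 1) with rfl | rfl
      · simp [xx]
      · simp [xx, posE_inr]
    · refine Finset.sum_congr rfl fun i _ => ?_
      rw [Fintype.sum_bool]
      simp only [posE_inl, dd, Function.comp]
      have h2 : (-1:ℝ) ^ (2 * (i:ℕ)) = 1 := by rw [pow_mul]; norm_num
      simp only [pow_add, h2, Bool.toNat_true, Bool.toNat_false]
      ring
  have e3 : |(-1:ℝ) ^ o| = 1 := by rw [abs_pow]; simp
  rw [e1, e2, abs_mul, abs_mul, e3, one_mul, one_mul]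
  rfl

open Classical in
lemma count_fin (k : ℕ) (hk : 100 ≤ k) (x : Fin k → ℝ) (hx : Function.Injective x) :
    ∑ σ : Equiv.Perm (Fin k), (if |∑ j : Fin k, (-1:ℝ)^((j:ℕ)+1) * ((j:ℕ) + 1 : ℝ) * (x ∘ σ) j|
            ≤ |∑ j : Fin k, (-1:ℝ)^((j:ℕ)+1) * (x ∘ σ) j| then (1:ℝ) else 0)
      ≤ 100000000 / k * Fintype.card (Equiv.Perm (Fin k)) := by
  obtain ⟨n, o, ho, rfl⟩ : ∃ n o : ℕ, o ≤ 1 ∧ k = 2 * n + o := ⟨k / 2, k % 2, by omega, by omega⟩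
  have h := count_evE n o (by omega) ho (x ∘ posE n o) (hx.comp (posE n o).injective)
  have hn : (40:ℝ) ≤ n := by exact_mod_cast (by omega : 40 ≤ n)
  have ho' : (o:ℝ) ≤ 1 := by exact_mod_cast ho
  have h1 : ∑ σ : Equiv.Perm (Fin (2 * n + o)),
      (if |∑ j : Fin (2 * n + o), (-1:ℝ)^((j:ℕ)+1) * ((j:ℕ) + 1 : ℝ) * (x ∘ σ) j|
            ≤ |∑ j : Fin (2 * n + o), (-1:ℝ)^((j:ℕ)+1) * (x ∘ σ) j| then (1:ℝ) else 0) =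
      ∑ σ : Equiv.Perm (Idx n o), (if evE ((x ∘ posE n o) ∘ σ) then (1:ℝ) else 0) := by
    simp only [event_iff n o ho]
    refine Fintype.sum_equiv (posE n o).permCongr.symm _ _ fun σ => ?_
    have : (x ∘ σ) ∘ posE n o = (x ∘ posE n o) ∘ ((posE n o).permCongr.symm σ) := by
      funext i
      simp [Equiv.permCongr]
    rw [this]
  have h2 : Fintype.card (Equiv.Perm (Idx n o)) = Fintype.card (Equiv.Perm (Fin (2 * n + o))) :=
    Fintype.card_congr (posE n o).permCongr
  rw [h1]
  refine h.trans ?_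
  rw [h2]
  have h3 : (25000003:ℝ) / n ≤ 100000000 / ((2 * n + o : ℕ) : ℝ) := by
    push_cast
    rw [div_le_div_iff₀ (by linarith) (by positivity)]
    linarith
  gcongr

lemma ae_inj (k : ℕ) : ∀ᵐ x ∂(volume : Measure (Fin k → ℝ)), Function.Injective x := by
  have h : ∀ i j : Fin k, i ≠ j → ∀ᵐ x ∂(volume : Measure (Fin k → ℝ)), x i ≠ x j := by
    intro i j hij
    set L : (Fin k → ℝ) →ₗ[ℝ] ℝ := (LinearMap.proj i : (Fin k → ℝ) →ₗ[ℝ] ℝ) - LinearMap.proj j with hL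
    have h1 : (volume : Measure (Fin k → ℝ)) (LinearMap.ker L : Set (Fin k → ℝ)) = 0 := by
      apply Measure.addHaar_submodule
      intro htop
      have : Pi.single i (1:ℝ) ∈ LinearMap.ker L := by rw [htop]; trivial
      rw [LinearMap.mem_ker] at this
      simp [hL, Pi.single_apply, hij.symm] at this
    rw [ae_iff]
    refine measure_mono_null ?_ h1
    intro x hx
    simp only [ne_eq, not_not, Set.mem_setOf_eq] at hx
    simp [hL, hx]
  have h2 : ∀ᵐ x ∂(volume : Measure (Fin k → ℝ)), ∀ i j : Fin k, i ≠ j → x i ≠ x j := by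
    rw [ae_all_iff]; intro i
    rw [ae_all_iff]; intro j
    by_cases hij : i = j
    · simp [hij]
    · filter_upwards [h i j hij] with x hx _ using hx
  filter_upwards [h2] with x hx
  intro i j hij
  by_contra hne
  exact hx i j hne hij

open Classical in
lemma measure_step (k : ℕ) (μ : Measure (Fin k → ℝ)) [IsProbabilityMeasure μ]
    (hex : ∀ σ : Equiv.Perm (Fin k), μ.map (fun x => x ∘ σ) = μ)
    (E : Set (Fin k → ℝ)) (hE : MeasurableSet E) (K : ℝ)
    (h : ∀ᵐ x ∂μ, ∑ σ : Equiv.Perm (Fin k), (if x ∘ σ ∈ E then (1:ℝ) else 0)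
      ≤ K * Fintype.card (Equiv.Perm (Fin k))) : μ E ≤ ENNReal.ofReal K := by
  have hm : ∀ σ : Equiv.Perm (Fin k), Measurable (fun x : Fin k → ℝ => x ∘ σ) := fun σ =>
    measurable_pi_lambda _ fun i => measurable_pi_apply _
  set P : ENNReal := (Fintype.card (Equiv.Perm (Fin k)) : ENNReal) with hP
  have hP0 : P ≠ 0 := by simp [hP, Fintype.card_ne_zero]
  have hPt : P ≠ ⊤ := by simp [hP]
  have h1 : ∀ σ : Equiv.Perm (Fin k), μ E = ∫⁻ x, ENNReal.ofReal (if x ∘ σ ∈ E then (1:ℝ) else 0) ∂μ := by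
    intro σ
    calc μ E = μ.map (fun x => x ∘ σ) E := by rw [hex σ]
      _ = μ ((fun x => x ∘ σ) ⁻¹' E) := Measure.map_apply (hm σ) hE
      _ = ∫⁻ x, ((fun x : Fin k → ℝ => x ∘ σ) ⁻¹' E).indicator 1 x ∂μ := (lintegral_indicator_one ((hm σ) hE)).symm
      _ = _ := by
        refine lintegral_congr fun x => ?_
        by_cases hx : x ∘ σ ∈ E
        · simp [Set.indicator, hx]
        · simp [Set.indicator, hx]
  have h2 : P * μ E = ∫⁻ x, ∑ σ : Equiv.Perm (Fin k), ENNReal.ofReal (if x ∘ σ ∈ E then (1:ℝ) else 0) ∂μ := by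
    rw [lintegral_finsetSum]
    · simp only [← h1, Finset.sum_const, Finset.card_univ, nsmul_eq_mul, hP]
    · intro σ _
      exact (Measurable.ite (hm σ hE) measurable_const measurable_const).ennreal_ofReal
  have h3 : P * μ E ≤ P * ENNReal.ofReal K := by
    rw [h2]
    calc _ ≤ ∫⁻ x, ENNReal.ofReal (K * Fintype.card (Equiv.Perm (Fin k))) ∂μ := by
          refine lintegral_mono_ae ?_
          filter_upwards [h] with x hx
          rw [← ENNReal.ofReal_sum_of_nonneg (fun σ _ => by split_ifs <;> norm_num)]
          exact ENNReal.ofReal_le_ofReal hx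
      _ = P * ENNReal.ofReal K := by
          rw [lintegral_const, measure_univ, mul_one, mul_comm K,
            ENNReal.ofReal_mul (Nat.cast_nonneg _), ENNReal.ofReal_natCast]
  exact (ENNReal.mul_le_mul_iff_right hP0 hPt).mp h3

end final

theorem stmt_4 :
    ∃ C > (0:ℝ), ∀ (k : ℕ), 1 ≤ k →
      ∀ (μ : Measure (Fin k → ℝ)), IsProbabilityMeasure μ →
      (∀ σ : Equiv.Perm (Fin k), μ.map (fun x => x ∘ σ) = μ) →
      μ ≪ (volume : Measure (Fin k → ℝ)) →
      (μ {x | |∑ j : Fin k, (-1:ℝ)^((j:ℕ)+1) * ((j:ℕ) + 1 : ℝ) * x j|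
            ≤ |∑ j : Fin k, (-1:ℝ)^((j:ℕ)+1) * x j|}) ≤ ENNReal.ofReal (C / k) := by
  refine ⟨100000000, by norm_num, fun k hk μ hμ hex hac => ?_⟩
  by_cases hk2 : 100 ≤ k
  · refine measure_step k μ hex _ ?_ _ ?_
    · refine (isClosed_le ?_ ?_).measurableSet <;> fun_prop
    · filter_upwards [hac.ae_le (ae_inj k)] with x hx
      exact count_fin k hk2 x hx
  · refine le_trans prob_le_one ?_
    rw [← ENNReal.ofReal_one]
    apply ENNReal.ofReal_le_ofReal
    have h1 : (k:ℝ) ≤ 100 := by exact_mod_cast (by omega : k ≤ 100)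
    have h2 : (0:ℝ) < k := by exact_mod_cast hk
    rw [le_div_iff₀ h2]
    linarith
end

section
/- Let $n\ge 2$ and let $w_1,\ldots,w_n$ be real numbers with $\sum_{i=1}^n w_i=0$ and $\sum_{i=1}^n w_i^2=1$. Let $\pi$ be a uniform random permutation of $\{1,\ldots,n\}$. Then for every $L\in\mathbb{R}$, $\mathbb{P}\{|\sum_{i=1}^n w_i \pi(i) - Ln| \le 1\} \le (C/n)\, e^{-c|L|}$ for absolute constants $C,c>0$. -/
open Finset

/-- the permutation statistic -/
noncomputable def pS {n : ℕ} (w : Fin n → ℝ) (π : Equiv.Perm (Fin n)) : ℝ :=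
  ∑ i, w i * ((π i : ℕ) : ℝ)

lemma exp_sub_sq_le (y : ℝ) : Real.exp (y - y ^ 2) ≤ 1 + y + y ^ 2 := by
  by_cases h : y ≤ -(1/2)
  · have h1 : Real.exp (y - y^2) ≤ Real.exp (-(3/4)) := by
      apply Real.exp_le_exp.mpr; nlinarith
    have h2 : Real.exp (-(3/4)) ≤ 3/4 := by
      have := Real.add_one_le_exp (3/4 : ℝ)
      rw [Real.exp_neg]
      rw [inv_le_comm₀ (Real.exp_pos _) (by norm_num)]
      linarith
    nlinarith [sq_nonneg (y + 1/2)]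
  · push Not at h
    -- exp(y^2-y) ≥ 1 + (y^2 - y) + ... use exp(-(y-y^2)) 
    have h3 : 1 ≤ (1 + y + y^2) * (1 - (y - y^2)) ∨ 1/2 < y := by
      by_cases hy : y ≤ 1
      · left; nlinarith [sq_nonneg y, sq_nonneg (y^2)]
      · right; linarith
    rcases h3 with h3 | h3
    · have h4 := Real.add_one_le_exp (-(y - y^2))
      rw [Real.exp_neg] at h4
      have h5 : 0 < 1 + y + y^2 := by nlinarith [sq_nonneg (y + 1/2)]
      have h6 : 1 ≤ (1 + y + y^2) * (Real.exp (y - y^2))⁻¹ := by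
        refine h3.trans (mul_le_mul_of_nonneg_left (by linarith) h5.le)
      rw [← div_eq_mul_inv, le_div_iff₀ (Real.exp_pos _)] at h6
      linarith
    · by_cases hy : y ≤ 1
      · have h4 : Real.exp (y - y^2) ≤ Real.exp (1/4) := by
          apply Real.exp_le_exp.mpr; nlinarith [sq_nonneg (y - 1/2)]
        have h5 : Real.exp (1/4) ≤ 4/3 := by
          have := Real.add_one_le_exp (-(1/4) : ℝ)
          rw [Real.exp_neg] at this
          rw [← inv_inv (Real.exp (1/4)), inv_le_comm₀ (by positivity) (by norm_num)]
          linarith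
        nlinarith
      · have : Real.exp (y - y^2) ≤ 1 := by
          apply Real.exp_le_one_iff.mpr; nlinarith
        nlinarith

lemma pS_inv {n : ℕ} (w : Fin n → ℝ) (π : Equiv.Perm (Fin n)) :
    pS w π⁻¹ = ∑ u, w (π u) * ((u : ℕ) : ℝ) := by
  unfold pS
  rw [← Equiv.sum_comp π]
  simp

lemma sum_fin_val (m : ℕ) : ∑ u : Fin m, ((u : ℕ) : ℝ) = (m:ℝ) * (m - 1) / 2 := by
  rw [Fin.sum_univ_eq_sum_range (fun i => (i:ℝ))]
  induction m with
  | zero => simp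
  | succ k ih => rw [sum_range_succ, ih]; push_cast; ring

lemma sum_swap_succ {m : ℕ} (i : Fin (m+1)) (f : Fin (m+1) → ℝ) :
    ∑ j : Fin m, f (Equiv.swap 0 i j.succ) = (∑ j, f j) - f i := by
  have := Equiv.sum_comp (Equiv.swap 0 i) f
  rw [Fin.sum_univ_succ] at this
  simp at this
  linarith

lemma mgf_bound (n : ℕ) : ∀ (w : Fin n → ℝ) (s : ℝ), ∑ i, w i = 0 →
    ∑ π : Equiv.Perm (Fin n), Real.exp (s * pS w π) ≤
      n.factorial * Real.exp (s ^ 2 * n ^ 2 * (∑ i, w i ^ 2) / 2) := by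
  induction n with
  | zero => intro w s _; simp [pS]
  | succ m ih =>
    intro w s hw
    rcases Nat.eq_zero_or_pos m with rfl | hm
    · simp at hw
      simp [pS, hw]
    have hm' : (0:ℝ) < m := by exact_mod_cast hm
    have hm1 : (1:ℝ) ≤ m := by exact_mod_cast hm
    set Q := ∑ i, w i ^ 2 with hQ
    have key : ∑ π : Equiv.Perm (Fin (m+1)), Real.exp (s * pS w π)
        = ∑ i : Fin (m+1), ∑ e : Equiv.Perm (Fin m),
          Real.exp (s * (pS (fun j => w (Equiv.swap 0 i j.succ) + w i / m) e⁻¹ - w i * (m+1) / 2)) := by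
      rw [← Equiv.sum_comp (Equiv.inv (Equiv.Perm (Fin (m+1))))]
      rw [← Equiv.sum_comp (Equiv.Perm.decomposeFin (n := m)).symm]
      rw [Fintype.sum_prod_type]
      refine sum_congr rfl fun i _ => sum_congr rfl fun e _ => ?_
      congr 2
      simp only [Equiv.inv_apply, pS_inv]
      rw [Fin.sum_univ_succ]
      simp only [Equiv.Perm.decomposeFin_symm_apply_zero, Equiv.Perm.decomposeFin_symm_apply_succ,
        Fin.val_zero, Fin.val_succ]
      push_cast
      have h1 : ∑ u : Fin m, w (Equiv.swap 0 i (e u).succ) = - w i := by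
        rw [Equiv.sum_comp e (fun j => w (Equiv.swap 0 i j.succ)), sum_swap_succ i w, hw]; ring
      simp only [mul_add, add_mul, sum_add_distrib, ← mul_sum, sum_fin_val, h1, mul_one]
      field_simp
      ring
    rw [key]
    have h2 : ∀ i : Fin (m+1), ∑ e : Equiv.Perm (Fin m),
          Real.exp (s * (pS (fun j => w (Equiv.swap 0 i j.succ) + w i / m) e⁻¹ - w i * (m+1) / 2))
          ≤ m.factorial * (Real.exp (s^2 * m^2 * Q / 2) * 
            (1 + (-(s * w i * (m+1)/2)) + (-(s * w i * (m+1)/2))^2)) := by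
      intro i
      have h3 : ∑ j : Fin m, (w (Equiv.swap 0 i j.succ) + w i / m) = 0 := by
        rw [sum_add_distrib, sum_swap_succ i w, hw]; simp; field_simp; ring
      have h4 : ∑ j : Fin m, (w (Equiv.swap 0 i j.succ) + w i / m)^2 = Q - w i ^2 * (m+1)/m := by
        simp only [add_sq, sum_add_distrib, ← mul_sum, ← sum_mul]
        rw [sum_swap_succ i w, sum_swap_succ i (fun j => w j ^2), hw]
        simp; field_simp; ring
      have h5 := ih (fun j => w (Equiv.swap 0 i j.succ) + w i / m) s h3
      rw [h4, ← Equiv.sum_comp (Equiv.inv (Equiv.Perm (Fin m)))] at h5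
      simp only [Equiv.inv_apply] at h5
      have h6 : ∀ e : Equiv.Perm (Fin m), Real.exp (s * (pS (fun j => w (Equiv.swap 0 i j.succ) + w i / m) e⁻¹ - w i * (m+1) / 2)) = Real.exp (-(s * w i * (m+1)/2)) * Real.exp (s * (pS (fun j => w (Equiv.swap 0 i j.succ) + w i / m) e⁻¹)) := by
        intro e; rw [← Real.exp_add]; congr 1; ring
      simp only [h6, ← mul_sum]
      set y := -(s * w i * (m+1)/2) with hy
      calc _ ≤ Real.exp y * (m.factorial * Real.exp (s ^ 2 * m ^ 2 * (Q - w i ^2 * (m+1)/m) / 2)) :=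
            mul_le_mul_of_nonneg_left h5 (Real.exp_pos _).le
        _ = m.factorial * Real.exp (s^2 * m^2*Q/2 + (y - s^2 * m * (m+1) * w i^2 / 2)) := by
            rw [mul_left_comm, ← Real.exp_add]; congr 2; field_simp; ring
        _ ≤ m.factorial * Real.exp (s^2 * m^2*Q/2 + (y - y^2)) := by
            gcongr
            rw [hy]
            have : 0 ≤ s^2 * w i^2 := by positivity
            have h7 : (m+1:ℝ)^2/4 ≤ m * (m+1)/2 := by nlinarith
            nlinarith
        _ ≤ _ := by
            rw [Real.exp_add]
            gcongr
            exact exp_sub_sq_le y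
    calc _ ≤ ∑ i : Fin (m+1), (m.factorial * (Real.exp (s^2 * m^2 * Q / 2) * 
            (1 + (-(s * w i * (m+1)/2)) + (-(s * w i * (m+1)/2))^2)) : ℝ) := sum_le_sum fun i _ => h2 i
      _ = m.factorial * (Real.exp (s^2*m^2*Q/2) * ((m+1) + s^2*(m+1)^2/4 * Q)) := by
          rw [← mul_sum, ← mul_sum]
          congr 2
          have e1 : ∀ i, (1 + (-(s * w i * (m+1)/2)) + (-(s * w i * (m+1)/2))^2) = 
             1 + (-(s*(m+1)/2)) * w i + (s^2*(m+1)^2/4) * w i ^2 := by intro i; ring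
          simp only [e1, sum_add_distrib, ← mul_sum, hw, ← hQ]
          simp
      _ ≤ _ := by
          have hQ0 : 0 ≤ Q := sum_nonneg fun i _ => sq_nonneg _
          rw [Nat.factorial_succ]
          push_cast
          have h8 : ((m+1:ℝ) + s^2*(m+1)^2/4 * Q) ≤ (m+1) * Real.exp (s^2*(m+1)/4*Q) := by
            have := Real.add_one_le_exp (s^2*(m+1)/4*Q)
            nlinarith
          calc _ ≤ (m.factorial:ℝ) * (Real.exp (s^2*m^2*Q/2) * ((m+1) * Real.exp (s^2*(m+1)/4*Q))) := by gcongr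
            _ = (m+1)* m.factorial * Real.exp (s^2*m^2*Q/2 + s^2*(m+1)/4*Q) := by
                rw [Real.exp_add]; ring
            _ ≤ _ := by
                gcongr
                have : 0 ≤ s^2 * Q := by positivity
                nlinarith

section Fourier
variable {n K : ℕ}

/-- half of the change of the statistic under a swap -/
noncomputable def pA (w : Fin n → ℝ) (p q : Fin K → Fin n) (k : Fin K) (π : Equiv.Perm (Fin n)) : ℝ :=
  (w (p k) - w (q k)) * (((π (p k) : ℕ) : ℝ) - ((π (q k) : ℕ) : ℝ)) / 2

lemma pS_swap (w : Fin n → ℝ) (a b : Fin n) (hab : a ≠ b) (π : Equiv.Perm (Fin n)) :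
    pS w (π * Equiv.swap a b) =
      pS w π - (w a - w b) * (((π a : ℕ) : ℝ) - ((π b : ℕ) : ℝ)) := by
  unfold pS
  have : ∑ i, w i * (((π * Equiv.swap a b) i : ℕ) : ℝ) - ∑ i, w i * ((π i : ℕ) : ℝ)
      = - ((w a - w b) * (((π a : ℕ) : ℝ) - ((π b : ℕ) : ℝ))) := by
    rw [← sum_sub_distrib]
    rw [← Finset.sum_subset (Finset.subset_univ {a, b})]
    · rw [sum_pair hab]; simp; ring
    · intro x _ hx
      simp at hx
      rw [Equiv.Perm.mul_apply, Equiv.swap_apply_of_ne_of_ne hx.1 hx.2]; ring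
  linarith

variable (w : Fin n → ℝ) (p q : Fin K → Fin n)

lemma pA_swap_self (k : Fin K) (π : Equiv.Perm (Fin n)) :
    pA w p q k (π * Equiv.swap (p k) (q k)) = - pA w p q k π := by
  simp [pA]; ring

lemma pA_swap_ne (hp : Function.Injective p) (hq : Function.Injective q)
    (hpq : ∀ k l, p k ≠ q l) (k l : Fin K) (hkl : l ≠ k) (π : Equiv.Perm (Fin n)) :
    pA w p q l (π * Equiv.swap (p k) (q k)) = pA w p q l π := by
  unfold pA
  rw [Equiv.Perm.mul_apply, Equiv.Perm.mul_apply,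
    Equiv.swap_apply_of_ne_of_ne (hp.ne hkl) (hpq _ _),
    Equiv.swap_apply_of_ne_of_ne (hpq _ _).symm (hq.ne hkl)]

lemma sign_identity (hp : Function.Injective p) (hq : Function.Injective q)
    (hpq : ∀ k l, p k ≠ q l) (z : ℂ) (A : Finset (Fin K)) :
    ∑ π : Equiv.Perm (Fin n), Complex.exp (z * pS w π) *
      ∏ k ∈ A, ((1 + Complex.exp (-2 * z * pA w p q k π)) / 2)
    = ∑ π : Equiv.Perm (Fin n), Complex.exp (z * pS w π) := by
  induction A using Finset.induction_on with
  | empty => simp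
  | insert k A hk ih =>
    rw [← ih]
    set X : Equiv.Perm (Fin n) → ℂ := fun π => Complex.exp (z * pS w π) *
      ∏ k ∈ A, ((1 + Complex.exp (-2 * z * pA w p q k π)) / 2) with hX
    have h1 : ∑ π, X π = ∑ π, X (π * Equiv.swap (p k) (q k)) :=
      (Equiv.sum_comp (Equiv.mulRight (Equiv.swap (p k) (q k))) X).symm
    have h2 : ∑ π, X π = ∑ π, (X π + X (π * Equiv.swap (p k) (q k))) / 2 := by
      rw [← sum_div, sum_add_distrib, ← h1]; ring
    rw [h2]
    refine sum_congr rfl fun π _ => ?_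
    rw [prod_insert hk]
    have h3 : X (π * Equiv.swap (p k) (q k)) = X π * Complex.exp (-2 * z * pA w p q k π) := by
      simp only [hX]
      have h4 : ∀ l ∈ A, ((1 + Complex.exp (-2 * z * pA w p q l (π * Equiv.swap (p k) (q k)))) / 2)
          = ((1 + Complex.exp (-2 * z * pA w p q l π)) / 2) := by
        intro l hl
        rw [pA_swap_ne w p q hp hq hpq k l (fun h => hk (h ▸ hl))]
      rw [prod_congr rfl h4, mul_right_comm, ← Complex.exp_add]
      congr 2
      rw [pS_swap w _ _ (hpq k k)]
      simp only [pA]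
      push_cast
      ring
    rw [h3]
    simp only [hX]
    ring

lemma sign_identity_real (hp : Function.Injective p) (hq : Function.Injective q)
    (hpq : ∀ k l, p k ≠ q l) (s : ℝ) :
    ∑ π : Equiv.Perm (Fin n), Real.exp (s * pS w π) *
      ∏ k, ((1 + Real.exp (-2 * s * pA w p q k π)) / 2)
    = ∑ π : Equiv.Perm (Fin n), Real.exp (s * pS w π) := by
  have := sign_identity w p q hp hq hpq (s : ℂ) univ
  exact_mod_cast this

lemma norm_q_le (s t a : ℝ) (h : |s * a| ≤ 1) :
    ‖(1 + Complex.exp (-2 * ((s:ℂ) + t * Complex.I) * a)) / 2‖ ≤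
      (1 + Real.exp (-2 * s * a)) / 2 * Real.exp (-(Real.sin (t * a) ^ 2 / 8)) := by
  set y := Real.exp (-2 * s * a) with hy
  have hy0 : 0 < y := Real.exp_pos _
  have hsa := abs_le.mp h
  have e2 : Real.exp 2 ≤ 8 := by
    have := Real.exp_one_lt_d9
    rw [show (2:ℝ) = 1 + 1 by norm_num, Real.exp_add]; nlinarith [Real.exp_pos 1]
  have hy8 : y ≤ 8 := le_trans (Real.exp_le_exp.mpr (by nlinarith)) e2
  have hy8' : 1 ≤ 8 * y := by
    have : Real.exp (-2) ≤ y := Real.exp_le_exp.mpr (by nlinarith)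
    rw [Real.exp_neg] at this
    have h3 : (8:ℝ)⁻¹ ≤ (Real.exp 2)⁻¹ := inv_anti₀ (Real.exp_pos _) e2
    linarith
  have hexp : Complex.exp (-2 * ((s:ℂ) + t * Complex.I) * a)
      = y * (Real.cos (2 * (t * a)) - Real.sin (2 * (t*a)) * Complex.I) := by
    rw [show -2 * ((s:ℂ) + t * Complex.I) * a = ((-2 * s * a : ℝ) : ℂ) + ((-(2 * (t * a)) : ℝ):ℂ) * Complex.I by push_cast; ring]
    rw [Complex.exp_add, Complex.exp_mul_I, ← Complex.ofReal_exp, ← hy, ← Complex.ofReal_cos, ← Complex.ofReal_sin, Real.cos_neg, Real.sin_neg]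
    push_cast; ring
  have hns : ‖(1 + Complex.exp (-2 * ((s:ℂ) + t * Complex.I) * a)) / 2‖ ^ 2 =
      ((1 + y)^2 - 4 * y * Real.sin (t * a)^2) / 4 := by
    have c1 := Real.cos_two_mul' (t*a)
    have c2 := Real.sin_sq_add_cos_sq (2 * (t*a))
    have c3 := Real.sin_sq_add_cos_sq (t*a)
    have c4 : Real.cos (2 * (t*a)) = 1 - 2 * Real.sin (t*a)^2 := by linarith
    have c5 : Real.sin (2 * (t*a))^2 = 1 - (1 - 2 * Real.sin (t*a)^2)^2 := by rw [← c4]; linarith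
    rw [hexp, ← Complex.normSq_eq_norm_sq]
    generalize Real.cos (2 * (t*a)) = C at *
    generalize Real.sin (2 * (t*a)) = D at *
    rw [show (1 + (y:ℂ) * (C - D * Complex.I)) / 2 = (((1 + y * C)/2 : ℝ):ℂ) + ((-(y*D)/2 : ℝ):ℂ) * Complex.I by push_cast; ring]
    rw [Complex.normSq_add_mul_I, c4]
    linear_combination (y^2/4) * c5
  refine (sq_le_sq₀ (norm_nonneg _) (by positivity)).mp ?_
  rw [hns, mul_pow, ← Real.exp_nat_mul]
  have h5 : 1 - Real.sin (t*a)^2/4 ≤ Real.exp ((2:ℕ) * -(Real.sin (t * a) ^ 2 / 8)) := by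
    refine le_trans ?_ (Real.add_one_le_exp _)
    push_cast; linarith
  refine le_trans ?_ (mul_le_mul_of_nonneg_left h5 (by positivity))
  have h6 : (1+y)^2 ≤ 16 * y := by nlinarith
  nlinarith [sq_nonneg (Real.sin (t*a))]

lemma charfun_bound (hp : Function.Injective p) (hq : Function.Injective q)
    (hpq : ∀ k l, p k ≠ q l) (s t : ℝ) (hs : ∀ k π, |s * pA w p q k π| ≤ 1) :
    ‖∑ π : Equiv.Perm (Fin n), Complex.exp (((s:ℂ) + t * Complex.I) * pS w π)‖ ^ 2 ≤
      (∑ π : Equiv.Perm (Fin n), Real.exp (2 * s * pS w π)) *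
      ∑ π : Equiv.Perm (Fin n), ∏ k, Real.exp (-(Real.sin (t * pA w p q k π) ^ 2 / 4)) := by
  rw [← sign_identity w p q hp hq hpq _ univ, ← sign_identity_real w p q hp hq hpq (2*s)]
  have h1 : ‖∑ π : Equiv.Perm (Fin n), Complex.exp (((s:ℂ) + t * Complex.I) * pS w π) *
      ∏ k, ((1 + Complex.exp (-2 * ((s:ℂ) + t * Complex.I) * pA w p q k π)) / 2)‖ ≤
      ∑ π : Equiv.Perm (Fin n), (Real.exp (s * pS w π) * ∏ k, ((1 + Real.exp (-2 * s * pA w p q k π)) / 2)) * ∏ k, Real.exp (-(Real.sin (t * pA w p q k π) ^ 2 / 8)) := by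
    refine (norm_sum_le _ _).trans (sum_le_sum fun π _ => ?_)
    rw [norm_mul, mul_assoc, ← prod_mul_distrib, Complex.norm_exp, norm_prod]
    refine mul_le_mul (le_of_eq ?_) (prod_le_prod (fun _ _ => norm_nonneg _) fun k _ => norm_q_le s t _ (hs k π)) (by positivity) (Real.exp_pos _).le
    simp
  refine (pow_le_pow_left₀ (norm_nonneg _) h1 2).trans ?_
  refine (sum_mul_sq_le_sq_mul_sq _ _ _).trans ?_
  refine mul_le_mul (sum_le_sum fun π _ => ?_) (le_of_eq (sum_congr rfl fun π _ => ?_)) (by positivity) (by positivity)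
  · rw [mul_pow, ← prod_pow, ← Real.exp_nat_mul]
    refine mul_le_mul (le_of_eq (by congr 1; push_cast; ring)) (prod_le_prod (fun _ _ => by positivity) fun k _ => ?_) (by positivity) (by positivity)
    have : Real.exp (-2 * (2 * s) * pA w p q k π) = Real.exp (-2 * s * pA w p q k π)^2 := by
      rw [← Real.exp_nat_mul]; congr 1; push_cast; ring
    rw [this]
    nlinarith [sq_nonneg (Real.exp (-2 * s * pA w p q k π) - 1)]
  · rw [← prod_pow]
    refine prod_congr rfl fun k _ => ?_
    rw [← Real.exp_nat_mul]; congr 1; push_cast; ring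

end Fourier

lemma sin_sq_sub_le (α β : ℝ) : Real.sin (α - β)^2 ≤ 2 * (Real.sin α^2 + Real.sin β^2) := by
  rw [Real.sin_sub]
  have h1 := Real.sin_sq_add_cos_sq α
  have h2 := Real.sin_sq_add_cos_sq β
  have h3 : (Real.sin α * Real.cos β)^2 ≤ Real.sin α^2 := by
    rw [mul_pow]; nlinarith [sq_nonneg (Real.sin α), sq_nonneg (Real.sin β)]
  have h4 : (Real.cos α * Real.sin β)^2 ≤ Real.sin β^2 := by
    rw [mul_pow]; nlinarith [sq_nonneg (Real.sin α), sq_nonneg (Real.sin β)]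
  nlinarith [sq_nonneg (Real.sin α * Real.cos β + Real.cos α * Real.sin β)]

lemma sum_sin_sq_ge (n h : ℕ) (R : Finset ℕ) (hR : R ⊆ range n) (hc : 3 * n ≤ 4 * #R)
    (hh : 4 * h ≤ n) (θ u : ℝ) :
    n / 16 * Real.sin (θ * h)^2 ≤ ∑ v ∈ R, Real.sin (θ * (u - v))^2 := by
  set B := R.filter (fun v => v + h ∈ R) with hB
  have hcard : n ≤ 4 * #B := by
    have e1 : B.image (· + h) = R ∩ R.image (· + h) := by
      ext x
      simp only [hB, mem_image, mem_filter, mem_inter]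
      constructor
      · rintro ⟨v, ⟨h1, h2⟩, rfl⟩; exact ⟨h2, v, h1, rfl⟩
      · rintro ⟨h1, v, h2, rfl⟩; exact ⟨v, ⟨h2, h1⟩, rfl⟩
    have e2 : #(B.image (· + h)) = #B := card_image_of_injective _ (add_left_injective h)
    have e3 : #(R.image (· + h)) = #R := card_image_of_injective _ (add_left_injective h)
    have e4 : R ∪ R.image (· + h) ⊆ range (n + h) := by
      intro x hx
      simp only [mem_union, mem_image] at hx
      rcases hx with hx | ⟨v, hv, rfl⟩
      · have := mem_range.mp (hR hx); simp; omega
      · have := mem_range.mp (hR hv); simp; omega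
    have e5 := card_le_card e4
    have e6 := card_union_add_card_inter R (R.image (· + h))
    rw [← e1, e2, e3] at e6
    simp at e5
    omega
  have s1 : ∑ v ∈ B, Real.sin (θ * (u - v))^2 ≤ ∑ v ∈ R, Real.sin (θ * (u - v))^2 :=
    sum_le_sum_of_subset_of_nonneg (filter_subset _ _) fun _ _ _ => sq_nonneg _
  have s2 : ∑ v ∈ B, Real.sin (θ * (u - (v + h : ℕ)))^2 ≤ ∑ v ∈ R, Real.sin (θ * (u - v))^2 := by
    rw [← sum_image (s := B) (g := (· + h)) (f := fun v : ℕ => Real.sin (θ * (u - v))^2) (fun a _ b _ hab => by simpa using hab)]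
    refine sum_le_sum_of_subset_of_nonneg ?_ fun _ _ _ => sq_nonneg _
    intro x hx
    simp only [mem_image, hB, mem_filter] at hx
    obtain ⟨v, ⟨_, h2⟩, rfl⟩ := hx
    exact h2
  have s3 : ∑ v ∈ B, Real.sin (θ * h)^2 ≤ ∑ v ∈ B, 2 * (Real.sin (θ * (u - v))^2 + Real.sin (θ * (u - (v + h : ℕ)))^2) := by
    refine sum_le_sum fun v _ => ?_
    have := sin_sq_sub_le (θ * (u - v)) (θ * (u - (v + h : ℕ)))
    have e : θ * (u - v) - θ * (u - (v + h : ℕ)) = θ * h := by push_cast; ring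
    rwa [e] at this
  rw [← mul_sum, sum_add_distrib, sum_const, nsmul_eq_mul] at s3
  have hcard' : (n:ℝ) ≤ 4 * #B := by exact_mod_cast hcard
  nlinarith [sq_nonneg (Real.sin (θ * h))]

lemma exists_shift (n : ℕ) (hn : 4 ≤ n) (θ : ℝ) (h0 : 0 ≤ θ) (h1 : θ ≤ 1/2) :
    ∃ h : ℕ, 4 * h ≤ n ∧ min 1 ((n * θ)^2) / 256 ≤ Real.sin (θ * h)^2 := by
  have hsin : ∀ x : ℝ, 0 ≤ x → x ≤ 1 → x / 2 ≤ Real.sin x := by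
    intro x hx0 hx1
    rcases hx0.eq_or_lt with rfl | hx
    · simp
    have := Real.sin_gt_sub_cube hx
    nlinarith [mul_pos hx hx, mul_nonneg hx0 hx0, mul_nonneg hx0 (sub_nonneg.mpr hx1), mul_nonneg (mul_nonneg hx0 hx0) (sub_nonneg.mpr hx1)]
  by_cases hc : θ * (n / 4 : ℕ) ≤ 1
  · refine ⟨n/4, by omega, ?_⟩
    have h2 := hsin (θ * (n/4:ℕ)) (by positivity) hc
    have h3 : (n:ℝ) / 8 ≤ (n/4 : ℕ) := by
      have : n ≤ 8 * (n/4) := by omega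
      have : (n:ℝ) ≤ 8 * (n/4 : ℕ) := by exact_mod_cast this
      linarith
    have h4 : n * θ / 16 ≤ Real.sin (θ * (n/4:ℕ)) := by nlinarith
    have h5 : (n * θ / 16)^2 ≤ Real.sin (θ * (n/4:ℕ))^2 := pow_le_pow_left₀ (by positivity) h4 2
    have := min_le_right 1 ((n*θ)^2)
    nlinarith
  · push Not at hc
    have hθ : 0 < θ := by
      rcases h0.eq_or_lt with rfl | h
      · simp at hc; linarith
      · exact h
    have hf := Nat.floor_le (a := 1/θ) (by positivity)
    have hf2 := Nat.lt_floor_add_one (1/θ)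
    rw [le_div_iff₀ hθ] at hf
    rw [div_lt_iff₀ hθ] at hf2
    refine ⟨⌊1/θ⌋₊, ?_, ?_⟩
    · have : ((⌊1/θ⌋₊:ℕ):ℝ) ≤ (n/4:ℕ) := by nlinarith
      have : ⌊1/θ⌋₊ ≤ n/4 := by exact_mod_cast this
      omega
    · have h2 := hsin (θ * ⌊1/θ⌋₊) (by positivity) (by linarith)
      have h3 : 1/4 ≤ Real.sin (θ * ⌊1/θ⌋₊) := by nlinarith
      have := min_le_left 1 ((n*θ)^2)
      nlinarith

section L5
variable {n K : ℕ} (w : Fin n → ℝ) (p q : Fin K → Fin n)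

lemma sum_exp_sin_le (hn : 4 ≤ n) (θ u : ℝ) (h1 : |θ| ≤ 1/2) (Y : Finset (Fin n)) (hY : 3 * n ≤ 4 * #Y)
    (π : Equiv.Perm (Fin n)) :
    ∑ y ∈ Y, Real.exp (-(Real.sin (θ * (u - (π y : ℕ)))^2/4)) ≤
      #Y * Real.exp (-(min 1 ((n * θ)^2) / 32768)) := by
  set x := min 1 ((n * θ)^2) with hx
  have hx0 : 0 ≤ x := le_min zero_le_one (sq_nonneg _)
  set f : Fin n → ℕ := fun y => (π y : ℕ) with hf
  have hfi : Function.Injective f := Fin.val_injective.comp π.injective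
  obtain ⟨h, hh, hs⟩ := exists_shift n hn |θ| (abs_nonneg _) h1
  have hsum := sum_sin_sq_ge n h (Y.image f) (by
    intro v hv; simp only [mem_image] at hv; obtain ⟨y, _, rfl⟩ := hv; simp [hf]) (by
    rw [card_image_of_injective _ hfi]; exact hY) hh θ u
  rw [sum_image (fun a _ b _ hab => hfi hab)] at hsum
  have e1 : Real.sin (|θ| * h)^2 = Real.sin (θ * h)^2 := by
    rcases abs_choice θ with h | h <;> rw [h]
    rw [neg_mul, Real.sin_neg, neg_sq]
  rw [e1] at hs
  have e2 : ((n:ℝ) * |θ|)^2 = (n*θ)^2 := by rw [mul_pow, mul_pow, sq_abs]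
  rw [e2, ← hx] at hs
  have hle : ∀ y ∈ Y, Real.exp (-(Real.sin (θ * (u - (π y : ℕ)))^2/4)) ≤ 1 - Real.sin (θ * (u - (f y : ℕ)))^2 / 8 := by
    intro y _
    set z := Real.sin (θ * (u - (π y : ℕ)))^2 with hz
    have z0 : 0 ≤ z := sq_nonneg _
    have z1 : z ≤ 1 := Real.sin_sq_le_one _
    have h2 := Real.add_one_le_exp (z/4)
    rw [Real.exp_neg, inv_le_comm₀ (Real.exp_pos _) (by linarith)]
    refine le_trans ?_ h2
    rw [inv_le_iff_one_le_mul₀ (by linarith)]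
    nlinarith
  refine (sum_le_sum hle).trans ?_
  rw [sum_sub_distrib, ← sum_div]
  have hcn : (#Y:ℝ) ≤ n := by exact_mod_cast (card_le_univ Y).trans (by simp)
  have h3 := Real.add_one_le_exp (-(x/32768))
  have h4 : (#Y:ℝ) * (1 - x/32768) ≤ #Y * Real.exp (-(x/32768)) := by gcongr; linarith
  refine le_trans ?_ h4
  simp
  have h5 : (n:ℝ)/16 * (x/256) ≤ n/16 * Real.sin (θ * h)^2 := by gcongr
  nlinarith

lemma prod_sin_bound (hn : 4 ≤ n) (hK : 8 * K ≤ n) (hq : Function.Injective q)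
    (hpq : ∀ k l, p k ≠ q l) (t : ℝ) (ht : ∀ k, |t * (w (p k) - w (q k)) / 2| ≤ 1/2)
    (A : Finset (Fin K)) :
    ∑ π : Equiv.Perm (Fin n), ∏ k ∈ A, Real.exp (-(Real.sin (t * pA w p q k π) ^ 2 / 4)) ≤
      n.factorial * ∏ k ∈ A, Real.exp (-(min 1 ((n * (t * (w (p k) - w (q k)) / 2))^2) / 32768)) := by
  induction A using Finset.induction_on with
  | empty => simp [Fintype.card_perm]
  | insert k A hk ih =>
    set θ := t * (w (p k) - w (q k)) / 2 with hθ
    set F : Equiv.Perm (Fin n) → ℝ := fun π => ∏ k ∈ A, Real.exp (-(Real.sin (t * pA w p q k π) ^ 2 / 4)) with hF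
    have hF0 : ∀ π, 0 ≤ F π := fun π => prod_nonneg fun _ _ => (Real.exp_pos _).le
    set Y : Finset (Fin n) := (A.image p ∪ A.image q ∪ {p k})ᶜ with hYdef
    have hAK : #A + 1 ≤ K := by
      have := card_le_univ (insert k A)
      rw [card_insert_of_notMem hk] at this
      simpa using this
    have hY : 3 * n ≤ 4 * #Y := by
      have c1 : #(A.image p ∪ A.image q ∪ {p k}) ≤ #A + #A + 1 := by
        refine (card_union_le _ _).trans ?_
        have := card_union_le (A.image p) (A.image q)
        have := card_image_le (s := A) (f := p)
        have := card_image_le (s := A) (f := q)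
        simp; omega
      rw [hYdef, card_compl, Fintype.card_fin]
      omega
    have hY0 : (0:ℝ) < #Y := by
      have : 0 < #Y := by omega
      exact_mod_cast this
    have key : ∀ y ∈ Y, ∑ π : Equiv.Perm (Fin n), F π * Real.exp (-(Real.sin (t * pA w p q k π) ^ 2 / 4)) =
       ∑ π : Equiv.Perm (Fin n), F π * Real.exp (-(Real.sin (θ * (((π (p k) : ℕ):ℝ) - (π y : ℕ))) ^ 2 / 4)) := by
      intro y hy
      simp only [hYdef, mem_compl, mem_union, mem_image, mem_singleton, not_or, not_exists, not_and] at hy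
      obtain ⟨⟨hy1, hy2⟩, hy3⟩ := hy
      rw [← Equiv.sum_comp (Equiv.mulRight (Equiv.swap (q k) y))]
      refine sum_congr rfl fun π _ => ?_
      simp only [Equiv.coe_mulRight]
      congr 1
      · refine prod_congr rfl fun l hl => ?_
        have hlk : l ≠ k := fun h => hk (h ▸ hl)
        unfold pA
        rw [Equiv.Perm.mul_apply, Equiv.Perm.mul_apply,
          Equiv.swap_apply_of_ne_of_ne (hpq _ _) (hy1 l hl),
          Equiv.swap_apply_of_ne_of_ne (hq.ne hlk) (hy2 l hl)]
      · unfold pA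
        rw [Equiv.Perm.mul_apply, Equiv.Perm.mul_apply, Equiv.swap_apply_left,
          Equiv.swap_apply_of_ne_of_ne (hpq _ _) (Ne.symm hy3), hθ]
        congr 5
        ring
    have h2 : (#Y:ℝ) * ∑ π : Equiv.Perm (Fin n), F π * Real.exp (-(Real.sin (t * pA w p q k π) ^ 2 / 4))
        ≤ #Y * (Real.exp (-(min 1 ((n * θ)^2) / 32768)) * ∑ π, F π) := by
      rw [← nsmul_eq_mul, ← sum_const, sum_congr rfl key, sum_comm]
      calc _ = ∑ π, F π * ∑ y ∈ Y, Real.exp (-(Real.sin (θ * (((π (p k) : ℕ):ℝ) - (π y : ℕ))) ^ 2 / 4)) := by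
            simp only [mul_sum]
        _ ≤ ∑ π, F π * (#Y * Real.exp (-(min 1 ((n * θ)^2) / 32768))) :=
            sum_le_sum fun π _ => mul_le_mul_of_nonneg_left (sum_exp_sin_le hn θ _ (ht k) Y hY π) (hF0 π)
        _ = _ := by rw [← sum_mul]; ring
    have h3 := le_of_mul_le_mul_left h2 hY0
    simp only [prod_insert hk]
    calc _ = ∑ π : Equiv.Perm (Fin n), F π * Real.exp (-(Real.sin (t * pA w p q k π) ^ 2 / 4)) :=
          sum_congr rfl fun π _ => mul_comm _ _
      _ ≤ _ := h3
      _ ≤ _ := by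
        rw [mul_left_comm]
        exact mul_le_mul_of_nonneg_left ih (Real.exp_pos _).le

end L5

/-- averaging: a good family of disjoint pairs -/
lemma exists_pairs (n K : ℕ) (hn : 2 ≤ n) (hK : 2 * K ≤ n) (w : Fin n → ℝ) (hw : ∑ i, w i = 0)
    (hw2 : ∑ i, w i ^ 2 = 1) :
    ∃ p q : Fin K → Fin n, Function.Injective p ∧ Function.Injective q ∧ (∀ k l, p k ≠ q l) ∧
      2 * K / n ≤ ∑ k, (w (p k) - w (q k))^2 := by
  set p0 : Fin K → Fin n := fun k => ⟨k, by omega⟩ with hp0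
  set q0 : Fin K → Fin n := fun k => ⟨K + k, by omega⟩ with hq0
  have hp : Function.Injective p0 := fun a b h => by simp [hp0] at h; exact Fin.ext h
  have hq : Function.Injective q0 := fun a b h => by simp [hq0] at h; exact Fin.ext h
  have hpq : ∀ k l, p0 k ≠ q0 l := fun k l h => by simp [hp0, hq0] at h; omega
  -- invariance
  let M : Fin n → Fin n → ℝ := fun a b => ∑ ρ : Equiv.Perm (Fin n), (w (ρ a) - w (ρ b))^2
  have hinv : ∀ (τ : Equiv.Perm (Fin n)) a b, M (τ a) (τ b) = M a b := by
    intro τ a b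
    exact Equiv.sum_comp (Equiv.mulRight τ) (fun ρ : Equiv.Perm (Fin n) => (w (ρ a) - w (ρ b))^2)
  have hself : ∀ a, M a a = 0 := by intro a; simp [M]
  have hconst : ∀ a b c d : Fin n, a ≠ b → c ≠ d → M a b = M c d := by
    intro a b c d hab hcd
    have h1 : M (Equiv.swap a c a) (Equiv.swap a c b) = M a b := hinv _ a b
    rw [Equiv.swap_apply_left] at h1
    set b' := Equiv.swap a c b
    have hb' : b' ≠ c := by
      intro h
      apply hab
      have : Equiv.swap a c b = Equiv.swap a c a := by rw [Equiv.swap_apply_left]; exact h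
      exact ((Equiv.swap a c).injective this).symm
    have h2 := hinv (Equiv.swap b' d) c b'
    rw [Equiv.swap_apply_left, Equiv.swap_apply_of_ne_of_ne hb'.symm hcd] at h2
    rw [← h1, ← h2]
  have htot : ∑ a, ∑ b, M a b = n.factorial * (2 * n) := by
    have : ∑ a, ∑ b, M a b = ∑ ρ : Equiv.Perm (Fin n), ∑ a, ∑ b, (w (ρ a) - w (ρ b))^2 := by
      simp only [M]
      rw [sum_comm' (t' := univ) (s' := fun _ => univ) (by simp)]
      rw [sum_comm]
      simp only [sum_comm (s := (univ : Finset (Fin n))) (t := (univ : Finset (Equiv.Perm (Fin n))))]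
    rw [this]
    have h2 : ∀ ρ : Equiv.Perm (Fin n), ∑ a, ∑ b, (w (ρ a) - w (ρ b))^2 = 2 * n := by
      intro ρ
      rw [Equiv.sum_comp ρ (fun a => ∑ b, (w a - w (ρ b))^2)]
      have : ∀ a, ∑ b, (w a - w (ρ b))^2 = n * w a^2 + 1 := by
        intro a
        rw [Equiv.sum_comp ρ (fun b => (w a - w b)^2)]
        simp only [sub_sq, sum_add_distrib, sum_sub_distrib, ← mul_sum, hw, hw2]
        simp
      simp only [this, sum_add_distrib, ← mul_sum, hw2]
      simp; ring
    simp [h2, Fintype.card_perm]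
  have hn' : (2:ℝ) ≤ n := by exact_mod_cast hn
  have hM : ∀ a b : Fin n, a ≠ b → 2 * n.factorial / n ≤ M a b := by
    intro a b hab
    have hle : ∑ c, ∑ d, M c d ≤ ∑ c : Fin n, ∑ d : Fin n, M a b := by
      refine sum_le_sum fun c _ => sum_le_sum fun d _ => ?_
      by_cases h : c = d
      · rw [h, hself]; exact sum_nonneg fun _ _ => sq_nonneg _
      · exact (hconst _ _ _ _ h hab).le
    rw [htot] at hle
    simp at hle
    rw [div_le_iff₀ (by linarith)]
    have : (n:ℝ) * (2 * n.factorial) ≤ n * (M a b * n) := by linarith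
    exact le_of_mul_le_mul_left this (by linarith)
  have hsum : ∑ ρ : Equiv.Perm (Fin n), (2 * K / n : ℝ) ≤ ∑ ρ : Equiv.Perm (Fin n), ∑ k, (w (ρ (p0 k)) - w (ρ (q0 k)))^2 := by
    rw [sum_comm]
    have : ∑ k : Fin K, (2 * n.factorial / n : ℝ) ≤ ∑ k, M (p0 k) (q0 k) := sum_le_sum fun k _ => hM _ _ (hpq k k)
    refine le_trans (le_of_eq ?_) this
    simp [Fintype.card_perm]; ring
  obtain ⟨ρ, _, hρ⟩ := exists_le_of_sum_le ⟨1, mem_univ _⟩ hsum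
  exact ⟨ρ ∘ p0, ρ ∘ q0, ρ.injective.comp hp, ρ.injective.comp hq, fun k l h => hpq k l (ρ.injective h), hρ⟩

lemma charfun_final (n : ℕ) (hn : 8 ≤ n) (w : Fin n → ℝ) (hw : ∑ i, w i = 0) (hw2 : ∑ i, w i ^ 2 = 1)
    (δ : ℝ) (hδ0 : 0 < δ) (hδ : δ ≤ 1/2) (hwδ : ∀ i, |w i| ≤ δ) (s t : ℝ) (hs : |s| * n ≤ 1) (ht : |t| ≤ 1) :
    ‖∑ π : Equiv.Perm (Fin n), Complex.exp (((s:ℂ) + t * Complex.I) * pS w π)‖ ≤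
      n.factorial * Real.exp 1 * Real.exp (-(min ((n*t)^2) (1/δ^2) / 2097152)) := by
  obtain ⟨p, q, hp, hq, hpq, hd⟩ := exists_pairs n (n/8) (by omega) (by omega) w hw hw2
  have hn0 : (0:ℝ) < n := by positivity
  have hd8 : 1/8 ≤ ∑ k, (w (p k) - w (q k))^2 := by
    refine le_trans ?_ hd
    rw [le_div_iff₀ hn0]
    have : n ≤ 16 * (n/8) := by omega
    have : (n:ℝ) ≤ 16 * (n/8 : ℕ) := by exact_mod_cast this
    linarith
  have hdd : ∀ k, |w (p k) - w (q k)| ≤ 2 * δ := fun k => by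
    have := abs_sub (w (p k)) (w (q k))
    linarith [hwδ (p k), hwδ (q k)]
  have hsA : ∀ k π, |s * pA w p q k π| ≤ 1 := by
    intro k π
    unfold pA
    have h1 : |((π (p k) : ℕ) : ℝ) - ((π (q k) : ℕ) : ℝ)| ≤ n := by
      have a1 : ((π (p k) : ℕ) : ℝ) ≤ n := by exact_mod_cast (π (p k)).2.le
      have a2 : ((π (q k) : ℕ) : ℝ) ≤ n := by exact_mod_cast (π (q k)).2.le
      have a3 : (0:ℝ) ≤ ((π (p k) : ℕ) : ℝ) := by positivity
      have a4 : (0:ℝ) ≤ ((π (q k) : ℕ) : ℝ) := by positivity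
      rw [abs_le]; constructor <;> linarith
    rw [abs_mul, abs_div, abs_mul, abs_of_pos (two_pos : (0:ℝ) < 2)]
    have h2 : |w (p k) - w (q k)| * |((π (p k) : ℕ) : ℝ) - ((π (q k) : ℕ) : ℝ)| ≤ 1 * n :=
      mul_le_mul (by linarith [hdd k]) h1 (abs_nonneg _) (by norm_num)
    nlinarith [abs_nonneg s]
  have hθ : ∀ k, |t * (w (p k) - w (q k)) / 2| ≤ 1/2 := by
    intro k
    rw [abs_div, abs_mul, abs_of_pos (two_pos : (0:ℝ) < 2)]
    have : |t| * |w (p k) - w (q k)| ≤ 1 * 1 := mul_le_mul ht (by linarith [hdd k]) (abs_nonneg _) (by norm_num)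
    linarith
  have h1 := charfun_bound w p q hp hq hpq s t hsA
  have h2 := prod_sin_bound w p q (by omega) (by omega) hq hpq t hθ univ
  have h3 := mgf_bound n w (2*s) hw
  rw [hw2] at h3
  set m := min ((n*t)^2) (1/δ^2) with hm
  have hm0 : 0 ≤ m := le_min (sq_nonneg _) (by positivity)
  have h4 : m / 32 ≤ ∑ k, min 1 ((n * (t * (w (p k) - w (q k)) / 2))^2) := by
    have : ∀ k, (w (p k) - w (q k))^2 * (m/4) ≤ min 1 ((n * (t * (w (p k) - w (q k)) / 2))^2) := by
      intro k
      have hd2 : (w (p k) - w (q k))^2 ≤ (2*δ)^2 := by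
        rw [← sq_abs]; exact pow_le_pow_left₀ (abs_nonneg _) (hdd k) 2
      apply le_min
      · calc _ ≤ (2*δ)^2 * ((1/δ^2)/4) := by
              gcongr
              exact min_le_right _ _
          _ = 1 := by field_simp; ring
      · calc _ ≤ (w (p k) - w (q k))^2 * ((n*t)^2/4) := by
              gcongr
              exact min_le_left _ _
          _ = _ := by ring
    refine le_trans ?_ (sum_le_sum fun k _ => this k)
    rw [← sum_mul]
    nlinarith
  rw [← Real.exp_sum] at h2
  have h5 : Real.exp (∑ k, -(min 1 ((n * (t * (w (p k) - w (q k)) / 2))^2) / 32768)) ≤ Real.exp (-(m / 1048576)) := by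
    apply Real.exp_le_exp.mpr
    rw [sum_neg_distrib, ← sum_div]
    linarith
  have h6 : Real.exp ((2*s)^2 * n^2 * 1/2) ≤ Real.exp 2 := by
    apply Real.exp_le_exp.mpr
    have : (|s| * n)^2 ≤ 1 := by
      rw [sq_le_one_iff₀ (by positivity)]; exact hs
    rw [mul_pow, sq_abs] at this
    nlinarith
  rw [← sq_le_sq₀ (norm_nonneg _) (by positivity)]
  calc _ ≤ _ := h1
    _ ≤ (n.factorial * Real.exp 2) * (n.factorial * Real.exp (-(m / 1048576))) := by
        refine mul_le_mul (h3.trans ?_) (h2.trans ?_) (by positivity) (by positivity)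
        · gcongr
        · gcongr
    _ = _ := by
        rw [mul_pow, mul_pow, ← Real.exp_nat_mul, ← Real.exp_nat_mul]
        rw [show ((2:ℕ):ℝ) * 1 = 2 by norm_num, show ((2:ℕ):ℝ) * -(m/2097152) = -(m/1048576) by push_cast; ring]
        ring

lemma sum_geom_dist (ρ : ℝ) (h0 : 0 ≤ ρ) (h1 : ρ < 1) (N r : ℕ) :
    ∑ r' ∈ range N, ρ ^ (Int.natAbs ((r:ℤ) - r')) ≤ 2 * (1 - ρ)⁻¹ := by
  have hs := summable_geometric_of_lt_one h0 h1
  have ht := tsum_geometric_of_lt_one h0 h1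
  rw [← sum_filter_add_sum_filter_not _ (fun r' => r' ≤ r)]
  have a1 : ∑ r' ∈ (range N).filter (fun r' => r' ≤ r), ρ ^ (Int.natAbs ((r:ℤ) - r')) ≤ (1 - ρ)⁻¹ := by
    rw [← ht]
    rw [← sum_image (f := fun j => ρ ^ j) (g := fun r' : ℕ => Int.natAbs ((r:ℤ) - r'))]
    · exact hs.sum_le_tsum _ fun _ _ => by positivity
    · intro a ha b hb hab
      simp at ha hb hab
      omega
  have a2 : ∑ r' ∈ (range N).filter (fun r' => ¬ r' ≤ r), ρ ^ (Int.natAbs ((r:ℤ) - r')) ≤ (1 - ρ)⁻¹ := by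
    rw [← ht]
    rw [← sum_image (f := fun j => ρ ^ j) (g := fun r' : ℕ => Int.natAbs ((r:ℤ) - r'))]
    · exact hs.sum_le_tsum _ fun _ _ => by positivity
    · intro a ha b hb hab
      simp at ha hb hab
      omega
  linarith

lemma kernel_ge (N : ℕ) (u : ℝ) (hu : ∀ r < N, |(r:ℝ) * u| ≤ 1) :
    (N:ℝ)^2 / 4 ≤ ‖∑ r ∈ range N, Complex.exp ((r:ℂ) * u * Complex.I)‖^2 := by
  have h1 : (N:ℝ)/2 ≤ (∑ r ∈ range N, Complex.exp ((r:ℂ) * u * Complex.I)).re := by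
    rw [Complex.re_sum]
    have : ∑ r ∈ range N, (1/2:ℝ) ≤ ∑ r ∈ range N, (Complex.exp ((r:ℂ) * u * Complex.I)).re := by
      refine sum_le_sum fun r hr => ?_
      have e : (r:ℂ) * u * Complex.I = (((r:ℝ) * u : ℝ):ℂ) * Complex.I := by push_cast; ring
      rw [e, Complex.exp_ofReal_mul_I_re]
      have h2 := Real.one_sub_sq_div_two_le_cos (x := (r:ℝ) * u)
      have h3 := hu r (mem_range.mp hr)
      have h4 : ((r:ℝ)*u)^2 ≤ 1 := by rw [← sq_abs, sq_le_one_iff₀ (abs_nonneg _)]; exact h3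
      linarith
    refine le_trans (le_of_eq ?_) this
    simp; ring
  have h2 := h1.trans (Complex.re_le_norm _)
  have h3 := pow_le_pow_left₀ (by positivity) h2 2
  refine le_trans (le_of_eq ?_) h3
  ring

lemma kernel_expand (N : ℕ) (u : ℝ) :
    ((‖∑ r ∈ range N, Complex.exp ((r:ℂ) * u * Complex.I)‖^2 : ℝ) : ℂ) =
      ∑ r ∈ range N, ∑ r' ∈ range N, Complex.exp (((r:ℂ) - r') * u * Complex.I) := by
  push_cast
  rw [← Complex.mul_conj', map_sum, sum_mul_sum]
  refine sum_congr rfl fun r _ => sum_congr rfl fun r' _ => ?_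
  rw [← Complex.exp_conj, ← Complex.exp_add]
  congr 1
  simp
  ring

lemma smallball (n N : ℕ) (hn : 8 ≤ n) (hN : 1 ≤ N) (hNn : N ≤ n) (w : Fin n → ℝ) (hw : ∑ i, w i = 0)
    (hw2 : ∑ i, w i ^ 2 = 1)
    (δ : ℝ) (hδ0 : 0 < δ) (hδ : δ ≤ 1/2) (hwδ : ∀ i, |w i| ≤ δ)
    (hNδ : (N:ℝ) ≤ Real.exp (1 / δ^2 / 2097152)) (x : ℝ) :
    (#{π : Equiv.Perm (Fin n) | |pS w π - x| ≤ n / N} : ℝ) ≤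
      n.factorial * ((4 * Real.exp 2 * (2 * (1 - Real.exp (-(1/2097152)))⁻¹ + 1)) / N) * Real.exp (-(|x| / n)) := by
  have hn0 : (0:ℝ) < n := by positivity
  have hN0 : (0:ℝ) < N := by positivity
  set ρ := Real.exp (-(1/2097152)) with hρ
  have hρ0 : 0 ≤ ρ := (Real.exp_pos _).le
  have hρ1 : ρ < 1 := by rw [hρ, Real.exp_lt_one_iff]; norm_num
  obtain ⟨s, hs, hsx⟩ : ∃ s : ℝ, |s| * n = 1 ∧ s * x = |x| / n := by
    rcases le_total 0 x with h | h
    · exact ⟨1/n, by rw [abs_of_pos (by positivity)]; field_simp, by rw [abs_of_nonneg h]; ring⟩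
    · exact ⟨-(1/n), by rw [abs_neg, abs_of_pos (by positivity)]; field_simp, by rw [abs_of_nonpos h]; ring⟩
  set B := ({π : Equiv.Perm (Fin n) | |pS w π - x| ≤ n / N} : Finset _) with hB
  set Kn : Equiv.Perm (Fin n) → ℝ := fun π => ‖∑ r ∈ range N, Complex.exp ((r:ℂ) * ((pS w π - x)/n : ℝ) * Complex.I)‖^2 with hKn
  -- lower bound
  have low : (#B : ℝ) * (Real.exp (|x|/n - 1) * ((N:ℝ)^2/4)) ≤ ∑ π, Real.exp (s * pS w π) * Kn π := by
    rw [← nsmul_eq_mul, ← sum_const]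
    refine le_trans (sum_le_sum fun π hπ => ?_) (sum_le_sum_of_subset_of_nonneg (subset_univ B) fun _ _ _ => by positivity)
    have hπ' : |pS w π - x| ≤ n / N := by simpa [hB] using hπ
    refine mul_le_mul (Real.exp_le_exp.mpr ?_) (kernel_ge N _ fun r hr => ?_) (by positivity) (by positivity)
    · have h1 : |s * (pS w π - x)| ≤ 1 := by
        rw [abs_mul]
        calc |s| * |pS w π - x| ≤ |s| * (n / N) := by gcongr
          _ = 1 / N := by rw [← mul_div_assoc, hs]
          _ ≤ 1 := by rw [div_le_one hN0]; exact_mod_cast hN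
      have := (abs_le.mp h1).1
      rw [← hsx]; linarith
    · rw [abs_mul, abs_div, abs_of_pos hn0, abs_of_nonneg (by positivity : (0:ℝ) ≤ (r:ℝ))]
      have hr' : (r:ℝ) ≤ N := by exact_mod_cast hr.le
      calc (r:ℝ) * (|pS w π - x| / n) ≤ N * ((n/N)/n) := by gcongr
        _ = 1 := by field_simp
  -- upper bound
  have up : ∑ π, Real.exp (s * pS w π) * Kn π ≤ 
      ∑ r ∈ range N, ∑ r' ∈ range N, (n.factorial * Real.exp 1 * (ρ ^ (Int.natAbs ((r:ℤ) - r')) + 1 / N)) := by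
    have e1 : ((∑ π, Real.exp (s * pS w π) * Kn π : ℝ) : ℂ) = ∑ r ∈ range N, ∑ r' ∈ range N,
        Complex.exp (-(((r:ℂ) - r') * (x/n) * Complex.I)) * ∑ π, Complex.exp (((s:ℂ) + (((r:ℝ) - r')/n : ℝ) * Complex.I) * pS w π) := by
      push_cast
      have : ∀ π, Complex.exp (s * pS w π) * ((Kn π : ℝ):ℂ) = ∑ r ∈ range N, ∑ r' ∈ range N, Complex.exp (-(((r:ℂ) - r') * (x/n) * Complex.I)) * Complex.exp (((s:ℂ) + (((r:ℝ) - r')/n : ℝ) * Complex.I) * pS w π) := by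
        intro π
        simp only [hKn]
        rw [kernel_expand, mul_sum]
        refine sum_congr rfl fun r _ => ?_
        rw [mul_sum]
        refine sum_congr rfl fun r' _ => ?_
        rw [← Complex.exp_add, ← Complex.exp_add]
        congr 1
        push_cast
        ring
      rw [sum_congr rfl fun π _ => this π, sum_comm]
      refine sum_congr rfl fun r _ => ?_
      rw [sum_comm]
      refine sum_congr rfl fun r' _ => ?_
      rw [mul_sum]
      push_cast
      rfl
    have e2 : ∑ π, Real.exp (s * pS w π) * Kn π ≤ ‖((∑ π, Real.exp (s * pS w π) * Kn π : ℝ) : ℂ)‖ := by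
      rw [Complex.norm_real]; exact Real.le_norm_self _
    refine e2.trans ?_
    rw [e1]
    refine (norm_sum_le _ _).trans (sum_le_sum fun r hr => (norm_sum_le _ _).trans (sum_le_sum fun r' hr' => ?_))
    rw [norm_mul]
    have e3 : ‖Complex.exp (-(((r:ℂ) - r') * (x/n) * Complex.I))‖ = 1 := by
      rw [show -(((r:ℂ) - r') * (x/n) * Complex.I) = ((-(((r:ℝ) - r') * (x/n)) : ℝ) : ℂ) * Complex.I by push_cast; ring]
      exact Complex.norm_exp_ofReal_mul_I _
    rw [e3, one_mul]
    have hr2 : (r:ℝ) ≤ n := by exact_mod_cast ((mem_range.mp hr).le.trans hNn)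
    have hr2' : (r':ℝ) ≤ n := by exact_mod_cast ((mem_range.mp hr').le.trans hNn)
    have hr0 : (0:ℝ) ≤ r := by positivity
    have hr0' : (0:ℝ) ≤ r' := by positivity
    have ht : |((r:ℝ) - r')/n| ≤ 1 := by
      rw [abs_div, abs_of_pos hn0, div_le_one hn0, abs_le]; constructor <;> linarith
    refine (charfun_final n hn w hw hw2 δ hδ0 hδ hwδ s _ hs.le ht).trans ?_
    refine mul_le_mul_of_nonneg_left ?_ (by positivity)
    have e4 : (n:ℝ) * (((r:ℝ) - r')/n) = ((r:ℤ) - r' : ℤ) := by push_cast; field_simp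
    rw [e4]
    rcases min_choice ((((r:ℤ) - r' : ℤ):ℝ)^2) (1/δ^2) with h | h
    · rw [h]
      have : Real.exp (-((((r:ℤ) - r' : ℤ):ℝ)^2 / 2097152)) ≤ ρ ^ (Int.natAbs ((r:ℤ) - r')) := by
        rw [hρ, ← Real.exp_nat_mul]
        apply Real.exp_le_exp.mpr
        set j := ((r:ℤ) - r') 
        have hj : ((j.natAbs : ℕ):ℝ) ≤ (j:ℝ)^2 := by
          have : ((j.natAbs:ℕ):ℝ) ≤ ((j.natAbs:ℕ):ℝ)^2 := by
            exact_mod_cast Nat.le_self_pow two_ne_zero _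
          refine this.trans (le_of_eq ?_)
          rw [Nat.cast_natAbs, Int.cast_abs, sq_abs]
        linarith
      have : 0 ≤ 1/(N:ℝ) := by positivity
      linarith
    · rw [h]
      have : Real.exp (-(1/δ^2 / 2097152)) ≤ 1 / N := by
        rw [Real.exp_neg, one_div (N:ℝ)]
        exact inv_anti₀ hN0 hNδ
      have : 0 ≤ ρ ^ (Int.natAbs ((r:ℤ) - r')) := by positivity
      linarith
  have up2 : ∑ r ∈ range N, ∑ r' ∈ range N, (n.factorial * Real.exp 1 * (ρ ^ (Int.natAbs ((r:ℤ) - r')) + 1 / N))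
      ≤ N * (n.factorial * Real.exp 1 * (2 * (1-ρ)⁻¹ + 1)) := by
    refine (sum_le_card_nsmul _ _ (n.factorial * Real.exp 1 * (2 * (1-ρ)⁻¹ + 1)) fun r _ => ?_).trans (by simp)
    rw [← mul_sum, sum_add_distrib]
    refine mul_le_mul_of_nonneg_left (add_le_add (sum_geom_dist ρ hρ0 hρ1 N r) ?_) (by positivity)
    simp
    rw [mul_inv_cancel₀ hN0.ne']
  have fin := low.trans (up.trans up2)
  rw [Real.exp_sub] at fin
  rw [Real.exp_neg, show (2:ℝ) = 1 + 1 by norm_num, Real.exp_add]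
  set E := Real.exp (|x|/n)
  have hE : 0 < E := Real.exp_pos _
  have he : 0 < Real.exp 1 := Real.exp_pos _
  rw [← le_div_iff₀ (by positivity)] at fin
  refine fin.trans (le_of_eq ?_)
  field_simp
  norm_num

/-- insertion of the item `0` at position `v` in the arrangement `e` of the other items -/
def insPerm {m : ℕ} (x : Fin (m+1) × Equiv.Perm (Fin m)) : Equiv.Perm (Fin (m+1)) :=
  x.1.cycleRange.symm * Equiv.Perm.decomposeFin.symm (0, x.2)

lemma insPerm_zero {m : ℕ} (v : Fin (m+1)) (e : Equiv.Perm (Fin m)) : insPerm (v, e) 0 = v := by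
  simp [insPerm]

lemma insPerm_succ {m : ℕ} (v : Fin (m+1)) (e : Equiv.Perm (Fin m)) (j : Fin m) :
    insPerm (v, e) j.succ = v.succAbove (e j) := by
  simp [insPerm]

lemma insPerm_bij (m : ℕ) : Function.Bijective (insPerm (m := m)) := by
  rw [Fintype.bijective_iff_injective_and_card]
  constructor
  · rintro ⟨v, e⟩ ⟨v', e'⟩ h
    have h0 := congrArg (fun π : Equiv.Perm (Fin (m+1)) => π 0) h
    simp only [insPerm_zero] at h0
    subst h0
    have : e = e' := by
      ext1 j
      have h1 := congrArg (fun π : Equiv.Perm (Fin (m+1)) => π j.succ) h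
      simp only [insPerm_succ] at h1
      exact Fin.succAbove_right_injective h1
    rw [this]
  · simp [Fintype.card_perm, Nat.factorial_succ]

lemma sum_insPerm {m : ℕ} (F : Equiv.Perm (Fin (m+1)) → ℝ) :
    ∑ π, F π = ∑ e : Equiv.Perm (Fin m), ∑ v : Fin (m+1), F (insPerm (v, e)) := by
  rw [← (insPerm_bij m).sum_comp F, Fintype.sum_prod_type, sum_comm]

lemma val_succAbove {m : ℕ} (v : Fin (m+1)) (u : Fin m) :
    ((v.succAbove u : Fin (m+1)) : ℕ) = u + (if (v:ℕ) ≤ u then 1 else 0) := by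
  unfold Fin.succAbove
  simp only [Fin.lt_def, Fin.val_castSucc]
  split_ifs <;> first | omega | simp

lemma pS_insPerm_sub {m : ℕ} (w : Fin (m+1) → ℝ) (e : Equiv.Perm (Fin m)) (y : ℕ → ℝ)
    (hy : ∀ u : Fin m, y u = w (e.symm u).succ) (a b : Fin (m+1)) (hab : a ≤ b) :
    pS w (insPerm (b, e)) - pS w (insPerm (a, e)) = ∑ u ∈ Ico (a:ℕ) b, (w 0 - y u) := by
  have h1 : ∀ v : Fin (m+1), pS w (insPerm (v, e)) = w 0 * (v:ℕ) + ∑ u : Fin m, y u * u +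
      ∑ u ∈ range m, (if (v:ℕ) ≤ u then y u else 0) := by
    intro v
    unfold pS
    rw [Fin.sum_univ_succ, insPerm_zero, add_assoc]
    congr 1
    rw [← Fin.sum_univ_eq_sum_range (fun u => if (v:ℕ) ≤ u then y u else 0), ← sum_add_distrib,
      ← Equiv.sum_comp e (fun u : Fin m => y u * u + if (v:ℕ) ≤ u then y u else 0)]
    refine sum_congr rfl fun j _ => ?_
    rw [insPerm_succ, val_succAbove, hy]
    simp
    split_ifs <;> simp [mul_add]
  rw [h1, h1]
  have h2 : ∑ u ∈ range m, (if (a:ℕ) ≤ u then y u else 0) - ∑ u ∈ range m, (if (b:ℕ) ≤ u then y u else 0)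
      = ∑ u ∈ Ico (a:ℕ) b, y u := by
    rw [← sum_sub_distrib]
    have : Ico (a:ℕ) b = (range m).filter (fun u => (a:ℕ) ≤ u ∧ u < b) := by
      ext u; simp only [mem_Ico, mem_filter, mem_range]
      have := b.2
      omega
    rw [this, sum_filter]
    refine sum_congr rfl fun u _ => ?_
    have : (a:ℕ) ≤ b := hab
    split_ifs <;> first | omega | simp
  rw [sum_sub_distrib, ← h2]
  simp
  rw [Nat.cast_sub (show (a:ℕ) ≤ b from hab)]
  ring

lemma run_bound {m : ℕ} (δ : ℝ) (hδ : 0 < δ) (y : ℕ → ℝ) (hy : ∀ u < m, y u ≤ δ) (g : Fin (m+1) → ℝ)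
    (hg : ∀ a b : Fin (m+1), a ≤ b → g b - g a = ∑ u ∈ Ico (a:ℕ) b, (δ - y u)) (x : ℝ)
    (R : Finset (Fin (m+1))) (hR : ∀ v ∈ R, |g v - x| ≤ 1) (T : Finset ℕ)
    (hT : T = (range m).filter (fun u => δ / 2 < y u)) (D : ℕ) (hD : 4 / δ + 1 < D) :
    ((#R : ℝ) ≤ 4 / δ + #T + 1) ∧ ((∀ u ∈ T, ∀ u' ∈ T, u < u' → D ≤ u' - u) → #R ≤ D) := by
  rcases R.eq_empty_or_nonempty with rfl | hne
  · simp; positivity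
  set a := R.min' hne with ha
  set b := R.max' hne with hb
  have hab : a ≤ b := R.min'_le _ (R.max'_mem hne)
  have hab' : (a:ℕ) ≤ b := hab
  have hbm : (b:ℕ) ≤ m := by have := b.2; omega
  have hsum : ∑ u ∈ Ico (a:ℕ) b, (δ - y u) ≤ 2 := by
    rw [← hg a b hab]
    have h1 := abs_le.mp (hR a (R.min'_mem hne))
    have h2 := abs_le.mp (hR b (R.max'_mem hne))
    linarith
  have hcard : #R ≤ b + 1 - a := by
    have : R ⊆ Icc a b := fun v hv => mem_Icc.mpr ⟨R.min'_le _ hv, R.le_max' _ hv⟩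
    simpa using card_le_card this
  -- non-top items
  have hnt : ∀ c : ℕ, c ≤ b → (#((Ico (a:ℕ) c).filter (fun u => ¬ δ/2 < y u)) : ℝ) ≤ 4 / δ := by
    intro c hc
    have h1 : ∑ u ∈ (Ico (a:ℕ) c).filter (fun u => ¬ δ/2 < y u), δ / 2 ≤ ∑ u ∈ Ico (a:ℕ) b, (δ - y u) := by
      refine le_trans (sum_le_sum (g := fun u => δ - y u) fun u hu => ?_) (sum_le_sum_of_subset_of_nonneg ?_ fun u hu _ => ?_)
      · have := (mem_filter.mp hu).2
        linarith
      · intro u hu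
        have := mem_Ico.mp (mem_filter.mp hu).1
        exact mem_Ico.mpr ⟨this.1, by omega⟩
      · have := mem_Ico.mp hu
        have := hy u (by omega)
        linarith
    rw [sum_const, nsmul_eq_mul] at h1
    rw [le_div_iff₀ hδ]
    linarith
  have hsplit : ∀ c : ℕ, a ≤ c → c ≤ b → c - (a:ℕ) = #((Ico (a:ℕ) c).filter (fun u => δ/2 < y u)) + #((Ico (a:ℕ) c).filter (fun u => ¬ δ/2 < y u)) := by
    intro c _ _
    rw [card_filter_add_card_filter_not]; simp
  have hsubT : ∀ c : ℕ, c ≤ b → (Ico (a:ℕ) c).filter (fun u => δ/2 < y u) ⊆ T := by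
    intro c hc u hu
    rw [hT]
    rw [mem_filter] at hu ⊢
    have := mem_Ico.mp hu.1
    exact ⟨mem_range.mpr (by omega), hu.2⟩
  constructor
  · have h1 := hsplit b hab' le_rfl
    have h2 := hnt b le_rfl
    have h3 := card_le_card (hsubT b le_rfl)
    have h4 : #R ≤ #T + #((Ico (a:ℕ) b).filter (fun u => ¬ δ/2 < y u)) + 1 := by omega
    have h5 : (#R:ℝ) ≤ #T + #((Ico (a:ℕ) b).filter (fun u => ¬ δ/2 < y u)) + 1 := by exact_mod_cast h4
    linarith
  · intro hgood
    by_contra hcon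
    push Not at hcon
    have hc : (a:ℕ) + D ≤ b := by omega
    have h1 := hsplit (a + D) (by omega) hc
    have h2 := hnt _ hc
    have h3 : #((Ico (a:ℕ) (a+D)).filter (fun u => δ/2 < y u)) ≤ 1 := by
      rw [card_le_one]
      intro u hu u' hu'
      have m1 := mem_Ico.mp (mem_filter.mp hu).1
      have m2 := mem_Ico.mp (mem_filter.mp hu').1
      rcases lt_trichotomy u u' with h | h | h
      · have := hgood u (hsubT _ hc hu) u' (hsubT _ hc hu') h; omega
      · exact h
      · have := hgood u' (hsubT _ hc hu') u (hsubT _ hc hu) h; omega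
    have h4 : D ≤ 1 + #((Ico (a:ℕ) (a+D)).filter (fun u => ¬ δ/2 < y u)) := by omega
    have h5 : (D:ℝ) ≤ 1 + #((Ico (a:ℕ) (a+D)).filter (fun u => ¬ δ/2 < y u)) := by exact_mod_cast h4
    linarith

/-- two large items are close -/
def badPerm {n : ℕ} (w : Fin n → ℝ) (δ : ℝ) (D : ℕ) (π : Equiv.Perm (Fin n)) : Prop :=
  ∃ k l : Fin n, δ / 2 < w k ∧ δ / 2 < w l ∧ (π k : ℕ) < π l ∧ (π l : ℕ) ≤ π k + D

open Classical in
lemma insertion_bound {m : ℕ} (w : Fin (m+1) → ℝ) (hw2 : ∑ i, w i ^ 2 = 1) (δ : ℝ) (hδ : 0 < δ) (h0 : w 0 = δ)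
    (hwδ : ∀ i, |w i| ≤ δ) (D : ℕ) (hD : 4 / δ + 1 < D) (x : ℝ) :
    ((m+1 : ℕ) : ℝ) * #{π : Equiv.Perm (Fin (m+1)) | |pS w π - x| ≤ 1} ≤
      D * #{π : Equiv.Perm (Fin (m+1)) | |pS w π - x| ≤ 2 * δ * (m+1 : ℕ) + 1} +
      (4/δ + 4/δ^2 + 1) * #{π : Equiv.Perm (Fin (m+1)) | |pS w π - x| ≤ 2 * δ * (m+1:ℕ) + 1 ∧ badPerm w δ D π} := by
  set M := 4/δ + 4/δ^2 + 1 with hM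
  have hM0 : 0 ≤ M := by positivity
  set H : Equiv.Perm (Fin (m+1)) → ℝ := fun π =>
    D * (if |pS w π - x| ≤ 2 * δ * (m+1 : ℕ) + 1 then 1 else 0) +
    M * (if |pS w π - x| ≤ 2 * δ * (m+1 : ℕ) + 1 ∧ badPerm w δ D π then 1 else 0) with hH
  have hH0 : ∀ π, 0 ≤ H π := by
    intro π; simp only [hH]; positivity
  have hR : D * (#{π : Equiv.Perm (Fin (m+1)) | |pS w π - x| ≤ 2 * δ * (m+1 : ℕ) + 1} : ℝ) +
      M * #{π : Equiv.Perm (Fin (m+1)) | |pS w π - x| ≤ 2 * δ * (m+1:ℕ) + 1 ∧ badPerm w δ D π} = ∑ π, H π := by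
    simp only [hH, sum_add_distrib, ← mul_sum, Finset.sum_boole]
  rw [hR]
  have hL : (#{π : Equiv.Perm (Fin (m+1)) | |pS w π - x| ≤ 1} : ℝ) = ∑ π : Equiv.Perm (Fin (m+1)), (if |pS w π - x| ≤ 1 then (1:ℝ) else 0) := by
    rw [Finset.sum_boole]
  rw [hL, sum_insPerm, sum_insPerm H, mul_sum]
  refine sum_le_sum fun e _ => ?_
  rw [Finset.sum_boole]
  set R := ({v : Fin (m+1) | |pS w (insPerm (v, e)) - x| ≤ 1} : Finset _) with hRdef
  rcases R.eq_empty_or_nonempty with hemp | ⟨v0, hv0⟩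
  · rw [hemp]; simp; exact sum_nonneg fun _ _ => hH0 _
  suffices hsuff : ∀ v : Fin (m+1), (#R : ℝ) ≤ H (insPerm (v, e)) by
    have := card_nsmul_le_sum univ (fun v => H (insPerm (v, e))) (#R : ℝ) fun v _ => hsuff v
    simpa using this
  intro v
  set y : ℕ → ℝ := fun u => if h : u < m then w (e.symm ⟨u, h⟩).succ else 0 with hy
  have hyw : ∀ u : Fin m, y u = w (e.symm u).succ := by intro u; simp [hy]
  have hyδ : ∀ u < m, y u ≤ δ := by
    intro u hu; rw [show u = ((⟨u, hu⟩ : Fin m) : ℕ) from rfl, hyw]; exact (abs_le.mp (hwδ _)).2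
  have hyδ' : ∀ u < m, -δ ≤ y u := by
    intro u hu; rw [show u = ((⟨u, hu⟩ : Fin m) : ℕ) from rfl, hyw]; exact (abs_le.mp (hwδ _)).1
  have hg : ∀ a b : Fin (m+1), a ≤ b → pS w (insPerm (b, e)) - pS w (insPerm (a, e)) = ∑ u ∈ Ico (a:ℕ) b, (δ - y u) := by
    intro a b hab
    rw [pS_insPerm_sub w e y hyw a b hab, h0]
  set T := (range m).filter (fun u => δ / 2 < y u) with hT
  obtain ⟨hb1, hb2⟩ := run_bound δ hδ y hyδ (fun v => pS w (insPerm (v, e))) hg x R (by simp [hRdef]) T hT D hD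
  -- size of T
  have hTc : (#T : ℝ) ≤ 4 / δ^2 := by
    have h1 : ∑ u ∈ T, δ^2/4 ≤ ∑ u ∈ range m, y u^2 := by
      refine le_trans (sum_le_sum (g := fun u => y u^2) fun u hu => ?_) (sum_le_sum_of_subset_of_nonneg (filter_subset _ _) fun _ _ _ => sq_nonneg _)
      have := (mem_filter.mp hu).2
      nlinarith
    have h2 : ∑ u ∈ range m, y u^2 ≤ 1 := by
      rw [← Fin.sum_univ_eq_sum_range (fun u => y u^2)]
      simp only [hyw]
      rw [Equiv.sum_comp e.symm (fun j : Fin m => w j.succ ^2)]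
      rw [Fin.sum_univ_succ] at hw2
      nlinarith [sq_nonneg (w 0)]
    rw [sum_const, nsmul_eq_mul] at h1
    rw [le_div_iff₀ (by positivity)]
    linarith
  -- closeness
  have hclose : |pS w (insPerm (v, e)) - x| ≤ 2 * δ * (m+1:ℕ) + 1 := by
    have h1 : |pS w (insPerm (v0, e)) - x| ≤ 1 := by simpa [hRdef] using hv0
    have hdiff : ∀ a b : Fin (m+1), a ≤ b → |pS w (insPerm (b, e)) - pS w (insPerm (a, e))| ≤ 2 * δ * (m+1:ℕ) := by
      intro a b hab
      rw [hg a b hab]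
      have hlen : ((#(Ico (a:ℕ) b) : ℕ) : ℝ) ≤ (m+1:ℕ) := by
        simp only [Nat.card_Ico]
        have := b.2
        exact_mod_cast (by omega : (b:ℕ) - a ≤ m + 1)
      refine (abs_sum_le_sum_abs _ _).trans ((sum_le_card_nsmul _ _ (2*δ) fun u hu => ?_).trans ?_)
      · have := mem_Ico.mp hu
        have hb := b.2
        rw [abs_le]; constructor <;> linarith [hyδ u (by omega), hyδ' u (by omega)]
      · rw [nsmul_eq_mul]
        nlinarith
    have h2 : |pS w (insPerm (v, e)) - pS w (insPerm (v0, e))| ≤ 2 * δ * (m+1:ℕ) := by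
      rcases le_total v0 v with h | h
      · exact hdiff _ _ h
      · rw [abs_sub_comm]; exact hdiff _ _ h
    have := abs_sub_le (pS w (insPerm (v, e))) (pS w (insPerm (v0, e))) x
    linarith
  simp only [hH, hclose, true_and, if_true, mul_one]
  by_cases hbad : badPerm w δ D (insPerm (v, e))
  · simp only [hbad, if_true, mul_one]
    have : (0:ℝ) ≤ D := by positivity
    linarith
  · simp only [hbad, if_false, mul_zero, add_zero]
    have : #R ≤ D := by
      apply hb2
      intro u hu u' hu' huu
      by_contra hcon
      push Not at hcon
      apply hbad
      rw [hT, mem_filter, mem_range] at hu hu'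
      have a1 := hu.2
      have a2 := hu'.2
      rw [show u = ((⟨u, hu.1⟩ : Fin m) : ℕ) from rfl, hyw] at a1
      rw [show u' = ((⟨u', hu'.1⟩ : Fin m) : ℕ) from rfl, hyw] at a2
      refine ⟨_, _, a1, a2, ?_, ?_⟩
      · rw [insPerm_succ, insPerm_succ, val_succAbove, val_succAbove]
        simp; split_ifs <;> omega
      · rw [insPerm_succ, insPerm_succ, val_succAbove, val_succAbove]
        simp; split_ifs <;> omega
    exact_mod_cast this

open Classical in
lemma bad_count {n : ℕ} (hn : 2 ≤ n) (w : Fin n → ℝ) (hw2 : ∑ i, w i ^ 2 = 1) (δ : ℝ) (hδ : 0 < δ) (D : ℕ) :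
    (#{π : Equiv.Perm (Fin n) | badPerm w δ D π} : ℝ) ≤ n.factorial * ((4/δ^2)^2 * (2 * D / n)) := by
  have hn0 : (2:ℝ) ≤ n := by exact_mod_cast hn
  set P := (univ : Finset (Fin n)).filter (fun k => δ/2 < w k) with hP
  have hPc : (#P : ℝ) ≤ 4 / δ^2 := by
    have h1 : ∑ u ∈ P, δ^2/4 ≤ ∑ u, w u^2 := by
      refine le_trans (sum_le_sum (g := fun u => w u^2) fun u hu => ?_) (sum_le_sum_of_subset_of_nonneg (filter_subset _ _) fun _ _ _ => sq_nonneg _)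
      have := (mem_filter.mp hu).2
      nlinarith
    rw [sum_const, nsmul_eq_mul, hw2] at h1
    rw [le_div_iff₀ (by positivity)]
    linarith
  set Ev : Fin n → Fin n → Finset (Equiv.Perm (Fin n)) := fun k l =>
    {π | (π k : ℕ) < π l ∧ (π l : ℕ) ≤ π k + D} with hEv
  have hsub : ({π : Equiv.Perm (Fin n) | badPerm w δ D π} : Finset _) ⊆ P.biUnion fun k => P.biUnion fun l => Ev k l := by
    intro π hπ
    have hπ := (mem_filter.mp hπ).2
    obtain ⟨k, l, h1, h2, h3, h4⟩ := hπ
    simp only [mem_biUnion, hP, mem_filter, mem_univ, true_and, hEv]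
    exact ⟨k, h1, l, h2, h3, h4⟩
  have hEvc : ∀ k l, (#(Ev k l) : ℝ) ≤ n.factorial * (2 * D / n) := by
    intro k l
    by_cases hkl : k = l
    · subst hkl; simp [hEv]; positivity
    have hinv : ∀ l' ∈ univ.erase k, (#(Ev k l) : ℝ) = #(Ev k l') := by
      intro l' hl'
      have hl'k : l' ≠ k := (mem_erase.mp hl').1
      have := card_map (s := Ev k l) (Equiv.mulRight (Equiv.swap l l')).toEmbedding
      rw [← this]
      congr 2
      ext π
      simp only [hEv, mem_map_equiv, mem_filter, mem_univ, true_and]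
      simp [Equiv.swap_apply_of_ne_of_ne hkl hl'k.symm]
    have h1 : ((n:ℝ) - 1) * #(Ev k l) = ∑ l' ∈ univ.erase k, (#(Ev k l') : ℝ) := by
      rw [← sum_congr rfl hinv, sum_const, card_erase_of_mem (mem_univ _)]
      simp [Nat.cast_sub (by omega : 1 ≤ n)]
    have h2 : ∑ l' ∈ univ.erase k, (#(Ev k l') : ℝ) ≤ ∑ π : Equiv.Perm (Fin n), (D:ℝ) := by
      have : ∀ l', (#(Ev k l') : ℝ) = ∑ π : Equiv.Perm (Fin n), (if (π k : ℕ) < π l' ∧ (π l' : ℕ) ≤ π k + D then (1:ℝ) else 0) := by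
        intro l'; rw [Finset.sum_boole]
      simp only [this]
      rw [sum_comm]
      refine sum_le_sum fun π _ => ?_
      rw [Finset.sum_boole]
      have hc : #((univ.erase k).filter fun l' => (π k : ℕ) < π l' ∧ (π l' : ℕ) ≤ π k + D) ≤ #(Ioc (π k : ℕ) (π k + D)) := by
        refine card_le_card_of_injOn (fun l' => (π l' : ℕ)) ?_ ?_
        · intro l' hl'
          simp at hl'
          simp; exact hl'.2
        · intro a _ b _ hab
          exact π.injective (Fin.ext hab)
      simp only [Nat.card_Ioc, Nat.add_sub_cancel_left] at hc
      exact_mod_cast hc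
    simp only [sum_const, card_univ, Fintype.card_perm, Fintype.card_fin, nsmul_eq_mul] at h2
    rw [← mul_div_assoc, le_div_iff₀ (by linarith)]
    have : (0:ℝ) ≤ #(Ev k l) := by positivity
    nlinarith
  have h3 : (#{π : Equiv.Perm (Fin n) | badPerm w δ D π} : ℝ) ≤ ∑ k ∈ P, ∑ l ∈ P, (#(Ev k l) : ℝ) := by
    have := (card_le_card hsub).trans (card_biUnion_le.trans (sum_le_sum fun k _ => card_biUnion_le))
    exact_mod_cast this
  refine h3.trans ((sum_le_sum fun k _ => sum_le_sum fun l _ => hEvc k l).trans ?_)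
  simp only [sum_const, nsmul_eq_mul]
  have : (#P:ℝ) * #P ≤ (4/δ^2)^2 := by rw [sq]; gcongr
  calc _ = (#P * #P : ℝ) * (n.factorial * (2 * D / n)) := by ring
    _ ≤ (4/δ^2)^2 * (n.factorial * (2 * D / n)) := by gcongr
    _ = _ := by ring

lemma chernoff {n : ℕ} (hn : 0 < n) (w : Fin n → ℝ) (hw : ∑ i, w i = 0) (hw2 : ∑ i, w i ^ 2 = 1) (r x : ℝ) :
    (#{π : Equiv.Perm (Fin n) | |pS w π - x| ≤ r * n} : ℝ) ≤
      n.factorial * Real.exp (1/2 + r) * Real.exp (-(|x| / n)) := by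
  have hn0 : (0:ℝ) < n := by positivity
  obtain ⟨s, hs, hsx⟩ : ∃ s : ℝ, |s| * n = 1 ∧ s * x = |x| / n := by
    rcases le_total 0 x with h | h
    · exact ⟨1/n, by rw [abs_of_pos (by positivity)]; field_simp, by rw [abs_of_nonneg h]; ring⟩
    · exact ⟨-(1/n), by rw [abs_neg, abs_of_pos (by positivity)]; field_simp, by rw [abs_of_nonpos h]; ring⟩
  set B := ({π : Equiv.Perm (Fin n) | |pS w π - x| ≤ r * n} : Finset _) with hB
  have low : (#B : ℝ) * Real.exp (|x|/n - r) ≤ ∑ π, Real.exp (s * pS w π) := by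
    rw [← nsmul_eq_mul, ← sum_const]
    refine le_trans (sum_le_sum fun π hπ => ?_) (sum_le_sum_of_subset_of_nonneg (subset_univ B) fun _ _ _ => by positivity)
    have hπ' : |pS w π - x| ≤ r * n := by simpa [hB] using hπ
    refine Real.exp_le_exp.mpr ?_
    have h1 : |s * (pS w π - x)| ≤ r := by
      rw [abs_mul]
      calc |s| * |pS w π - x| ≤ |s| * (r * n) := by gcongr
        _ = (|s| * n) * r := by ring
        _ = r := by rw [hs, one_mul]
    have := (abs_le.mp h1).1
    rw [← hsx]; linarith
  have up := mgf_bound n w s hw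
  rw [hw2] at up
  have h2 : s^2 * (n:ℝ)^2 * 1 / 2 = 1/2 := by
    have : (|s| * n)^2 = 1 := by rw [hs]; norm_num
    rw [mul_pow, sq_abs] at this
    rw [this]; norm_num
  rw [h2] at up
  have h3 := low.trans up
  rw [← le_div_iff₀ (Real.exp_pos _)] at h3
  refine h3.trans (le_of_eq ?_)
  rw [mul_div_assoc, ← Real.exp_sub, mul_assoc, ← Real.exp_add]
  congr 2
  ring

lemma close_bound : ∃ C > (0:ℝ), ∀ (n : ℕ) (w : Fin n → ℝ), ∑ i, w i = 0 → ∑ i, w i ^ 2 = 1 → ∀ δ : ℝ,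
    0 < δ → δ ≤ 1 → 1 ≤ δ * n → (∀ i, |w i| ≤ δ) → ∀ x : ℝ,
    (#{π : Equiv.Perm (Fin n) | |pS w π - x| ≤ 3 * δ * n} : ℝ) ≤ n.factorial * (C * δ) * Real.exp (-(|x| / n)) := by
  set C0 : ℝ := 4 * Real.exp 2 * (2 * (1 - Real.exp (-(1/2097152)))⁻¹ + 1) with hC0
  have hC0p : 0 < C0 := by
    have : Real.exp (-(1/2097152)) < 1 := by rw [Real.exp_lt_one_iff]; norm_num
    have : 0 < (1 - Real.exp (-(1/2097152)))⁻¹ := inv_pos.mpr (by linarith)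
    positivity
  refine ⟨(2 * C0 + Real.exp (1/2 + 3)) * 4096, by positivity, ?_⟩
  intro n w hw hw2 δ hδ hδ1 hδn hwδ x
  have hn : 0 < n := by
    rcases Nat.eq_zero_or_pos n with h | h
    · subst h; norm_num at hδn
    · exact h
  have hn0 : (0:ℝ) < n := by positivity
  have he := Real.exp_pos (1/2 + 3)
  by_cases hc : 8 ≤ n ∧ δ ≤ 1/4096
  · obtain ⟨hn8, hδc⟩ := hc
    set N := ⌊1/4096/δ⌋₊ with hN
    have h1 : 1 ≤ 1/4096/δ := by rw [le_div_iff₀ hδ]; linarith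
    have hN1 : 1 ≤ N := Nat.le_floor (by simpa using h1)
    have hNle : (N:ℝ) ≤ 1/4096/δ := Nat.floor_le (by positivity)
    have hNlt : 1/4096/δ < N + 1 := Nat.lt_floor_add_one _
    have hN1' : (1:ℝ) ≤ N := by exact_mod_cast hN1
    have hNδ : N * δ ≤ 1/4096 := by rwa [le_div_iff₀ hδ] at hNle
    have hNδ2 : 1/4096 ≤ 2 * N * δ := by
      rw [div_lt_iff₀ hδ] at hNlt; nlinarith
    have hNn : N ≤ n := by
      have : (N:ℝ) ≤ n := by nlinarith
      exact_mod_cast this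
    have hexp : (N:ℝ) ≤ Real.exp (1/δ^2/2097152) := by
      have a1 := Real.add_one_le_exp (1/δ^2/2097152)
      have a2 : 1/4096/δ ≤ 1/δ^2/2097152 + 1 := by
        have : 1/δ^2/2097152 + 1 - 1/4096/δ = (1/δ/2048 - 1)^2 / 2 + 1/2 + 1/δ/4096 + (1/δ)^2/2097152*3/4 := by
          field_simp; ring
        have : 0 ≤ (1/δ/2048 - 1)^2 / 2 + 1/2 + 1/δ/4096 + (1/δ)^2/2097152*3/4 := by positivity
        linarith
      linarith
    have hb := smallball n N hn8 hN1 hNn w hw hw2 δ hδ (by linarith) hwδ hexp x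
    rw [← hC0] at hb
    have hmono : (#{π : Equiv.Perm (Fin n) | |pS w π - x| ≤ 3 * δ * n} : ℝ) ≤ #{π : Equiv.Perm (Fin n) | |pS w π - x| ≤ n / N} := by
      have : 3 * δ * n ≤ n / N := by
        rw [le_div_iff₀ (by linarith)]
        nlinarith
      exact_mod_cast card_le_card (monotone_filter_right _ fun π _ h => le_trans h this)
    refine hmono.trans (hb.trans ?_)
    gcongr
    rw [div_le_iff₀ (by linarith)]
    nlinarith
  · have hδ2 : 1/4096 ≤ δ := by
      by_contra hcon
      push Not at hcon
      apply hc
      refine ⟨?_, hcon.le⟩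
      by_contra h8
      have : (n:ℝ) ≤ 8 := by exact_mod_cast (by omega : n ≤ 8)
      nlinarith
    have hb := chernoff hn w hw hw2 3 x
    have hmono : (#{π : Equiv.Perm (Fin n) | |pS w π - x| ≤ 3 * δ * n} : ℝ) ≤ #{π : Equiv.Perm (Fin n) | |pS w π - x| ≤ 3 * n} := by
      have : 3 * δ * n ≤ 3 * n := by nlinarith
      exact_mod_cast card_le_card (monotone_filter_right _ fun π _ h => le_trans h this)
    refine hmono.trans (hb.trans ?_)
    gcongr
    nlinarith

set_option maxHeartbeats 1600000 in
lemma caseB : ∃ C > (0:ℝ), ∀ (m : ℕ) (w : Fin (m+1) → ℝ), 1 ≤ m → ∑ i, w i = 0 → ∑ i, w i ^ 2 = 1 → ∀ δ : ℝ,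
    0 < δ → w 0 = δ → (∀ i, |w i| ≤ δ) → Real.exp (1/δ^2/2097152) ≤ ((m+1:ℕ):ℝ) → ∀ x : ℝ,
    (#{π : Equiv.Perm (Fin (m+1)) | |pS w π - x| ≤ 1} : ℝ) ≤
      (m+1).factorial * (C / ((m+1:ℕ):ℝ)) * Real.exp (-(|x| / ((m+1:ℕ):ℝ) / 2)) := by
  classical
  obtain ⟨C5, hC5, hclose⟩ := close_bound
  set Q : ℝ := 81 * (192 * Real.exp (1/2+3)) * (120 * 2097152^5) with hQ
  have hQ0 : 0 < Q := by positivity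
  have hQs : Q ≤ (Q+1)^2 := by nlinarith
  clear_value Q
  refine ⟨6 * C5 + (Q + 1), by positivity, ?_⟩
  intro m w hm hw hw2 δ hδ h0 hwδ hexp x
  have hn2 : 2 ≤ m + 1 := by omega
  have hn0 : (0:ℝ) < ((m+1:ℕ):ℝ) := by positivity
  have hδ1 : δ ≤ 1 := by
    have : w 0 ^ 2 ≤ ∑ i, w i ^ 2 := single_le_sum (f := fun i => w i ^ 2) (fun i _ => sq_nonneg _) (mem_univ 0)
    rw [hw2, h0] at this
    nlinarith
  have hδn : 1 ≤ δ * ((m+1:ℕ):ℝ) := by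
    have : ∑ i, w i ^ 2 ≤ ∑ i : Fin (m+1), δ^2 := sum_le_sum fun i _ => by
      rw [← sq_abs]; exact pow_le_pow_left₀ (abs_nonneg _) (hwδ i) 2
    rw [hw2] at this
    simp at this
    push_cast
    have : δ^2 ≤ δ := by nlinarith
    nlinarith
  set D := ⌊4/δ⌋₊ + 2 with hD
  have hD1 : 4/δ + 1 < D := by
    have := Nat.lt_floor_add_one (4/δ)
    push_cast [hD]; linarith
  have hD2 : (D:ℝ) ≤ 6/δ := by
    have h1 := Nat.floor_le (by positivity : 0 ≤ 4/δ)
    have h2 : 2 ≤ 2/δ := by rw [le_div_iff₀ hδ]; linarith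
    have h3 : 6/δ = 4/δ + 2/δ := by ring
    push_cast [hD]; linarith
  have hins := insertion_bound w hw2 δ hδ h0 hwδ D hD1 x
  have hbad := bad_count hn2 w hw2 δ hδ D
  have hcl := hclose (m+1) w hw hw2 δ hδ hδ1 hδn hwδ x
  have hch := chernoff (by omega : 0 < m + 1) w hw hw2 3 x
  set K : ℝ := (#{π : Equiv.Perm (Fin (m+1)) | |pS w π - x| ≤ 2 * δ * ((m+1:ℕ):ℝ) + 1} : ℝ) with hK
  set J : ℝ := (#{π : Equiv.Perm (Fin (m+1)) | |pS w π - x| ≤ 2 * δ * ((m+1:ℕ):ℝ) + 1 ∧ badPerm w δ D π} : ℝ) with hJ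
  set A : ℝ := (#{π : Equiv.Perm (Fin (m+1)) | |pS w π - x| ≤ 1} : ℝ) with hA
  have hKcl : K ≤ (m+1).factorial * (C5 * δ) * Real.exp (-(|x| / ((m+1:ℕ):ℝ))) := by
    refine le_trans ?_ hcl
    have : 2 * δ * ((m+1:ℕ):ℝ) + 1 ≤ 3 * δ * ((m+1:ℕ):ℝ) := by nlinarith
    rw [hK]
    exact Nat.cast_le.mpr (card_le_card (monotone_filter_right _ fun π _ h => le_trans h this))
  have hKch : K ≤ (m+1).factorial * Real.exp (1/2+3) * Real.exp (-(|x| / ((m+1:ℕ):ℝ))) := by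
    refine le_trans ?_ hch
    have : 2 * δ * ((m+1:ℕ):ℝ) + 1 ≤ 3 * ((m+1:ℕ):ℝ) := by nlinarith
    rw [hK]
    exact Nat.cast_le.mpr (card_le_card (monotone_filter_right _ fun π _ h => le_trans h this))
  have hJK : J ≤ K := by
    rw [hJ, hK]
    exact Nat.cast_le.mpr (card_le_card (monotone_filter_right _ fun π _ h => h.1))
  have hJb : J ≤ (m+1).factorial * ((4/δ^2)^2 * (2 * D / ((m+1:ℕ):ℝ))) := by
    refine le_trans ?_ hbad
    rw [hJ]
    exact Nat.cast_le.mpr (card_le_card (monotone_filter_right _ fun π _ h => h.2))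
  have hJ0 : 0 ≤ J := by positivity
  have hK0 : 0 ≤ K := by positivity
  have hA0 : 0 ≤ A := by positivity
  clear_value K J A D
  set F : ℝ := ((m+1).factorial : ℝ) with hF
  have hF0 : 0 < F := by positivity
  set E : ℝ := Real.exp (-(|x| / ((m+1:ℕ):ℝ) / 2)) with hE
  have hE0 : 0 < E := Real.exp_pos _
  have hE1 : E ≤ 1 := by
    rw [hE, Real.exp_le_one_iff]
    have : 0 ≤ |x| / ((m+1:ℕ):ℝ) / 2 := by positivity
    linarith
  have hEE : Real.exp (-(|x| / ((m+1:ℕ):ℝ))) = E^2 := by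
    rw [hE, ← Real.exp_nat_mul]; congr 1; push_cast; ring
  rw [hEE] at hKcl hKch
  -- polynomial vs exponential
  have hpoly : 1 / (δ^9 * ((m+1:ℕ):ℝ)) ≤ 120 * 2097152^5 := by
    have a1 := Real.pow_div_factorial_le_exp (1/δ^2/2097152) (by positivity) 5
    have a2 := a1.trans hexp
    have a3 : (1/δ^2/2097152)^5 / (Nat.factorial 5 : ℝ) = 1 / (δ^10 * (120 * 2097152^5)) := by
      norm_num [Nat.factorial]; field_simp; norm_num
    rw [a3, div_le_iff₀ (by positivity)] at a2
    rw [div_le_iff₀ (by positivity)]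
    have a4 : δ^10 ≤ δ^9 := pow_le_pow_of_le_one hδ.le hδ1 (by norm_num)
    calc 1 ≤ ((m+1:ℕ):ℝ) * (δ^10 * (120 * 2097152^5)) := a2
      _ ≤ ((m+1:ℕ):ℝ) * (δ^9 * (120 * 2097152^5)) := by gcongr
      _ = _ := by ring
  have hJ2 : (9/δ^2 * J)^2 ≤ (F * (Q+1) * E)^2 := by
    calc (9/δ^2 * J)^2 = 81/δ^4 * (J * J) := by ring
      _ ≤ 81/δ^4 * ((F * ((4/δ^2)^2 * (2 * (6/δ) / ((m+1:ℕ):ℝ)))) * (F * Real.exp (1/2+3) * E^2)) := by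
          refine mul_le_mul_of_nonneg_left (mul_le_mul (hJb.trans ?_) (hJK.trans hKch) hJ0 (by positivity)) (by positivity)
          gcongr
      _ = F^2 * E^2 * (81 * (192 * Real.exp (1/2+3)) * (1/(δ^9 * ((m+1:ℕ):ℝ)))) := by
          field_simp; ring
      _ ≤ F^2 * E^2 * Q := by
          rw [hQ]
          exact mul_le_mul_of_nonneg_left (mul_le_mul_of_nonneg_left hpoly (by positivity)) (by positivity)
      _ ≤ F^2 * E^2 * (Q+1)^2 := by
          exact mul_le_mul_of_nonneg_left hQs (by positivity)
      _ = _ := by ring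
  have hJ3 : 9/δ^2 * J ≤ F * (Q+1) * E := by
    rwa [sq_le_sq₀ (by positivity) (by positivity)] at hJ2
  have hcoef : 4/δ + 4/δ^2 + 1 ≤ 9/δ^2 := by
    have h1 : 4/δ ≤ 4/δ^2 := by
      apply div_le_div_of_nonneg_left (by norm_num) (by positivity); nlinarith
    have h2 : 1 ≤ 1/δ^2 := by rw [le_div_iff₀ (by positivity)]; nlinarith
    have h3 : 9/δ^2 = 4/δ^2 + 4/δ^2 + 1/δ^2 := by ring
    linarith
  have hDK : D * K ≤ F * (6 * C5) * E := by
    calc D * K ≤ 6/δ * (F * (C5 * δ) * E^2) := by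
          refine mul_le_mul hD2 hKcl (by positivity) (by positivity)
      _ = F * (6 * C5) * (E * E) := by field_simp
      _ ≤ F * (6 * C5) * (1 * E) := by gcongr
      _ = _ := by ring
  have hfin : ((m+1:ℕ):ℝ) * A ≤ F * (6 * C5 + (Q+1)) * E := by
    refine hins.trans ?_
    have : (4/δ + 4/δ^2 + 1) * J ≤ 9/δ^2 * J := by gcongr
    calc _ ≤ F * (6 * C5) * E + F * (Q+1) * E := by linarith
      _ = _ := by ring
  calc A = (((m+1:ℕ):ℝ) * A) / ((m+1:ℕ):ℝ) := by field_simp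
    _ ≤ (F * (6 * C5 + (Q+1)) * E) / ((m+1:ℕ):ℝ) := by gcongr
    _ = _ := by ring

lemma pS_neg {n : ℕ} (w : Fin n → ℝ) (π : Equiv.Perm (Fin n)) : pS (fun i => - w i) π = - pS w π := by
  simp [pS]

lemma pS_comp {n : ℕ} (w : Fin n → ℝ) (τ π : Equiv.Perm (Fin n)) : pS (fun i => w (τ i)) (π * τ) = pS w π := by
  unfold pS
  exact Equiv.sum_comp τ (fun i => w i * ((π i : ℕ) : ℝ))

lemma caseB_gen : ∃ C > (0:ℝ), ∀ (n : ℕ) (w : Fin n → ℝ), 2 ≤ n → ∑ i, w i = 0 → ∑ i, w i ^ 2 = 1 → ∀ (δ : ℝ) (i0 : Fin n),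
    0 < δ → |w i0| = δ → (∀ i, |w i| ≤ δ) → Real.exp (1/δ^2/2097152) ≤ (n:ℝ) → ∀ x : ℝ,
    (#{π : Equiv.Perm (Fin n) | |pS w π - x| ≤ 1} : ℝ) ≤
      n.factorial * (C / (n:ℝ)) * Real.exp (-(|x| / (n:ℝ) / 2)) := by
  obtain ⟨C, hC, h⟩ := caseB
  refine ⟨C, hC, ?_⟩
  intro n w hn hw hw2 δ i0 hδ hi0 hwδ hexp x
  obtain ⟨m, rfl⟩ : ∃ m, n = m + 1 := ⟨n - 1, by omega⟩
  have key : ∀ (w : Fin (m+1) → ℝ) (x : ℝ), ∑ i, w i = 0 → ∑ i, w i ^ 2 = 1 → w i0 = δ → (∀ i, |w i| ≤ δ) →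
      (#{π : Equiv.Perm (Fin (m+1)) | |pS w π - x| ≤ 1} : ℝ) ≤
      (m+1).factorial * (C / ((m+1:ℕ):ℝ)) * Real.exp (-(|x| / ((m+1:ℕ):ℝ) / 2)) := by
    intro w x hw hw2 hi hwδ
    set τ : Equiv.Perm (Fin (m+1)) := Equiv.swap 0 i0 with hτ
    have h1 := h m (fun i => w (τ i)) (by omega) (by rw [Equiv.sum_comp τ w]; exact hw)
      (by rw [Equiv.sum_comp τ (fun i => w i ^ 2)]; exact hw2) δ hδ (by simp [hτ, hi]) (fun i => hwδ _) hexp x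
    refine le_trans (le_of_eq ?_) h1
    have := card_map (s := ({π : Equiv.Perm (Fin (m+1)) | |pS w π - x| ≤ 1} : Finset _)) (Equiv.mulRight τ).toEmbedding
    rw [← this]
    congr 2
    ext π
    simp only [mem_map_equiv, mem_filter, mem_univ, true_and]
    have e : pS w ((Equiv.mulRight τ).symm π) = pS (fun i => w (τ i)) π := by
      rw [← pS_comp w τ]; simp
    rw [e]
  rcases abs_choice (w i0) with hc | hc
  · exact key w x hw hw2 (by rw [← hi0, hc]) hwδ
  · have h1 := key (fun i => - w i) (-x) (by simp [hw]) (by simpa using hw2) (by rw [← hi0, hc]) (by simpa using hwδ)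
    rw [abs_neg] at h1
    refine le_trans (le_of_eq ?_) h1
    congr 2
    ext π
    simp only [mem_filter, mem_univ, true_and]
    rw [pS_neg, ← abs_neg (pS w π - x)]
    rw [show -(pS w π - x) = -pS w π - -x by ring]

lemma all_cases : ∃ C > (0:ℝ), ∀ (n : ℕ) (w : Fin n → ℝ), 2 ≤ n → ∑ i, w i = 0 → ∑ i, w i ^ 2 = 1 → ∀ x : ℝ,
    (#{π : Equiv.Perm (Fin n) | |pS w π - x| ≤ 1} : ℝ) ≤
      n.factorial * (C / (n:ℝ)) * Real.exp (-(|x| / (n:ℝ) / 2)) := by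
  obtain ⟨CB, hCB, hB⟩ := caseB_gen
  set C0 : ℝ := 4 * Real.exp 2 * (2 * (1 - Real.exp (-(1/2097152)))⁻¹ + 1) with hC0
  have hC0p : 0 < C0 := by
    have : Real.exp (-(1/2097152)) < 1 := by rw [Real.exp_lt_one_iff]; norm_num
    have : 0 < (1 - Real.exp (-(1/2097152)))⁻¹ := inv_pos.mpr (by linarith)
    positivity
  have he := Real.exp_pos (1/2 + 1)
  refine ⟨CB + C0 + 8 * Real.exp (1/2+1), by positivity, ?_⟩
  intro n w hn hw hw2 x
  have hn0 : (0:ℝ) < n := by positivity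
  have hE : Real.exp (-(|x|/n)) ≤ Real.exp (-(|x|/n/2)) := by
    apply Real.exp_le_exp.mpr
    have : 0 ≤ |x| / n := by positivity
    linarith
  by_cases h8 : 8 ≤ n
  swap
  · have hb := chernoff (by omega : 0 < n) w hw hw2 1 x
    have hmono : (#{π : Equiv.Perm (Fin n) | |pS w π - x| ≤ 1} : ℝ) ≤ #{π : Equiv.Perm (Fin n) | |pS w π - x| ≤ 1 * n} := by
      have : (1:ℝ) ≤ 1 * n := by rw [one_mul]; exact_mod_cast (by omega : 1 ≤ n)
      exact_mod_cast card_le_card (monotone_filter_right _ fun π _ h => le_trans h this)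
    refine hmono.trans (hb.trans ?_)
    gcongr
    rw [le_div_iff₀ hn0]
    have : (n:ℝ) ≤ 8 := by exact_mod_cast (by omega : n ≤ 8)
    nlinarith
  have : Nonempty (Fin n) := ⟨⟨0, by omega⟩⟩
  obtain ⟨i0, _, hi0⟩ := exists_max_image (univ : Finset (Fin n)) (fun i => |w i|) univ_nonempty
  set δ := |w i0| with hδdef
  have hwδ : ∀ i, |w i| ≤ δ := fun i => hi0 i (mem_univ i)
  have hδ : 0 < δ := by
    rcases (abs_nonneg (w i0)).lt_or_eq with h | h
    · exact h
    · exfalso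
      have : ∀ i, w i = 0 := fun i => abs_nonpos_iff.mp ((hwδ i).trans h.symm.le)
      simp [this] at hw2
  by_cases hcase : Real.exp (1/δ^2/2097152) ≤ (n:ℝ)
  · have := hB n w hn hw hw2 δ i0 hδ rfl hwδ hcase x
    refine this.trans ?_
    gcongr
    linarith
  · push Not at hcase
    have hδ2 : δ ≤ 1/2 := by
      by_contra hcon
      push Not at hcon
      have h1 : 1/δ^2/2097152 ≤ 1 := by
        rw [div_div, div_le_one (by positivity)]; nlinarith
      have h2 := Real.exp_le_exp.mpr h1
      have h3 := Real.exp_one_lt_d9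
      have : (8:ℝ) ≤ n := by exact_mod_cast h8
      linarith
    have hb := smallball n n h8 (by omega) le_rfl w hw hw2 δ hδ hδ2 hwδ hcase.le x
    rw [← hC0, div_self hn0.ne'] at hb
    refine hb.trans ?_
    gcongr
    linarith

theorem stmt_5 :
    ∃ C > (0:ℝ), ∃ c > (0:ℝ), ∀ (n : ℕ), 2 ≤ n → ∀ w : Fin n → ℝ,
      (∑ i, w i = 0) → (∑ i, w i ^ 2 = 1) → ∀ L : ℝ,
      ((Finset.univ.filter (fun π : Equiv.Perm (Fin n) =>
          |∑ i, w i * ((π i : ℕ) + 1 : ℝ) - L * n| ≤ 1)).card : ℝ) / (n.factorial : ℝ)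
        ≤ C / n * Real.exp (-c * |L|) := by
  obtain ⟨C, hC, h⟩ := all_cases
  refine ⟨C, hC, 1/2, by norm_num, ?_⟩
  intro n hn w hw hw2 L
  have hn0 : (0:ℝ) < n := by positivity
  have hF : (0:ℝ) < n.factorial := by positivity
  have hp : ∀ π : Equiv.Perm (Fin n), ∑ i, w i * ((π i : ℕ) + 1 : ℝ) = pS w π := by
    intro π
    simp only [mul_add, mul_one, sum_add_distrib, hw, add_zero, pS]
  have h1 := h n w hn hw hw2 (L * n)
  have h2 : -(|L * n| / n / 2) = -(1/2) * |L| := by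
    rw [abs_mul, abs_of_pos hn0]; field_simp
  rw [h2] at h1
  simp only [hp]
  rw [div_le_iff₀ hF]
  refine h1.trans (le_of_eq ?_)
  ring
end
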